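/- arXiv:2208.04830 — 2 statements merged into one kernel-verified Lean document; each statement's English description precedes it below -/
import Mathlib

section
/- There exist absolute constants C, c > 0 such that the following holds. Let p ≡ 3 (mod 4) be a prime and let E ⊆ P_3 ⊆ 𝔽_p^3. If |E| ≥ C p^{5/4}, then |∏(E)| ≥ c p. -/
open Finset

/-- Dot product `x·y = x₁y₁ + ⋯ + xₙyₙ` on `𝔽_q^n`. -/
def dotP {F : Type*} [CommRing F] {n : ℕ} (x y : Fin n → F) : F := ∑ i, x i * y i

/-- The "norm" `‖x‖ = x₁² + ⋯ + xₙ²` on `𝔽_q^n`. -/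
def nrm {F : Type*} [CommRing F] {n : ℕ} (x : Fin n → F) : F := ∑ i, x i * x i

/-- The sphere `S_r = {x ∈ 𝔽_q^n : ‖x‖ = r}`. -/
def sph (F : Type*) [CommRing F] [Fintype F] [DecidableEq F] (n : ℕ) (r : F) :
    Finset (Fin n → F) := Finset.univ.filter fun x => nrm x = r

/-- The dot product set `∏(E) = {x·y : x, y ∈ E}`. -/
def prodSet {F : Type*} [CommRing F] [DecidableEq F] {n : ℕ} (E : Finset (Fin n → F)) :
    Finset F := (E ×ˢ E).image fun p => dotP p.1 p.2

/-- Fourier transform of the indicator function of `X`: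
`X̂(m) = q^{-n} ∑_{x ∈ X} χ(-x·m)`. -/
noncomputable def fourierCoef {F : Type*} [CommRing F] [Fintype F] {n : ℕ}
    (χ : AddChar F ℂ) (X : Finset (Fin n → F)) (m : Fin n → F) : ℂ :=
  ((Fintype.card F : ℂ) ^ n)⁻¹ * ∑ x ∈ X, χ (-(dotP x m))

section Elimination

open MvPolynomial

variable {K : Type*} [Field K]

theorem totalDegree_resultant_le {σ : Type*} (f g : Polynomial (MvPolynomial σ K)) (m n d e : ℕ)
    (hf : ∀ i, (f.coeff i).totalDegree ≤ d) (hg : ∀ i, (g.coeff i).totalDegree ≤ e) :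
    (f.resultant g m n).totalDegree ≤ m * e + n * d := by
  rw [Polynomial.resultant, Matrix.det_apply]
  refine totalDegree_finsetSum_le fun τ _ => ?_
  refine (totalDegree_smul_le _ _).trans ?_
  refine (totalDegree_finsetProd _ _).trans ?_
  rw [Fin.sum_univ_add]
  refine add_le_add ?_ ?_
  · refine (Finset.sum_le_card_nsmul _ _ e fun i _ => ?_).trans (by simp)
    simp only [Polynomial.sylvester, Matrix.of_apply, Fin.addCases_left]
    split_ifs
    · exact hg _
    · simp
  · refine (Finset.sum_le_card_nsmul _ _ d fun i _ => ?_).trans (by simp)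
    simp only [Polynomial.sylvester, Matrix.of_apply, Fin.addCases_right]
    split_ifs
    · exact hf _
    · simp

theorem totalDegree_coeff_finSuccEquiv_le {n : ℕ} (f : MvPolynomial (Fin (n + 1)) K) (i : ℕ) :
    ((finSuccEquiv K n f).coeff i).totalDegree ≤ f.totalDegree := by
  by_cases h : (finSuccEquiv K n f).coeff i = 0
  · simp [h]
  · exact (Nat.le_add_right _ i).trans (totalDegree_coeff_finSuccEquiv_add_le f i h)

theorem natDegree_finSuccEquiv_le {n : ℕ} (f : MvPolynomial (Fin (n + 1)) K) :
    (finSuccEquiv K n f).natDegree ≤ f.totalDegree := by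
  rw [natDegree_finSuccEquiv]
  exact degreeOf_le_totalDegree f 0

theorem finSuccEquiv_pderiv_zero {n : ℕ} (f : MvPolynomial (Fin (n + 1)) K) :
    finSuccEquiv K n (pderiv 0 f) = Polynomial.derivative (finSuccEquiv K n f) := by
  induction f using MvPolynomial.induction_on with
  | C a => simp [finSuccEquiv_apply]
  | add p q hp hq => simp [hp, hq]
  | mul_X p i hp =>
    rw [Derivation.leibniz, map_add, smul_eq_mul, smul_eq_mul, map_mul, map_mul, hp, map_mul,
      Polynomial.derivative_mul]
    refine Fin.cases ?_ (fun j => ?_) i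
    · simp [finSuccEquiv_X_zero]; ring
    · simp [finSuccEquiv_X_succ, pderiv_X_of_ne (Fin.succ_ne_zero j)]; ring

theorem natDegree_eq_zero_of_derivative_eq_zero_of_lt {R : Type*} [CommRing R] [IsDomain R]
    (p : ℕ) [CharP R p] (f : Polynomial R) (hd : f.natDegree < p)
    (h : Polynomial.derivative f = 0) : f.natDegree = 0 := by
  by_contra hn
  obtain ⟨k, hk⟩ := Nat.exists_eq_succ_of_ne_zero hn
  have h1 := congrArg (fun q => Polynomial.coeff q k) h
  simp only [Polynomial.coeff_derivative, Polynomial.coeff_zero, mul_eq_zero] at h1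
  rcases h1 with h1 | h1
  · have : f = 0 := by
      rw [← Polynomial.leadingCoeff_eq_zero, Polynomial.leadingCoeff, hk]; exact h1
    simp [this] at hn
  · have h2 : ((k + 1 : ℕ) : R) = 0 := by push_cast; exact h1
    rw [CharP.cast_eq_zero_iff R p] at h2
    exact absurd (Nat.le_of_dvd (by omega) h2) (by omega)

/-- Elimination of the first variable from an irreducible polynomial and a polynomial
which it does not divide. -/
theorem exists_elimination {n : ℕ} (p : ℕ) [CharP K p] (F H : MvPolynomial (Fin (n + 1)) K)
    (hF : Irreducible F) (hdeg : F.totalDegree < p)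
    (hH : pderiv 0 F = 0 ∨ ¬ F ∣ H) :
    ∃ h : MvPolynomial (Fin n) K, h ≠ 0 ∧
      h.totalDegree ≤ F.totalDegree * (2 * H.totalDegree + 1) ∧
      ∀ (x : K) (y : Fin n → K), eval (Fin.cons x y) F = 0 → eval (Fin.cons x y) H = 0 →
        eval y h = 0 := by
  set f := finSuccEquiv K n F with hf
  set g := finSuccEquiv K n H with hg
  have hf0 : f ≠ 0 := by simpa [hf] using hF.ne_zero
  by_cases hfn : f.natDegree = 0
  · rw [Polynomial.natDegree_eq_zero] at hfn
    obtain ⟨h, hh⟩ := hfn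
    refine ⟨h, ?_, ?_, ?_⟩
    · rintro rfl; exact hf0 (by simpa using hh.symm)
    · have := totalDegree_coeff_finSuccEquiv_le F 0
      rw [← hf, ← hh, Polynomial.coeff_C_zero] at this
      exact this.trans (Nat.le_mul_of_pos_right _ (by omega))
    · intro x y hx _
      rw [eval_eq_eval_mv_eval', ← hf, ← hh] at hx
      simpa using hx
  have hndvd : ¬ F ∣ H := by
    refine hH.resolve_left fun h0 => hfn ?_
    refine natDegree_eq_zero_of_derivative_eq_zero_of_lt p f
      ((natDegree_finSuccEquiv_le F).trans_lt hdeg) ?_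
    rw [hf, ← finSuccEquiv_pderiv_zero, h0, map_zero]
  have hfirr : Irreducible f := (MulEquiv.irreducible_iff (finSuccEquiv K n)).2 hF
  have hfg : ¬ f ∣ g := by
    intro hd
    exact hndvd ((map_dvd_iff (finSuccEquiv K n)).1 hd)
  have hprim := hfirr.isPrimitive hfn
  let L := FractionRing (MvPolynomial (Fin n) K)
  have hinj : Function.Injective (algebraMap (MvPolynomial (Fin n) K) L) :=
    IsFractionRing.injective _ _
  have hcop : IsCoprime (f.map (algebraMap _ L)) (g.map (algebraMap _ L)) := by
    have h1 := (hprim.irreducible_iff_irreducible_map_fraction_map (K := L)).1 hfirr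
    refine (h1.coprime_iff_not_dvd).2 fun h2 => hfg ?_
    exact (hprim.dvd_iff_fraction_map_dvd_fraction_map L).2 h2
  have hres := Polynomial.resultant_ne_zero _ _ hcop
  rw [Polynomial.natDegree_map_eq_of_injective hinj, Polynomial.natDegree_map_eq_of_injective hinj,
    Polynomial.resultant_map_map] at hres
  refine ⟨f.resultant g, fun h0 => hres (by rw [h0, map_zero]), ?_, ?_⟩
  · refine (totalDegree_resultant_le f g _ _ F.totalDegree H.totalDegree
      (totalDegree_coeff_finSuccEquiv_le F) (totalDegree_coeff_finSuccEquiv_le H)).trans ?_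
    have h1 : f.natDegree ≤ F.totalDegree := natDegree_finSuccEquiv_le F
    have h2 : g.natDegree ≤ H.totalDegree := natDegree_finSuccEquiv_le H
    nlinarith
  · intro x y hx hy
    obtain ⟨a, b, -, -, hab⟩ := Polynomial.exists_mul_add_mul_eq_C_resultant f g le_rfl le_rfl
      (Or.inl hfn)
    rw [eval_eq_eval_mv_eval', ← hf] at hx
    rw [eval_eq_eval_mv_eval', ← hg] at hy
    have := congrArg (fun q => Polynomial.eval x (Polynomial.map (eval y) q)) hab
    simpa [hx, hy] using this.symm

end Elimination

section Chain

open MvPolynomial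

variable {K : Type*} [Field K]

theorem totalDegree_pderiv_le {σ : Type*} (i : σ) (F : MvPolynomial σ K) :
    (pderiv i F).totalDegree ≤ F.totalDegree := by
  classical
  refine Finset.sup_le fun m hm => ?_
  have h1 : m + Finsupp.single i 1 ∈ F.support := by
    rw [mem_support_iff] at hm ⊢
    intro h0
    exact hm (by rw [coeff_pderiv, h0, zero_mul])
  refine le_trans ?_ (le_totalDegree h1)
  rw [Finsupp.sum_add_index' (fun _ => rfl) (fun _ _ _ => rfl)]
  exact Nat.le_add_right _ _

theorem derivation_aeval {σ B : Type*} [Fintype σ] [CommRing B] [Algebra K B]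
    (D : B →+ B) (hL : ∀ a b, D (a * b) = a * D b + b * D a)
    (hD : ∀ k, D (algebraMap K B k) = 0) (g : σ → B)
    (H : MvPolynomial σ K) :
    D (aeval g H) = ∑ i, aeval g (pderiv i H) * D (g i) := by
  classical
  induction H using MvPolynomial.induction_on with
  | C a => simp [hD]
  | add p q hp hq => simp [hp, hq, add_mul, Finset.sum_add_distrib]
  | mul_X p j hp =>
    rw [map_mul, hL, hp, aeval_X]
    simp only [Derivation.leibniz, map_add, smul_eq_mul, map_mul, aeval_X, add_mul,
      Finset.sum_add_distrib, pderiv_X]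
    congr 1
    · rw [Finset.sum_eq_single j]
      · simp
      · intro b _ hb; simp [hb]
      · simp
    · rw [Finset.mul_sum]
      exact Finset.sum_congr rfl fun i _ => by ring

/-- The directional derivative `F_x ∂_z - F_z ∂_x` along the level curves of `F` in planes
`y = const`. -/
noncomputable def levelDer (F : MvPolynomial (Fin 3) K) :
    Derivation K (MvPolynomial (Fin 3) K) (MvPolynomial (Fin 3) K) :=
  pderiv 0 F • pderiv 2 - pderiv 2 F • pderiv 0

/-- The polynomial expressing that the level curves of `F` in planes `y = const` have a flex. -/
noncomputable def flexPoly (F : MvPolynomial (Fin 3) K) : MvPolynomial (Fin 3) K :=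
  pderiv 0 F * levelDer F (pderiv 2 F) - pderiv 2 F * levelDer F (pderiv 0 F)

theorem levelDer_apply (F H : MvPolynomial (Fin 3) K) :
    levelDer F H = pderiv 0 F * pderiv 2 H - pderiv 2 F * pderiv 0 H := by
  simp [levelDer]

theorem levelDer_self (F : MvPolynomial (Fin 3) K) : levelDer F F = 0 := by
  rw [levelDer_apply]; ring

theorem totalDegree_mul_le_of_le {σ : Type*} {P Q : MvPolynomial σ K} {a b : ℕ}
    (hP : P.totalDegree ≤ a) (hQ : Q.totalDegree ≤ b) : (P * Q).totalDegree ≤ a + b :=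
  (totalDegree_mul P Q).trans (add_le_add hP hQ)

theorem totalDegree_sub_le_of_le {σ : Type*} {P Q : MvPolynomial σ K} {a : ℕ}
    (hP : P.totalDegree ≤ a) (hQ : Q.totalDegree ≤ a) : (P - Q).totalDegree ≤ a :=
  (totalDegree_sub P Q).trans (max_le hP hQ)

theorem totalDegree_levelDer_le (F H : MvPolynomial (Fin 3) K) :
    (levelDer F H).totalDegree ≤ F.totalDegree + H.totalDegree := by
  rw [levelDer_apply]
  exact totalDegree_sub_le_of_le
    (totalDegree_mul_le_of_le (totalDegree_pderiv_le _ _) (totalDegree_pderiv_le _ _))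
    (totalDegree_mul_le_of_le (totalDegree_pderiv_le _ _) (totalDegree_pderiv_le _ _))

theorem totalDegree_flexPoly_le (F : MvPolynomial (Fin 3) K) :
    (flexPoly F).totalDegree ≤ 3 * F.totalDegree := by
  have h : ∀ i j, (pderiv i F * levelDer F (pderiv j F)).totalDegree ≤ 3 * F.totalDegree := by
    intro i j
    refine (totalDegree_mul_le_of_le (totalDegree_pderiv_le i F)
      ((totalDegree_levelDer_le F _).trans
        (add_le_add le_rfl (totalDegree_pderiv_le j F)))).trans ?_
    omega
  exact totalDegree_sub_le_of_le (h _ _) (h _ _)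

/-- Restriction of a polynomial to the line `a + t b` over a `K`-algebra `A`. -/
noncomputable def lineRestrict {σ A : Type*} [CommRing A] [Algebra K A] (a b : σ → A) :
    MvPolynomial σ K →ₐ[K] Polynomial A :=
  aeval fun i => Polynomial.C (a i) + Polynomial.C (b i) * Polynomial.X

theorem derivative_lineRestrict {σ A : Type*} [Fintype σ] [CommRing A] [Algebra K A]
    (a b : σ → A) (H : MvPolynomial σ K) :
    Polynomial.derivative (lineRestrict a b H) =
      ∑ i, Polynomial.C (b i) * lineRestrict a b (pderiv i H) := by
  have h := derivation_aeval (K := K)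
    (Polynomial.derivative (R := A)).toAddMonoidHom
    (fun a b => by simp; ring) (fun k => Polynomial.derivative_C)
    (fun i => Polynomial.C (a i) + Polynomial.C (b i) * Polynomial.X) H
  refine h.trans (Finset.sum_congr rfl fun i _ => ?_)
  change _ * Polynomial.derivative _ = _
  rw [mul_comm, lineRestrict]
  simp

theorem eval_lineRestrict {σ : Type*} (a b : σ → K) (H : MvPolynomial σ K) (t : K) :
    (lineRestrict a b H).eval t = eval (fun i => a i + b i * t) H := by
  induction H using MvPolynomial.induction_on with
  | C a => simp [lineRestrict]
  | add p q hp hq => simp [hp, hq]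
  | mul_X p i hp => simp [hp]; simp [lineRestrict]

theorem natDegree_lineRestrict_le {σ A : Type*} [CommRing A] [Algebra K A]
    (a b : σ → A) (H : MvPolynomial σ K) :
    (lineRestrict a b H).natDegree ≤ H.totalDegree := by
  rw [lineRestrict, aeval_def, eval₂_eq]
  refine Polynomial.natDegree_sum_le_of_forall_le _ _ fun m hm => ?_
  refine le_trans ?_ (le_totalDegree hm)
  refine (Polynomial.natDegree_C_mul_le _ _).trans ?_
  refine (Polynomial.natDegree_prod_le _ _).trans ?_
  refine Finset.sum_le_sum fun i _ => ?_
  refine Polynomial.natDegree_pow_le.trans ?_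
  refine (Nat.mul_le_mul_left _ (?_ : _ ≤ 1)).trans (by simp)
  compute_degree

theorem coeff_zero_lineRestrict {σ A : Type*} [CommRing A] [Algebra K A]
    (a b : σ → A) (H : MvPolynomial σ K) :
    (lineRestrict a b H).coeff 0 = aeval a H := by
  induction H using MvPolynomial.induction_on with
  | C a => simp [lineRestrict, Polynomial.algebraMap_apply]
  | add p q hp hq => simp [hp, hq]
  | mul_X p i hp => rw [map_mul, Polynomial.mul_coeff_zero, hp]; simp [lineRestrict]

/-- If a polynomial vanishes at more points of a line than its degree, it vanishes on the line. -/
theorem lineRestrict_eq_zero_of_card {σ : Type*} (a b : σ → K) (H : MvPolynomial σ K)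
    (s : Finset K) (hs : ∀ t ∈ s, eval (fun i => a i + b i * t) H = 0)
    (hcard : H.totalDegree < s.card) : lineRestrict a b H = 0 := by
  refine Polynomial.eq_zero_of_natDegree_lt_card_of_eval_eq_zero' _ s (fun t ht => ?_)
    ((natDegree_lineRestrict_le a b H).trans_lt hcard)
  rw [eval_lineRestrict, hs t ht]

theorem lineRestrict_eq_zero_iff [Infinite K] {σ : Type*} (a b : σ → K) (H : MvPolynomial σ K) :
    lineRestrict a b H = 0 ↔ ∀ t, eval (fun i => a i + b i * t) H = 0 := by
  constructor
  · intro h t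
    rw [← eval_lineRestrict, h, Polynomial.eval_zero]
  · intro h
    refine Polynomial.funext fun t => ?_
    rw [eval_lineRestrict, h, Polynomial.eval_zero]

theorem lineRestrict_directional_eq_zero {σ : Type*} [Fintype σ] (a b : σ → K)
    (H : MvPolynomial σ K) (h : lineRestrict a b H = 0) :
    lineRestrict a b (∑ i, C (b i) * pderiv i H) = 0 := by
  have := derivative_lineRestrict a b H
  rw [h, Polynomial.derivative_zero] at this
  rw [this, map_sum]
  refine Finset.sum_congr rfl fun i _ => ?_
  rw [map_mul]
  congr 1
  simp [lineRestrict, Polynomial.algebraMap_eq]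

theorem exists_coefficientwise_derivation {A : Type*} [CommRing A] (δ : Derivation ℤ A A) :
    ∃ D : Polynomial A →+ Polynomial A, (∀ a b, D (a * b) = a * D b + b * D a) ∧
      (∀ a, D (Polynomial.C a) = Polynomial.C (δ a)) ∧ D Polynomial.X = 0 ∧
      ∀ q i, (D q).coeff i = δ (q.coeff i) := by
  let _ : Differential A := ⟨δ⟩
  refine ⟨(Differential.mapCoeffs : Derivation ℤ (Polynomial A) (Polynomial A)).toLinearMap,
    fun a b => ?_, fun a => ?_, ?_, fun q i => ?_⟩
  · exact Derivation.leibniz (Differential.mapCoeffs (A := A)) a b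
  · exact Differential.mapCoeffs_C a
  · exact Differential.mapCoeffs_X
  · exact Differential.coeff_mapCoeffs q i

theorem dvd_coeff_of_dvd_flexPoly (p : ℕ) [CharP K p] (F : MvPolynomial (Fin 3) K)
    (hF : Prime F) (hdeg : F.totalDegree < p) (hx : ¬ F ∣ pderiv 0 F) (hG : F ∣ flexPoly F)
    (j : ℕ) :
    F ∣ (lineRestrict (A := MvPolynomial (Fin 3) K) X ![-pderiv 2 F, 0, pderiv 0 F] F).coeff j := by
  obtain ⟨Φ, hΦ⟩ : ∃ Φ, Φ = lineRestrict (K := K) (A := MvPolynomial (Fin 3) K) X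
    ![-pderiv 2 F, 0, pderiv 0 F] := ⟨_, rfl⟩
  rw [← hΦ]
  obtain ⟨D, hDmul, hDC, hDX, hDcoeff⟩ :=
    exists_coefficientwise_derivation ((levelDer F).restrictScalars ℤ)
  replace hDC : ∀ a, D (Polynomial.C a) = Polynomial.C (levelDer F a) := hDC
  replace hDcoeff : ∀ q i, (D q).coeff i = levelDer F (q.coeff i) := hDcoeff
  have hX : ∀ i j : Fin 3, pderiv i (X j : MvPolynomial (Fin 3) K) = if i = j then 1 else 0 := by
    intro i j
    rw [pderiv_X, Pi.single_apply]
    simp [eq_comm]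
  have h1 : D (Φ F) =
      (-Polynomial.C (pderiv 2 F) - Polynomial.C (levelDer F (pderiv 2 F)) * Polynomial.X)
        * Φ (pderiv 0 F) +
      (Polynomial.C (pderiv 0 F) + Polynomial.C (levelDer F (pderiv 0 F)) * Polynomial.X)
        * Φ (pderiv 2 F) := by
    rw [hΦ, lineRestrict]
    refine (derivation_aeval (K := K) D hDmul ?_ _ F).trans ?_
    swap
    · rw [Fin.sum_univ_three]
      simp only [map_add, hDmul, hDC, hDX]
      simp [levelDer_apply, hX]
      ring
    · intro k
      rw [Polynomial.algebraMap_apply, hDC, Derivation.map_algebraMap,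
        Polynomial.C_0]
  have h2 := derivative_lineRestrict (A := MvPolynomial (Fin 3) K) X ![-pderiv 2 F, 0, pderiv 0 F] F
  rw [Fin.sum_univ_three, ← hΦ] at h2
  simp only [Matrix.cons_val_zero, Matrix.cons_val_one, Matrix.cons_val, map_neg, map_zero,
    zero_mul, add_zero] at h2
  have h3 : Polynomial.C (pderiv 0 F) * D (Φ F) =
      Polynomial.C (pderiv 0 F) * Polynomial.derivative (Φ F) +
      Polynomial.C (levelDer F (pderiv 0 F)) * (Polynomial.derivative (Φ F) * Polynomial.X) -
      Polynomial.C (flexPoly F) * (Φ (pderiv 0 F) * Polynomial.X) := by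
    rw [h1, h2, flexPoly]
    simp only [map_sub, map_mul]
    ring
  induction j with
  | zero =>
    rw [hΦ, coeff_zero_lineRestrict, aeval_X_left_apply]
  | succ j ih =>
    have h4 := congrArg (fun q => Polynomial.coeff q j) h3
    simp only [Polynomial.coeff_sub, Polynomial.coeff_add, Polynomial.coeff_C_mul,
      hDcoeff, Polynomial.coeff_derivative] at h4
    have h5 : F ∣ levelDer F ((Φ F).coeff j) := by
      obtain ⟨q, hq⟩ := ih
      rw [hq, Derivation.leibniz, levelDer_self, smul_zero, add_zero]
      exact dvd_mul_right _ _
    have h6 : F ∣ (Polynomial.derivative (Φ F) * Polynomial.X).coeff j := by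
      rcases j with _ | j
      · simp
      · rw [Polynomial.coeff_mul_X, Polynomial.coeff_derivative]
        exact ih.mul_right _
    have h7 : F ∣ pderiv 0 F * ((Φ F).coeff (j + 1) * ((j : MvPolynomial (Fin 3) K) + 1)) := by
      have : pderiv 0 F * ((Φ F).coeff (j + 1) * ((j : MvPolynomial (Fin 3) K) + 1)) =
        pderiv 0 F * levelDer F ((Φ F).coeff j) - levelDer F (pderiv 0 F) *
          (Polynomial.derivative (Φ F) * Polynomial.X).coeff j +
          flexPoly F * (Φ (pderiv 0 F) * Polynomial.X).coeff j := by rw [h4]; ring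
      rw [this]
      exact ((h5.mul_left _).sub (h6.mul_left _)).add (hG.mul_right _)
    have h8 := (hF.dvd_mul.1 h7).resolve_left hx
    by_cases hj : (Φ F).coeff (j + 1) = 0
    · rw [hj]; exact dvd_zero _
    refine (hF.dvd_mul.1 h8).resolve_right fun h9 => hF.not_isUnit ?_
    refine isUnit_of_dvd_unit h9 ?_
    have hnat : (Φ F).natDegree ≤ F.totalDegree := by
      rw [hΦ]
      exact natDegree_lineRestrict_le _ _ _
    have hlt : j + 1 < p := ((Polynomial.le_natDegree_of_ne_zero hj).trans hnat).trans_lt hdeg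
    have h10 : ((j + 1 : ℕ) : K) ≠ 0 := by
      rw [Ne, CharP.cast_eq_zero_iff K p]
      exact fun h => absurd (Nat.le_of_dvd (by omega) h) (by omega)
    have h11 := (isUnit_iff_ne_zero.2 h10).map (C : K →+* MvPolynomial (Fin 3) K)
    simpa using h11

end Chain

section Lines

open MvPolynomial

variable {K : Type*} [Field K]

theorem map_eval_lineRestrict {σ : Type*} (b : σ → MvPolynomial σ K) (q : σ → K)
    (H : MvPolynomial σ K) :
    (lineRestrict X b H).map (eval q) = lineRestrict q (fun i => eval q (b i)) H := by
  induction H using MvPolynomial.induction_on with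
  | C a => simp [lineRestrict, Polynomial.algebraMap_apply]
  | add p q hp hq => simp [hp, hq]
  | mul_X p i hp => rw [map_mul, Polynomial.map_mul, hp, map_mul]; simp [lineRestrict]

/-- Level curves of an irreducible surface dividing its flex polynomial are unions of lines. -/
theorem eval_tangent_line_eq_zero (p : ℕ) [CharP K p] (F : MvPolynomial (Fin 3) K)
    (hF : Prime F) (hdeg : F.totalDegree < p) (hx : ¬ F ∣ pderiv 0 F) (hG : F ∣ flexPoly F)
    (q : Fin 3 → K) (hq : eval q F = 0) (S : K) :
    eval ![q 0 - eval q (pderiv 2 F) * S, q 1, q 2 + eval q (pderiv 0 F) * S] F = 0 := by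
  have h1 := map_eval_lineRestrict ![-pderiv 2 F, 0, pderiv 0 F] q F
  have h2 : (lineRestrict (A := MvPolynomial (Fin 3) K) X ![-pderiv 2 F, 0, pderiv 0 F] F).map
      (eval q) = 0 := by
    ext j
    obtain ⟨r, hr⟩ := dvd_coeff_of_dvd_flexPoly p F hF hdeg hx hG j
    rw [Polynomial.coeff_map, hr, map_mul, hq, zero_mul, Polynomial.coeff_zero]
  rw [h2] at h1
  have h3 := eval_lineRestrict q (fun i => eval q ((![-pderiv 2 F, 0, pderiv 0 F] :
    Fin 3 → MvPolynomial (Fin 3) K) i)) F S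
  rw [← h1, Polynomial.eval_zero] at h3
  rw [h3]
  congr 2
  ext i
  fin_cases i <;> simp [sub_eq_add_neg]

/-- The line of the first kind with parameters `u = (α, β, c)`:
the points `(α + β t, t, c)`. -/
def redPt (u : K × K × K) (t : K) : Fin 3 → K := ![u.1 + u.2.1 * t, t, u.2.2]

/-- The line of the second kind with parameters `v = (γ, δ, e)`:
the points `(γ + δ t, e, t)`. -/
def bluePt (v : K × K × K) (t : K) : Fin 3 → K := ![v.1 + v.2.1 * t, v.2.2, t]

/-- The lines with parameters `u` and `v`, of the first and of the second kind, meet. -/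
def Meets (u v : K × K × K) : Prop := u.1 + u.2.1 * v.2.2 = v.1 + v.2.1 * u.2.2

theorem Meets.symm {u v : K × K × K} (h : Meets u v) : Meets v u := Eq.symm h

theorem Meets.redPt_eq {u v : K × K × K} (h : Meets u v) :
    redPt u v.2.2 = bluePt v u.2.2 := by
  rw [redPt, bluePt, h]

theorem redPt_eq_line (u : K × K × K) (t : K) :
    redPt u t = fun i => ![u.1, 0, u.2.2] i + ![u.2.1, 1, 0] i * t := by
  ext i; fin_cases i <;> simp [redPt]

theorem bluePt_eq_line (v : K × K × K) (t : K) :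
    bluePt v t = fun i => ![v.1, v.2.2, 0] i + ![v.2.1, 0, 1] i * t := by
  ext i; fin_cases i <;> simp [bluePt]

theorem eval_redPt_eq_zero_of_card (u : K × K × K) (H : MvPolynomial (Fin 3) K)
    (s : Finset K) (hs : ∀ t ∈ s, eval (redPt u t) H = 0)
    (hcard : H.totalDegree < s.card) (t : K) : eval (redPt u t) H = 0 := by
  rw [redPt_eq_line, ← eval_lineRestrict, lineRestrict_eq_zero_of_card _ _ H s _ hcard,
    Polynomial.eval_zero]
  intro t ht
  rw [← redPt_eq_line, hs t ht]

theorem eval_bluePt_eq_zero_of_card (v : K × K × K) (H : MvPolynomial (Fin 3) K)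
    (s : Finset K) (hs : ∀ t ∈ s, eval (bluePt v t) H = 0)
    (hcard : H.totalDegree < s.card) (t : K) : eval (bluePt v t) H = 0 := by
  rw [bluePt_eq_line, ← eval_lineRestrict, lineRestrict_eq_zero_of_card _ _ H s _ hcard,
    Polynomial.eval_zero]
  intro t ht
  rw [← bluePt_eq_line, hs t ht]

section Infinite

variable [Infinite K]

theorem eval_bluePt_directional (v : K × K × K) (H : MvPolynomial (Fin 3) K)
    (h : ∀ t, eval (bluePt v t) H = 0) (t : K) :
    v.2.1 * eval (bluePt v t) (pderiv 0 H) + eval (bluePt v t) (pderiv 2 H) = 0 := by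
  simp only [bluePt_eq_line] at h ⊢
  rw [← lineRestrict_eq_zero_iff] at h
  have h1 := lineRestrict_directional_eq_zero _ _ H h
  rw [lineRestrict_eq_zero_iff] at h1
  simpa [Fin.sum_univ_three] using h1 t

theorem eval_bluePt_flexPoly (v : K × K × K) (F : MvPolynomial (Fin 3) K)
    (h : ∀ t, eval (bluePt v t) F = 0) (t : K) : eval (bluePt v t) (flexPoly F) = 0 := by
  have h1 := eval_bluePt_directional v F h
  have h2 := eval_bluePt_directional v (C v.2.1 * pderiv 0 F + pderiv 2 F)
    (fun t => by simpa using h1 t) t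
  have h1 := h1 t
  simp only [flexPoly, levelDer_apply, map_add, map_sub, map_mul, Derivation.leibniz,
    pderiv_C, smul_eq_mul, eval_C, mul_zero, add_zero] at h2 ⊢
  have h3 : eval (bluePt v t) (pderiv 2 F) = - (v.2.1 * eval (bluePt v t) (pderiv 0 F)) := by
    linear_combination h1
  rw [h3]
  linear_combination (eval (bluePt v t) (pderiv 0 F)) ^ 2 * h2

end Infinite

/-- The polynomial `m(y) (x - α - β y) - n(y) (z - c)`. -/
noncomputable def rulingPoly (u : K × K × K) (m n : Polynomial K) : MvPolynomial (Fin 3) K :=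
  Polynomial.aeval (X 1) m * (X 0 - C u.1 - C u.2.1 * X 1) -
    Polynomial.aeval (X 1) n * (X 2 - C u.2.2)

theorem eval_rulingPoly (u : K × K × K) (m n : Polynomial K) (q : Fin 3 → K) :
    eval q (rulingPoly u m n) = m.eval (q 1) * (q 0 - u.1 - u.2.1 * q 1) -
      n.eval (q 1) * (q 2 - u.2.2) := by
  have h : ∀ m : Polynomial K, eval q (Polynomial.aeval (X 1 : MvPolynomial (Fin 3) K) m) =
      m.eval (q 1) := by
    intro m
    have := Polynomial.hom_eval₂ m (algebraMap K (MvPolynomial (Fin 3) K)) (eval q) (X 1)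
    rw [Polynomial.aeval_def, this]
    simp only [eval_X, algebraMap_eq]
    rw [Polynomial.eval, show (eval q).comp C = RingHom.id K from RingHom.ext fun x => by simp]
  simp [rulingPoly, h]

theorem meets_of_dvd_rulingPoly (F : MvPolynomial (Fin 3) K) (hF : Prime F)
    (u v : K × K × K) (hu : ∀ t, eval (redPt u t) F = 0) (hv : ∀ t, eval (bluePt v t) F = 0)
    (m n : Polynomial K) (hm : m ≠ 0) (hd : F ∣ rulingPoly u m n) : Meets u v := by
  induction hk : m.natDegree generalizing m n with
  | zero =>
    obtain ⟨r, hr⟩ := hd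
    have h1 := congrArg (eval (bluePt v u.2.2)) hr
    rw [map_mul, hv, zero_mul, eval_rulingPoly] at h1
    rw [Polynomial.natDegree_eq_zero] at hk
    obtain ⟨a, rfl⟩ := hk
    have ha : a ≠ 0 := by rintro rfl; simp at hm
    simp [bluePt, ha] at h1
    rw [Meets]
    linear_combination -h1
  | succ k ih =>
    obtain ⟨r, hr⟩ := hd
    have h1 : ∀ t, m.eval v.2.2 * (v.1 + v.2.1 * t - u.1 - u.2.1 * v.2.2) -
        n.eval v.2.2 * (t - u.2.2) = 0 := by
      intro t
      have h1 := congrArg (eval (bluePt v t)) hr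
      rw [map_mul, hv, zero_mul, eval_rulingPoly] at h1
      simpa [bluePt] using h1
    by_cases hme : m.eval v.2.2 = 0
    · have hne : n.eval v.2.2 = 0 := by
        have := h1 (u.2.2 + 1)
        rw [hme] at this
        linear_combination -this
      obtain ⟨m', rfl⟩ := Polynomial.dvd_iff_isRoot.2 hme
      obtain ⟨n', rfl⟩ := Polynomial.dvd_iff_isRoot.2 hne
      have hm' : m' ≠ 0 := right_ne_zero_of_mul hm
      have h2 : rulingPoly u ((Polynomial.X - Polynomial.C v.2.2) * m')
          ((Polynomial.X - Polynomial.C v.2.2) * n') =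
          (X 1 - C v.2.2) * rulingPoly u m' n' := by
        simp only [rulingPoly, map_mul, map_sub, Polynomial.aeval_X, Polynomial.aeval_C,
          algebraMap_eq]
        ring
      have h3 : F ∣ (X 1 - C v.2.2) * rulingPoly u m' n' := h2 ▸ ⟨r, hr⟩
      refine ih m' n' hm' ((hF.dvd_mul.1 h3).resolve_left ?_) ?_
      · rintro ⟨s, hs⟩
        have := congrArg (eval (redPt u (v.2.2 + 1))) hs
        rw [map_mul, hu] at this
        simp [redPt] at this
      · rw [Polynomial.natDegree_mul (Polynomial.X_sub_C_ne_zero _) hm',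
          Polynomial.natDegree_X_sub_C] at hk
        omega
    · rw [Meets]
      have h2 := h1 u.2.2
      simp only [sub_self, mul_zero, sub_zero, mul_eq_zero, hme, false_or] at h2
      linear_combination -h2

variable [Infinite K]

/-- On an irreducible surface dividing its flex polynomial, every line of the first kind
on which `F_x` does not vanish identically meets every line of the second kind. -/
theorem meets_of_dvd_flexPoly (p : ℕ) [CharP K p] (F : MvPolynomial (Fin 3) K)
    (hF : Prime F) (hdeg : F.totalDegree < p) (hG : F ∣ flexPoly F)
    (u v : K × K × K) (hu : ∀ t, eval (redPt u t) F = 0) (hv : ∀ t, eval (bluePt v t) F = 0)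
    (hux : ∃ t, eval (redPt u t) (pderiv 0 F) ≠ 0) : Meets u v := by
  have hx : ¬ F ∣ pderiv 0 F := by
    rintro ⟨r, hr⟩
    obtain ⟨t, ht⟩ := hux
    exact ht (by rw [hr, map_mul, hu, zero_mul])
  set m := lineRestrict ![u.1, 0, u.2.2] ![u.2.1, 1, 0] (pderiv 0 F) with hm
  set n := -lineRestrict ![u.1, 0, u.2.2] ![u.2.1, 1, 0] (pderiv 2 F) with hn
  have hmev : ∀ t, m.eval t = eval (redPt u t) (pderiv 0 F) := by
    intro t; rw [hm, eval_lineRestrict, redPt_eq_line]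
  have hnev : ∀ t, n.eval t = -eval (redPt u t) (pderiv 2 F) := by
    intro t; rw [hn, Polynomial.eval_neg, eval_lineRestrict, redPt_eq_line]
  have hm0 : m ≠ 0 := by
    intro h0
    obtain ⟨t, ht⟩ := hux
    exact ht (by rw [← hmev, h0, Polynomial.eval_zero])
  refine meets_of_dvd_rulingPoly F hF u v hu hv m n hm0 ?_
  by_contra hnd
  obtain ⟨h, h0, -, hh⟩ := exists_elimination p F (rulingPoly u m n) hF.irreducible hdeg (Or.inr hnd)
  have key : ∀ t S, eval ![t, u.2.2 + m.eval t * S] h = 0 := by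
    intro t S
    refine hh (u.1 + u.2.1 * t + n.eval t * S) _ ?_ ?_
    · have := eval_tangent_line_eq_zero p F hF hdeg hx hG (redPt u t) (hu t) S
      rw [← hmev, ← neg_eq_iff_eq_neg.2 (hnev t)] at this
      have h2 : (Fin.cons (u.1 + u.2.1 * t + n.eval t * S) ![t, u.2.2 + m.eval t * S] :
          Fin 3 → K) = ![redPt u t 0 - -n.eval t * S, redPt u t 1, redPt u t 2 + m.eval t * S] := by
        ext i
        fin_cases i <;> simp [redPt]
      rw [h2, this]
    · rw [eval_rulingPoly]
      change m.eval t * (u.1 + u.2.1 * t + n.eval t * S - u.1 - u.2.1 * t) -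
        n.eval t * (u.2.2 + m.eval t * S - u.2.2) = 0
      ring
  have hprod : Polynomial.aeval (X 0 : MvPolynomial (Fin 2) K) m * h = 0 := by
    refine MvPolynomial.funext fun q => ?_
    have hq : eval q (Polynomial.aeval (X 0 : MvPolynomial (Fin 2) K) m) = m.eval (q 0) := by
      have := Polynomial.hom_eval₂ m (algebraMap K (MvPolynomial (Fin 2) K)) (eval q) (X 0)
      rw [Polynomial.aeval_def, this]
      simp only [eval_X, algebraMap_eq]
      rw [Polynomial.eval, show (eval q).comp C = RingHom.id K from RingHom.ext fun x => by simp]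
    rw [map_mul, map_zero, hq]
    by_cases hmq : m.eval (q 0) = 0
    · rw [hmq, zero_mul]
    · have := key (q 0) ((q 1 - u.2.2) / m.eval (q 0))
      rw [mul_div_cancel₀ _ hmq, add_sub_cancel] at this
      have h2 : (![q 0, q 1] : Fin 2 → K) = q := by ext i; fin_cases i <;> rfl
      rw [h2] at this
      rw [this, mul_zero]
  rcases mul_eq_zero.1 hprod with h1 | h1
  · refine hm0 ?_
    have := (transcendental_iff_injective.1 (MvPolynomial.transcendental_X K (0 : Fin 2)))
    exact this (by rw [h1, map_zero])
  · exact h0 h1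

end Lines

section Counting

open MvPolynomial

variable {K : Type*} [Field K] [Infinite K]

theorem card_le_of_lines_subset (p : ℕ) [CharP K p] (F H : MvPolynomial (Fin 3) K)
    (hF : Irreducible F) (hdeg : F.totalDegree < p) (hH : pderiv 0 F = 0 ∨ ¬ F ∣ H)
    (U : Finset (K × K × K)) (hU : Set.InjOn (fun u => u.2.2) (U : Set (K × K × K)))
    (hUF : ∀ u ∈ U, ∀ t, eval (redPt u t) F = 0) (hUH : ∀ u ∈ U, ∀ t, eval (redPt u t) H = 0) :
    #U ≤ F.totalDegree * (2 * H.totalDegree + 1) := by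
  classical
  obtain ⟨h, h0, hdh, hh⟩ := exists_elimination p F H hF hdeg hH
  refine le_trans ?_ hdh
  by_contra! hlt
  refine h0 (MvPolynomial.funext fun q => ?_)
  have h1 := lineRestrict_eq_zero_of_card ![q 0, 0] ![0, 1] h (U.image fun u => u.2.2) ?_ ?_
  · rw [lineRestrict_eq_zero_iff] at h1
    have h2 := h1 (q 1)
    have h3 : (fun i => (![q 0, 0] : Fin 2 → K) i + (![0, 1] : Fin 2 → K) i * q 1) = q := by
      ext i; fin_cases i <;> simp
    rw [h3] at h2
    rw [h2, map_zero]
  · intro t ht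
    obtain ⟨u, hu, rfl⟩ := mem_image.1 ht
    have h3 : (fun i => (![q 0, 0] : Fin 2 → K) i + (![0, 1] : Fin 2 → K) i * u.2.2) =
        ![q 0, u.2.2] := by
      ext i; fin_cases i <;> simp
    rw [h3]
    exact hh (u.1 + u.2.1 * q 0) _ (hUF u hu (q 0)) (hUH u hu (q 0))
  · rwa [card_image_of_injOn hU]

theorem exists_vanishing_on_blue (V : Finset (K × K × K)) :
    ∃ F : MvPolynomial (Fin 3) K, F ≠ 0 ∧ F.totalDegree ^ 2 ≤ 27 * #V ∧
      ∀ v ∈ V, ∀ t, eval (bluePt v t) F = 0 := by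
  classical
  set q := Nat.sqrt (3 * #V) with hq
  have hq1 : q * q ≤ 3 * #V := Nat.sqrt_le _
  have hq2 : 3 * #V < (q + 1) * (q + 1) := Nat.lt_succ_sqrt _
  let e : (Fin 3 → Fin (q + 1)) → (Fin 3 →₀ ℕ) :=
    fun i => Finsupp.equivFunOnFinite.symm fun j => (i j : ℕ)
  have he : Function.Injective e := by
    intro i j h
    have := Finsupp.equivFunOnFinite.symm.injective h
    ext k
    exact congrFun this k
  let P : ((Fin 3 → Fin (q + 1)) → K) →ₗ[K] MvPolynomial (Fin 3) K :=
    ∑ i, (monomial (e i)) ∘ₗ LinearMap.proj i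
  have hPapp : ∀ a, P a = ∑ i, monomial (e i) (a i) := by
    intro a; simp [P]
  have hPdeg : ∀ a, (P a).totalDegree ≤ 3 * q := by
    intro a
    rw [hPapp]
    refine totalDegree_finsetSum_le fun i _ => ?_
    refine (totalDegree_monomial_le _ _).trans ?_
    rw [Finsupp.sum_fintype _ _ (fun _ => rfl), Fin.sum_univ_three]
    have := (i 0).is_lt
    have := (i 1).is_lt
    have := (i 2).is_lt
    simp only [e, Finsupp.equivFunOnFinite_symm_apply_apply, id]
    omega
  have hPinj : ∀ a, P a = 0 → a = 0 := by
    intro a ha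
    funext i
    have := congrArg (coeff (e i)) ha
    rw [hPapp, coeff_sum, coeff_zero] at this
    simpa [coeff_monomial, he.eq_iff] using this
  let pt : ℕ ↪ K := Infinite.natEmbedding K
  let T : ((Fin 3 → Fin (q + 1)) → K) →ₗ[K] (V × Fin (3 * q + 1) → K) :=
    LinearMap.pi fun x => (aeval (R := K) (bluePt x.1.1 (pt x.2))).toLinearMap ∘ₗ P
  have hker : LinearMap.ker T ≠ ⊥ := by
    refine LinearMap.ker_ne_bot_of_finrank_lt ?_
    simp only [Module.finrank_fintype_fun_eq_card, Fintype.card_prod, Fintype.card_coe,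
      Fintype.card_fin, Fintype.card_fun]
    nlinarith
  obtain ⟨a, haT, ha0⟩ := (Submodule.ne_bot_iff _).1 hker
  refine ⟨P a, fun h => ha0 (hPinj a h), ?_, fun v hv => ?_⟩
  · calc (P a).totalDegree ^ 2 ≤ (3 * q) ^ 2 := Nat.pow_le_pow_left (hPdeg a) 2
      _ ≤ 27 * #V := by nlinarith
  · refine eval_bluePt_eq_zero_of_card v (P a) ((range (3 * q + 1)).map pt) ?_ ?_
    · intro t ht
      obtain ⟨k, hk, rfl⟩ := mem_map.1 ht
      have := congrFun (LinearMap.mem_ker.1 haT) (⟨v, hv⟩, ⟨k, mem_range.1 hk⟩)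
      simpa [T, aeval_eq_eval] using this
    · rw [card_map, card_range]
      exact Nat.lt_succ_of_le (hPdeg a)

end Counting

section Structure

open MvPolynomial

variable {K : Type*} [Field K]

theorem not_dvd_pderiv_zero {n : ℕ} (f : MvPolynomial (Fin (n + 1)) K) (h : pderiv 0 f ≠ 0) :
    ¬ f ∣ pderiv 0 f := by
  intro hd
  rw [← map_dvd_iff (finSuccEquiv K n), finSuccEquiv_pderiv_zero] at hd
  have h1 : Polynomial.derivative (finSuccEquiv K n f) ≠ 0 := by
    rw [← finSuccEquiv_pderiv_zero]
    simpa using h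
  have h2 : finSuccEquiv K n f ≠ 0 := by
    intro h0; rw [h0] at h1; simp at h1
  exact (Polynomial.degree_derivative_lt h2).not_ge (Polynomial.degree_le_of_dvd hd h1)

/-- The distinct irreducible components of a hypersurface. -/
theorem exists_components {σ : Type*} (F : MvPolynomial σ K) (hF : F ≠ 0) :
    ∃ s : Finset (MvPolynomial σ K), (∀ f ∈ s, Prime f) ∧
      (∀ f ∈ s, ∀ g ∈ s, f ≠ g → ¬ f ∣ g) ∧ ∑ f ∈ s, f.totalDegree ≤ F.totalDegree ∧
      ∀ φ : MvPolynomial σ K →ₐ[K] Polynomial K, φ F = 0 → ∃ f ∈ s, φ f = 0 := by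
  classical
  revert hF
  refine UniqueFactorizationMonoid.induction_on_prime F (fun h => absurd rfl h) ?_ ?_
  · intro x hx _
    refine ⟨∅, by simp, by simp, by simp, fun φ h0 => ?_⟩
    exact absurd h0 (hx.map φ).ne_zero
  · intro a q ha hq ih _
    obtain ⟨s, hs1, hs2, hs3, hs4⟩ := ih ha
    have hdeg : (q * a).totalDegree = q.totalDegree + a.totalDegree :=
      totalDegree_mul_of_isDomain hq.ne_zero ha
    by_cases hex : ∃ f ∈ s, Associated f q
    · obtain ⟨f, hf, hfq⟩ := hex
      refine ⟨s, hs1, hs2, by omega, fun φ h0 => ?_⟩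
      rw [map_mul, mul_eq_zero] at h0
      rcases h0 with h0 | h0
      · refine ⟨f, hf, ?_⟩
        obtain ⟨r, hr⟩ := hfq.symm.dvd
        rw [hr, map_mul, h0, zero_mul]
      · exact hs4 φ h0
    · have hqs : q ∉ s := fun h => hex ⟨q, h, Associated.refl q⟩
      refine ⟨insert q s, ?_, ?_, ?_, ?_⟩
      · simpa [hq] using hs1
      · intro f hf g hg hne hdvd
        rcases mem_insert.1 hf with rfl | hf' <;> rcases mem_insert.1 hg with rfl | hg'
        · exact hne rfl
        · exact hex ⟨g, hg', (hq.associated_of_dvd (hs1 g hg') hdvd).symm⟩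
        · exact hex ⟨f, hf', (hs1 f hf').associated_of_dvd hq hdvd⟩
        · exact hs2 f hf' g hg' hne hdvd
      · rw [sum_insert hqs]; omega
      · intro φ h0
        rw [map_mul, mul_eq_zero] at h0
        rcases h0 with h0 | h0
        · exact ⟨q, mem_insert_self _ _, h0⟩
        · obtain ⟨f, hf, hf0⟩ := hs4 φ h0
          exact ⟨f, mem_insert_of_mem hf, hf0⟩

theorem card_le_of_crossings (u : K × K × K) (H : MvPolynomial (Fin 3) K)
    (W : Finset (K × K × K)) (hW : Set.InjOn (fun v => v.2.2) (W : Set (K × K × K)))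
    (hH : ∃ t, eval (redPt u t) H ≠ 0) (h : ∀ v ∈ W, eval (redPt u v.2.2) H = 0) :
    #W ≤ H.totalDegree := by
  classical
  by_contra! hlt
  obtain ⟨t, ht⟩ := hH
  refine ht (eval_redPt_eq_zero_of_card u H (W.image fun v => v.2.2) ?_ ?_ t)
  · intro s hs
    obtain ⟨v, hv, rfl⟩ := mem_image.1 hs
    exact h v hv
  · rwa [card_image_of_injOn hW]

/-- Complete bipartite patterns of incidences contain few pairs from `E`. -/
def SparseOnComplete (E : Finset ((K × K × K) × (K × K × K))) (k : ℕ) : Prop :=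
  ∀ U V : Finset (K × K × K), (∀ u ∈ U, ∀ v ∈ V, Meets u v) →
    ∀ E' ⊆ E, (∀ e ∈ E', e.1 ∈ U ∧ e.2 ∈ V) → #E' ≤ k * (#U + #V)

open Classical in
/-- A polynomial whose zeros on a line of the component `f` contain all crossings with lines
`v` that are not in a ruled component together with it. -/
noncomputable def crossPoly (s : Finset (MvPolynomial (Fin 3) K)) (f : MvPolynomial (Fin 3) K) :
    MvPolynomial (Fin 3) K :=
  pderiv 0 f * (∏ g ∈ s.erase f, g) * (if f ∣ flexPoly f then 1 else flexPoly f)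

theorem totalDegree_crossPoly_le (s : Finset (MvPolynomial (Fin 3) K))
    (f : MvPolynomial (Fin 3) K) (hf : f ∈ s) (d : ℕ) (hd : ∑ g ∈ s, g.totalDegree ≤ d) :
    (crossPoly s f).totalDegree ≤ 4 * d := by
  classical
  have h1 := add_sum_erase s (fun g => g.totalDegree) hf
  have h2 : (if f ∣ flexPoly f then 1 else flexPoly f).totalDegree ≤ 3 * f.totalDegree := by
    split_ifs
    · simp
    · exact totalDegree_flexPoly_le f
  rw [crossPoly]
  refine (totalDegree_mul_le_of_le (totalDegree_mul_le_of_le (totalDegree_pderiv_le 0 f)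
    (totalDegree_finsetProd _ _)) h2).trans ?_
  omega

theorem not_dvd_crossPoly (s : Finset (MvPolynomial (Fin 3) K)) (f : MvPolynomial (Fin 3) K)
    (hs1 : ∀ g ∈ s, Prime g) (hs2 : ∀ f ∈ s, ∀ g ∈ s, f ≠ g → ¬ f ∣ g) (hf : f ∈ s)
    (hx : pderiv 0 f ≠ 0) : ¬ f ∣ crossPoly s f := by
  classical
  have hp := hs1 f hf
  rw [crossPoly, hp.dvd_mul, hp.dvd_mul, hp.dvd_finsetProd_iff]
  rintro ((h | ⟨g, hg, h⟩) | h)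
  · exact not_dvd_pderiv_zero f hx h
  · exact hs2 f hf g (mem_of_mem_erase hg) (ne_of_mem_erase hg).symm h
  · split_ifs at h with h1
    · exact hp.not_isUnit (isUnit_of_dvd_one h)
    · exact h1 h

theorem eval_redPt_eq_zero_iff [Infinite K] (u : K × K × K) (H : MvPolynomial (Fin 3) K) :
    (∀ t, eval (redPt u t) H = 0) ↔ lineRestrict ![u.1, 0, u.2.2] ![u.2.1, 1, 0] H = 0 := by
  simp only [redPt_eq_line, lineRestrict_eq_zero_iff]

theorem eval_bluePt_eq_zero_iff [Infinite K] (v : K × K × K) (H : MvPolynomial (Fin 3) K) :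
    (∀ t, eval (bluePt v t) H = 0) ↔ lineRestrict ![v.1, v.2.2, 0] ![v.2.1, 0, 1] H = 0 := by
  simp only [bluePt_eq_line, lineRestrict_eq_zero_iff]

/-- Lines of the first kind have few crossings with lines of the second kind lying on a surface
of degree `d`, up to `O(d ^ 2)` exceptions. -/
theorem exists_exceptional_reds [Infinite K] (p : ℕ) [CharP K p] (F : MvPolynomial (Fin 3) K)
    (hF : F ≠ 0) (d : ℕ) (hd : F.totalDegree ≤ d) (hdp : d < p) (U V : Finset (K × K × K))
    (hU : Set.InjOn (fun u => u.2.2) (U : Set (K × K × K)))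
    (hV : Set.InjOn (fun u => u.2.2) (V : Set (K × K × K)))
    (E : Finset ((K × K × K) × (K × K × K))) (hE : ∀ e ∈ E, Meets e.1 e.2)
    (hEV : ∀ e ∈ E, e.2 ∈ V) (k : ℕ) (hk : SparseOnComplete E k)
    (hVF : ∀ v ∈ V, ∀ t, eval (bluePt v t) F = 0) :
    ∃ U' ⊆ U, #U' ≤ 9 * d ^ 2 ∧
      ∀ E' ⊆ E, (∀ e ∈ E', e.1 ∈ U ∧ e.1 ∉ U') → #E' ≤ 4 * d * #U + k * (#U + #V) := by
  classical
  obtain ⟨s, hs1, hs2, hs3, hs4⟩ := exists_components F hF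
  have hsd : ∑ f ∈ s, f.totalDegree ≤ d := hs3.trans hd
  have hfd : ∀ f ∈ s, f.totalDegree ≤ d := fun f hf =>
    (single_le_sum (f := fun f : MvPolynomial (Fin 3) K => f.totalDegree)
      (fun _ _ => Nat.zero_le _) hf).trans hsd
  have hcomp : ∀ v ∈ V, ∃ f ∈ s, ∀ t, eval (bluePt v t) f = 0 := by
    intro v hv
    have h1 := hVF v hv
    rw [eval_bluePt_eq_zero_iff] at h1
    obtain ⟨f, hf, hf0⟩ := hs4 _ h1
    exact ⟨f, hf, (eval_bluePt_eq_zero_iff v f).2 hf0⟩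
  choose! c hcs hc using hcomp
  set bad : MvPolynomial (Fin 3) K → Finset (K × K × K) := fun f =>
    {u ∈ U | (∀ t, eval (redPt u t) f = 0) ∧ ∀ t, eval (redPt u t) (crossPoly s f) = 0} with hbad
  set good : MvPolynomial (Fin 3) K → Finset (K × K × K) := fun f =>
    {u ∈ U | (∀ t, eval (redPt u t) f = 0) ∧ ∃ t, eval (redPt u t) (crossPoly s f) ≠ 0} with hgood
  refine ⟨s.biUnion bad, ?_, ?_, ?_⟩
  · exact biUnion_subset.2 fun f _ => filter_subset _ _
  · calc #(s.biUnion bad) ≤ ∑ f ∈ s, #(bad f) := card_biUnion_le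
      _ ≤ ∑ f ∈ s, f.totalDegree * (9 * d) := by
        refine sum_le_sum fun f hf => ?_
        rcases Nat.eq_zero_or_pos d with h0 | hpos
        · have hf0 : f.totalDegree = 0 := Nat.le_zero.1 (h0 ▸ hfd f hf)
          have hb := card_le_of_lines_subset p f (crossPoly s f) (hs1 f hf).irreducible
            ((hfd f hf).trans_lt hdp) ?_ (bad f) (hU.mono (coe_subset.2 (filter_subset _ _))) ?_ ?_
          · rw [hf0, zero_mul] at hb ⊢
            exact hb
          · by_cases hx : pderiv 0 f = 0
            · exact Or.inl hx
            · exact Or.inr (not_dvd_crossPoly s f hs1 hs2 hf hx)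
          · exact fun u hu => (mem_filter.1 hu).2.1
          · exact fun u hu => (mem_filter.1 hu).2.2
        · refine (card_le_of_lines_subset p f (crossPoly s f) (hs1 f hf).irreducible
            ((hfd f hf).trans_lt hdp) ?_ (bad f) (hU.mono (coe_subset.2 (filter_subset _ _))) ?_ ?_).trans ?_
          · by_cases hx : pderiv 0 f = 0
            · exact Or.inl hx
            · exact Or.inr (not_dvd_crossPoly s f hs1 hs2 hf hx)
          · exact fun u hu => (mem_filter.1 hu).2.1
          · exact fun u hu => (mem_filter.1 hu).2.2
          · refine Nat.mul_le_mul_left _ ?_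
            have := totalDegree_crossPoly_le s f hf d hsd
            omega
      _ = (∑ f ∈ s, f.totalDegree) * (9 * d) := by rw [sum_mul]
      _ ≤ d * (9 * d) := Nat.mul_le_mul_right _ hsd
      _ = 9 * d ^ 2 := by ring
  · intro E' hE'E hE'
    set B := E'.filter fun e => e.1 ∈ good (c e.2) ∧ c e.2 ∣ flexPoly (c e.2) with hB
    have hBcard : #B ≤ k * (#U + #V) := by
      have hmap : ∀ e ∈ B, c e.2 ∈ s := fun e he =>
        hcs _ (hEV e (hE'E (mem_filter.1 he).1))
      calc #B = ∑ f ∈ s, #{e ∈ B | c e.2 = f} := card_eq_sum_card_fiberwise hmap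
        _ ≤ ∑ f ∈ s, k * (#(good f) + #{v ∈ V | c v = f}) := by
          refine sum_le_sum fun f hf => ?_
          by_cases hdf : f ∣ flexPoly f
          · refine hk (good f) {v ∈ V | c v = f} ?_ _ ?_ ?_
            · intro u hu v hv
              obtain ⟨hvV, rfl⟩ := mem_filter.1 hv
              obtain ⟨-, hu1, t, hu2⟩ := mem_filter.1 hu
              refine meets_of_dvd_flexPoly p (c v) (hs1 _ hf) ((hfd _ hf).trans_lt hdp) hdf u v
                hu1 (hc v hvV) ⟨t, fun h0 => hu2 ?_⟩
              rw [crossPoly, map_mul, map_mul, h0, zero_mul, zero_mul]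
            · exact (filter_subset _ _).trans ((filter_subset _ _).trans hE'E)
            · intro e he
              obtain ⟨heB, rfl⟩ := mem_filter.1 he
              obtain ⟨heE, he1, -⟩ := mem_filter.1 heB
              exact ⟨he1, mem_filter.2 ⟨hEV e (hE'E heE), rfl⟩⟩
          · have : ({e ∈ B | c e.2 = f} : Finset _) = ∅ := by
              refine filter_eq_empty_iff.2 fun e he hce => hdf ?_
              exact hce ▸ (mem_filter.1 he).2.2
            rw [this, card_empty]
            exact Nat.zero_le _
        _ = k * (∑ f ∈ s, #(good f) + ∑ f ∈ s, #{v ∈ V | c v = f}) := by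
          rw [← mul_sum, sum_add_distrib]
        _ ≤ k * (#U + #V) := by
          refine Nat.mul_le_mul_left _ (add_le_add ?_ ?_)
          · rw [← card_biUnion]
            · exact card_le_card (biUnion_subset.2 fun f _ => filter_subset _ _)
            · intro f hf g hg hfg
              refine disjoint_left.2 fun u hu hu' => ?_
              obtain ⟨-, -, t, hu2⟩ := mem_filter.1 hu
              obtain ⟨-, hu1, -⟩ := mem_filter.1 hu'
              refine hu2 ?_
              rw [crossPoly, map_mul, map_mul, map_prod,
                prod_eq_zero (mem_erase.2 ⟨hfg.symm, hg⟩) (hu1 t), mul_zero, zero_mul]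
          · exact (card_eq_sum_card_fiberwise hcs).ge
    have hNcard : #(E' \ B) ≤ 4 * d * #U := by
      refine card_le_mul_card_image_of_maps_to (f := Prod.fst) (t := U)
        (fun e he => (hE' e (mem_sdiff.1 he).1).1) _ fun u hu => ?_
      set W := ({e ∈ E' \ B | e.1 = u} : Finset _).image Prod.snd with hW
      have hWcard : #({e ∈ E' \ B | e.1 = u} : Finset _) = #W := by
        refine (card_image_of_injOn ?_).symm
        intro e he e' he' h
        exact Prod.ext (((mem_filter.1 he).2).trans (mem_filter.1 he').2.symm) h
      have hWmem : ∀ v ∈ W, (u, v) ∈ E' ∧ (u, v) ∉ B := by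
        intro v hv
        obtain ⟨e, he, rfl⟩ := mem_image.1 hv
        obtain ⟨heN, rfl⟩ := mem_filter.1 he
        exact mem_sdiff.1 heN
      have hWV : ∀ v ∈ W, v ∈ V := fun v hv => hEV _ (hE'E (hWmem v hv).1)
      have hWinj : Set.InjOn (fun v => v.2.2) (W : Set (K × K × K)) := hV.mono hWV
      rw [hWcard]
      have hcross : ∀ v ∈ W, redPt u v.2.2 = bluePt v u.2.2 := fun v hv =>
        (hE _ (hE'E (hWmem v hv).1)).redPt_eq
      by_cases hex : ∃ f ∈ s, ∀ t, eval (redPt u t) f = 0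
      · obtain ⟨f, hf, huf⟩ := hex
        by_cases hWe : W = ∅
        · rw [hWe, card_empty]; exact Nat.zero_le _
        obtain ⟨v₀, hv₀⟩ := nonempty_iff_ne_empty.2 hWe
        have hnb : u ∉ s.biUnion bad := (hE' _ (hWmem v₀ hv₀).1).2
        have hne : ∃ t, eval (redPt u t) (crossPoly s f) ≠ 0 := by
          by_contra! hall
          exact hnb (mem_biUnion.2 ⟨f, hf, mem_filter.2 ⟨hu, huf, hall⟩⟩)
        refine (card_le_of_crossings u (crossPoly s f) W hWinj hne fun v hv => ?_).trans
          (totalDegree_crossPoly_le s f hf d hsd)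
        rw [hcross v hv, crossPoly, map_mul, map_mul, map_prod]
        by_cases hcf : c v = f
        · have hnd : ¬ f ∣ flexPoly f := fun hd' =>
            (hWmem v hv).2 (mem_filter.2 ⟨(hWmem v hv).1,
              by rw [hcf]; exact ⟨mem_filter.2 ⟨hu, huf, hne⟩, hd'⟩⟩)
          rw [if_neg hnd, eval_bluePt_flexPoly v f (hcf ▸ hc v (hWV v hv)), mul_zero]
        · rw [prod_eq_zero (mem_erase.2 ⟨hcf, hcs v (hWV v hv)⟩) (hc v (hWV v hv) _), mul_zero,
            zero_mul]
      · have hne : ∃ t, eval (redPt u t) F ≠ 0 := by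
          by_contra! hall
          rw [eval_redPt_eq_zero_iff] at hall
          obtain ⟨f, hf, hf0⟩ := hs4 _ hall
          exact hex ⟨f, hf, (eval_redPt_eq_zero_iff u f).2 hf0⟩
        refine (card_le_of_crossings u F W hWinj hne fun v hv => ?_).trans (hd.trans (by omega))
        rw [hcross v hv]
        exact hVF v (hWV v hv) _
    have := card_sdiff_add_card_inter E' B
    have h3 : #(E' ∩ B) ≤ #B := card_le_card inter_subset_right
    omega

end Structure

section Incidence

open MvPolynomial

variable {K : Type*} [Field K]

/-- A deterministic form of random sampling with rate `1 / s`. -/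
theorem exists_sample {β ι : Type*} [DecidableEq β] (I : Finset ι) (a : β → ι → ℝ) (s : ℝ)
    (hs : 1 ≤ s) (V : Finset β) :
    ∃ W ⊆ V, ∑ i ∈ I, (s * ∑ v ∈ W, a v i - ∑ v ∈ V, a v i) ^ 2 ≤
      (s - 1) * ∑ v ∈ V, ∑ i ∈ I, a v i ^ 2 := by
  induction V using Finset.induction_on with
  | empty => exact ⟨∅, by simp⟩
  | insert v V hv ih =>
    obtain ⟨W, hWV, hW⟩ := ih
    have hvW : v ∉ W := fun h => hv (hWV h)
    set x : ι → ℝ := fun i => s * ∑ v ∈ W, a v i - ∑ v ∈ V, a v i with hx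
    have key : ∑ i ∈ I, (x i + (s - 1) * a v i) ^ 2 + (s - 1) * ∑ i ∈ I, (x i - a v i) ^ 2 =
        s * (∑ i ∈ I, x i ^ 2 + (s - 1) * ∑ i ∈ I, a v i ^ 2) := by
      simp only [mul_sum, mul_add, ← sum_add_distrib]
      exact sum_congr rfl fun i _ => by ring
    rw [sum_insert hv]
    by_cases h : ∑ i ∈ I, (x i - a v i) ^ 2 ≤
        (s - 1) * (∑ i ∈ I, a v i ^ 2 + ∑ v ∈ V, ∑ i ∈ I, a v i ^ 2)
    · refine ⟨W, hWV.trans (subset_insert _ _), le_of_eq_of_le ?_ h⟩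
      refine sum_congr rfl fun i _ => ?_
      rw [sum_insert hv, hx]; ring
    · refine ⟨insert v W, insert_subset_insert _ hWV, le_of_eq_of_le
        (b := ∑ i ∈ I, (x i + (s - 1) * a v i) ^ 2) ?_ ?_⟩
      · refine sum_congr rfl fun i _ => ?_
        rw [sum_insert hv, sum_insert hvW, hx]; ring
      · push Not at h
        have h1 := mul_le_mul_of_nonneg_left h.le (sub_nonneg.2 hs)
        have h2 := mul_le_mul_of_nonneg_left hW (by linarith : 0 ≤ s)
        linarith

theorem SparseOnComplete.mono {E E' : Finset ((K × K × K) × (K × K × K))} {k : ℕ}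
    (h : SparseOnComplete E k) (hE : E' ⊆ E) : SparseOnComplete E' k :=
  fun U V hUV F hF => h U V hUV F (hF.trans hE)

theorem SparseOnComplete.swap {E : Finset ((K × K × K) × (K × K × K))} {k : ℕ}
    (h : SparseOnComplete E k) :
    SparseOnComplete (E.map (Equiv.prodComm _ _).toEmbedding) k := by
  intro U V hUV F hF hFUV
  have := h V U (fun v hv u hu => (hUV u hu v hv).symm) (F.map (Equiv.prodComm _ _).toEmbedding)
    ?_ ?_
  · rwa [card_map, add_comm] at this
  · intro e he
    obtain ⟨f, hf, rfl⟩ := mem_map.1 he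
    obtain ⟨g, hg, rfl⟩ := mem_map.1 (hF hf)
    simpa using hg
  · intro e he
    obtain ⟨f, hf, rfl⟩ := mem_map.1 he
    exact ⟨(hFUV f hf).2, (hFUV f hf).1⟩

theorem eval_bluePt_rename_swap (u : K × K × K) (t : K) (F : MvPolynomial (Fin 3) K) :
    eval (bluePt u t) (rename (Equiv.swap 1 2) F) = eval (redPt u t) F := by
  rw [eval_rename]
  congr 2
  ext i
  fin_cases i <;> simp [bluePt, redPt, Equiv.swap_apply_def]

theorem eval_redPt_rename_swap (u : K × K × K) (t : K) (F : MvPolynomial (Fin 3) K) :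
    eval (redPt u t) (rename (Equiv.swap 1 2) F) = eval (bluePt u t) F := by
  rw [eval_rename]
  congr 2
  ext i
  fin_cases i <;> simp [bluePt, redPt, Equiv.swap_apply_def]

theorem card_le_mul_of_fst {α β : Type*} [DecidableEq α] [DecidableEq β] (E : Finset (α × β))
    (U : Finset α) (hU : ∀ e ∈ E, e.1 ∈ U) (d : ℕ)
    (h : ∀ u ∈ U, ∀ W : Finset β, (∀ v ∈ W, (u, v) ∈ E) → #W ≤ d) : #E ≤ d * #U := by
  refine card_le_mul_card_image_of_maps_to (f := Prod.fst) (t := U) hU _ fun u hu => ?_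
  have hcard : #{e ∈ E | e.1 = u} = #(({e ∈ E | e.1 = u} : Finset _).image Prod.snd) := by
    refine (card_image_of_injOn ?_).symm
    intro e he e' he' h
    exact Prod.ext (((mem_filter.1 he).2).trans (mem_filter.1 he').2.symm) h
  rw [hcard]
  refine h u hu _ fun v hv => ?_
  obtain ⟨e, he, rfl⟩ := mem_image.1 hv
  obtain ⟨heE, rfl⟩ := mem_filter.1 he
  exact heE

theorem card_eq_sum_card_snd {α β : Type*} [DecidableEq α] [DecidableEq β] (E : Finset (α × β))
    (U : Finset α) (V : Finset β) (hU : ∀ e ∈ E, e.1 ∈ U) (hV : ∀ e ∈ E, e.2 ∈ V) :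
    #E = ∑ u ∈ U, #{v ∈ V | (u, v) ∈ E} := by
  rw [card_eq_sum_card_fiberwise (f := Prod.fst) (t := U) hU]
  refine sum_congr rfl fun u _ => ?_
  refine card_nbij' (fun e => e.2) (fun v => (u, v)) ?_ ?_ ?_ ?_
  · intro e he
    obtain ⟨heE, rfl⟩ := mem_filter.1 he
    exact mem_filter.2 ⟨hV _ heE, heE⟩
  · intro v hv
    exact mem_filter.2 ⟨(mem_filter.1 hv).2, rfl⟩
  · intro e he
    obtain ⟨heE, rfl⟩ := mem_filter.1 he
    rfl
  · intro v _
    rfl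

/-- A small subset of `V` whose neighbourhoods are representative for most pairs. -/
theorem exists_representative_sample {α β : Type*} [DecidableEq α] [DecidableEq β]
    (E : Finset (α × β)) (U : Finset α) (V : Finset β) (hU : ∀ e ∈ E, e.1 ∈ U)
    (hV : ∀ e ∈ E, e.2 ∈ V) (n s : ℕ) (hs : 1 ≤ s) (hn : 2 * s ≤ n) (hVn : #V ≤ n) :
    ∃ W ⊆ V, s * #W ≤ 2 * n ∧ ∀ d : ℕ, ∀ E' ⊆ E,
      (∀ e ∈ E', #{v ∈ W | (e.1, v) ∈ E} ≤ d) →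
        (#E' : ℝ) ≤ #E / 4 + 2 * s * (d + 16) * #U := by
  rcases E.eq_empty_or_nonempty with rfl | hEne
  · refine ⟨∅, empty_subset _, by simp, fun d E' hE' _ => ?_⟩
    rw [subset_empty.1 hE']
    simp
    positivity
  have hnpos : (0 : ℝ) < n := by exact_mod_cast (by omega : 0 < n)
  have hspos : (1 : ℝ) ≤ s := by exact_mod_cast hs
  have hEpos : (0 : ℝ) < #E := by exact_mod_cast hEne.card_pos
  set w : ℝ := √(#E / n) with hw
  have hw2 : w ^ 2 = #E / n := Real.sq_sqrt (by positivity)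
  let a : β → Option α → ℝ := fun v i => i.elim w fun u => if (u, v) ∈ E then 1 else 0
  obtain ⟨W, hWV, hW⟩ := exists_sample (insertNone U) a s hspos V
  have hdeg : ∀ (u : α) (W : Finset β), ∑ v ∈ W, a v (some u) = #{v ∈ W | (u, v) ∈ E} := by
    intro u W
    simp [a]
  have hEsum : (#E : ℝ) = ∑ u ∈ U, (#{v ∈ V | (u, v) ∈ E} : ℝ) := by
    exact_mod_cast card_eq_sum_card_snd E U V hU hV
  have htot : ∑ v ∈ V, ∑ i ∈ insertNone U, a v i ^ 2 ≤ 2 * #E := by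
    simp only [sum_insertNone, sum_add_distrib]
    have h1 : ∑ v ∈ V, ∑ u ∈ U, a v (some u) ^ 2 = #E := by
      rw [sum_comm, hEsum]
      refine sum_congr rfl fun u _ => ?_
      rw [← hdeg]
      exact sum_congr rfl fun v _ => by simp [a]
    have h2 : ∑ v ∈ V, a v none ^ 2 ≤ #E := by
      have : ∑ v ∈ V, a v none ^ 2 = #V * (#E / n) := by simp [a, hw2]
      rw [this, mul_div_assoc', div_le_iff₀ hnpos, mul_comm]
      have : (#V : ℝ) ≤ n := by exact_mod_cast hVn
      gcongr
    linarith
  have hbound : ∑ i ∈ insertNone U, (s * ∑ v ∈ W, a v i - ∑ v ∈ V, a v i) ^ 2 ≤ 2 * s * #E := by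
    refine hW.trans ?_
    have := mul_le_mul_of_nonneg_left htot (by linarith : (0 : ℝ) ≤ s - 1)
    nlinarith
  rw [sum_insertNone] at hbound
  have hbU : ∑ u ∈ U, ((s : ℝ) * #{v ∈ W | (u, v) ∈ E} - #{v ∈ V | (u, v) ∈ E}) ^ 2 ≤
      2 * s * #E := by
    simp only [hdeg] at hbound
    exact (le_add_of_nonneg_left (sq_nonneg _)).trans hbound
  refine ⟨W, hWV, ?_, ?_⟩
  · have h1 : (s * ∑ v ∈ W, a v none - ∑ v ∈ V, a v none) ^ 2 ≤ 2 * s * #E :=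
      (le_add_of_nonneg_right (sum_nonneg fun _ _ => sq_nonneg _)).trans hbound
    have h2 : (s * ∑ v ∈ W, a v none - ∑ v ∈ V, a v none) ^ 2 =
        (#E / n) * (s * #W - #V : ℝ) ^ 2 := by
      rw [← hw2]; simp [a]; ring
    rw [h2, div_mul_eq_mul_div, div_le_iff₀ hnpos] at h1
    have h3 : (s * #W - #V : ℝ) ^ 2 ≤ 2 * s * n := by
      refine le_of_mul_le_mul_left ?_ hEpos
      linarith
    have h4 : (2 * s : ℝ) ≤ n := by exact_mod_cast hn
    have h5 : (s * #W - #V : ℝ) ≤ n := by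
      refine abs_le_of_sq_le_sq' ?_ hnpos.le |>.2
      nlinarith
    have h6 : (#V : ℝ) ≤ n := by exact_mod_cast hVn
    have h7 : (s * #W : ℝ) ≤ 2 * n := by linarith
    exact_mod_cast h7
  · intro d E' hE' hd
    have hE'sum : (#E' : ℝ) = ∑ u ∈ U, (#{v ∈ V | (u, v) ∈ E'} : ℝ) := by
      exact_mod_cast card_eq_sum_card_snd E' U V (fun e he => hU e (hE' he))
        (fun e he => hV e (hE' he))
    have hD : (0 : ℝ) < 2 * s * (d + 16) := by positivity
    have hterm : ∀ u ∈ U, (#{v ∈ V | (u, v) ∈ E'} : ℝ) ≤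
        2 * s * (d + 16) + 4 / (2 * s * (d + 16)) *
          ((s : ℝ) * #{v ∈ W | (u, v) ∈ E} - #{v ∈ V | (u, v) ∈ E}) ^ 2 := by
      intro u _
      rcases ({v ∈ V | (u, v) ∈ E'} : Finset β).eq_empty_or_nonempty with h0 | ⟨v, hv⟩
      · rw [h0]
        simp only [card_empty, Nat.cast_zero]
        positivity
      · have h1 : (#{v ∈ W | (u, v) ∈ E} : ℝ) ≤ d := by
          exact_mod_cast hd _ (mem_filter.1 hv).2
        have h2 : (#{v ∈ V | (u, v) ∈ E'} : ℝ) ≤ #{v ∈ V | (u, v) ∈ E} := by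
          exact_mod_cast card_le_card (monotone_filter_right V fun v _ h => hE' h)
        refine h2.trans ?_
        generalize (#{v ∈ V | (u, v) ∈ E} : ℝ) = D at *
        generalize (#{v ∈ W | (u, v) ∈ E} : ℝ) = x at *
        rw [div_mul_eq_mul_div, ← sub_le_iff_le_add', le_div_iff₀ hD]
        have h4 : 2 * (s * x) ≤ 2 * s * (d + 16) := by nlinarith
        generalize 2 * (s : ℝ) * (d + 16) = D₀ at *
        rcases le_or_gt D D₀ with h3 | h3
        · nlinarith [sq_nonneg (s * x - D)]
        · have h5 : D / 2 ≤ D - s * x := by linarith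
          nlinarith [mul_self_le_mul_self (by linarith : 0 ≤ D / 2) h5]
    have h3 : 4 / (2 * s * (d + 16)) * (2 * s * #E : ℝ) ≤ #E / 4 := by
      rw [div_mul_eq_mul_div, div_le_iff₀ hD]
      nlinarith [mul_nonneg (mul_nonneg hEpos.le (by linarith : (0 : ℝ) ≤ s))
        (Nat.cast_nonneg (α := ℝ) d)]
    calc (#E' : ℝ) ≤ ∑ u ∈ U, (2 * s * (d + 16) + 4 / (2 * s * (d + 16)) *
          ((s : ℝ) * #{v ∈ W | (u, v) ∈ E} - #{v ∈ V | (u, v) ∈ E}) ^ 2) :=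
          hE'sum.le.trans (sum_le_sum hterm)
      _ = 2 * s * (d + 16) * #U + 4 / (2 * s * (d + 16)) *
          ∑ u ∈ U, ((s : ℝ) * #{v ∈ W | (u, v) ∈ E} - #{v ∈ V | (u, v) ∈ E}) ^ 2 := by
        rw [sum_add_distrib, sum_const, nsmul_eq_mul, mul_sum, mul_comm (#U : ℝ)]
      _ ≤ 2 * s * (d + 16) * #U + 4 / (2 * s * (d + 16)) * (2 * s * #E : ℝ) := by gcongr
      _ ≤ _ := by linarith

end Incidence

section IncidenceBound

open MvPolynomial

variable {K : Type*} [Field K]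

theorem incidence_recursion_bound {n k d q u v u' v' e e₁ e₂ e₄ e₅ e₆ : ℝ} (hn : 4000 ≤ n)
    (hk : 0 ≤ k) (hdn : 1000 * d ^ 2 ≤ 27 * n) (hq : q ≤ n / 4)
    (hu0 : 0 ≤ u) (hv0 : 0 ≤ v) (hu0' : 0 ≤ u') (hv0' : 0 ≤ v')
    (hu : u ≤ n) (hv : v ≤ n) (hu' : u' ≤ n) (hv' : v' ≤ n)
    (h₁ : e₁ ≤ e / 4 + 2 * 2000 * (d + 16) * u) (h₂ : e₂ ≤ d * v)
    (h₄ : e₄ ≤ 4 * d * u' + k * (u' + v')) (h₅ : e₅ ≤ 4 * d * v' + k * (v' + u'))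
    (h₆ : e₆ ≤ 200000 * q * (√q + k)) (he : e ≤ e₁ + e₂ + e₄ + e₅ + e₆) :
    e ≤ 200000 * n * (√n + k) := by
  set r := √n with hr
  have hn0 : 0 ≤ n := by linarith
  have hr2 : r * r = n := Real.mul_self_sqrt hn0
  have hr0 : 0 ≤ r := Real.sqrt_nonneg _
  have hr1 : 16 ≤ r := by nlinarith
  have hdr : d ≤ r := by
    refine abs_le_of_sq_le_sq' ?_ hr0 |>.2
    nlinarith
  have hqr : √q ≤ r / 2 := by
    rw [Real.sqrt_le_left (by positivity)]
    nlinarith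
  have b1 : 2 * 2000 * (d + 16) * u ≤ 2 * 2000 * (r + r) * n := by gcongr
  have b2 : d * v ≤ r * n := by gcongr
  have b4 : 4 * d * u' + k * (u' + v') ≤ 4 * r * n + k * (n + n) := by gcongr
  have b5 : 4 * d * v' + k * (v' + u') ≤ 4 * r * n + k * (n + n) := by gcongr
  have b6 : 200000 * q * (√q + k) ≤ 200000 * (n / 4) * (r / 2 + k) := by gcongr
  have c1 : 0 ≤ r * n := by positivity
  have c2 : 0 ≤ k * n := by positivity
  linarith

theorem card_le_of_cover {α : Type*} (E : Finset α) (P Q R S : α → Prop) [DecidablePred P]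
    [DecidablePred Q] [DecidablePred R] [DecidablePred S] :
    #E ≤ #{e ∈ E | ¬ P e} + #{e ∈ E | P e ∧ ¬ Q e} + #{e ∈ {e ∈ E | P e ∧ Q e} | ¬ R e} +
      #{e ∈ {e ∈ E | P e ∧ Q e} | ¬ S e} + #{e ∈ {e ∈ E | P e ∧ Q e} | R e ∧ S e} := by
  classical
  have : E ⊆ {e ∈ E | ¬ P e} ∪ {e ∈ E | P e ∧ ¬ Q e} ∪ {e ∈ {e ∈ E | P e ∧ Q e} | ¬ R e} ∪
      {e ∈ {e ∈ E | P e ∧ Q e} | ¬ S e} ∪ {e ∈ {e ∈ E | P e ∧ Q e} | R e ∧ S e} := by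
    intro e he
    simp only [mem_union, mem_filter]
    tauto
  refine (card_le_card this).trans ?_
  refine (card_union_le _ _).trans (Nat.add_le_add_right ?_ _)
  refine (card_union_le _ _).trans (Nat.add_le_add_right ?_ _)
  refine (card_union_le _ _).trans (Nat.add_le_add_right ?_ _)
  exact card_union_le _ _

set_option maxHeartbeats 400000 in
/-- Two families of lines with sparse complete patterns have few incidences. -/
theorem card_incidences_le [Infinite K] (p : ℕ) [CharP K p] (k : ℕ) (n : ℕ) (hnp : n ≤ p ^ 2)
    (U V : Finset (K × K × K)) (hUn : #U ≤ n) (hVn : #V ≤ n)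
    (hU : Set.InjOn (fun u => u.2.2) (U : Set (K × K × K)))
    (hV : Set.InjOn (fun u => u.2.2) (V : Set (K × K × K)))
    (E : Finset ((K × K × K) × (K × K × K))) (hEU : ∀ e ∈ E, e.1 ∈ U) (hEV : ∀ e ∈ E, e.2 ∈ V)
    (hE : ∀ e ∈ E, Meets e.1 e.2) (hk : SparseOnComplete E k) :
    (#E : ℝ) ≤ 200000 * n * (√n + k) := by
  classical
  induction n using Nat.strong_induction_on generalizing U V E with
  | _ n ih =>
  rcases lt_or_ge n 4000 with hsmall | hlarge
  · have h1 : #E ≤ n * n := by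
      calc #E ≤ #(U ×ˢ V) := card_le_card fun e he => mem_product.2 ⟨hEU e he, hEV e he⟩
        _ = #U * #V := card_product _ _
        _ ≤ n * n := Nat.mul_le_mul hUn hVn
    have h2 : (#E : ℝ) ≤ n * n := by exact_mod_cast h1
    have h3 : (n : ℝ) ≤ 4000 := by exact_mod_cast hsmall.le
    have h4 : √(n : ℝ) * √n = n := Real.mul_self_sqrt (Nat.cast_nonneg n)
    have h5 : √(n : ℝ) ≤ 4000 := by
      rw [Real.sqrt_le_left (by norm_num)]; linarith
    have h6 : (n : ℝ) ≤ 4000 * √n := by nlinarith [Real.sqrt_nonneg (n : ℝ)]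
    have h7 : (0 : ℝ) ≤ n * k := by positivity
    have h8 : (0 : ℝ) ≤ n * √n := by positivity
    nlinarith [mul_le_mul_of_nonneg_left h6 (Nat.cast_nonneg (α := ℝ) n)]
  · obtain ⟨W, hWV, hWcard, hW⟩ := exists_representative_sample E U V hEU hEV n 2000 (by norm_num)
      hlarge hVn
    obtain ⟨F, hF0, hFdeg, hFW⟩ := exists_vanishing_on_blue W
    set d := F.totalDegree with hd
    have hdn : 1000 * d ^ 2 ≤ 27 * n := by omega
    have hdp : d < p := by
      refine lt_of_pow_lt_pow_left₀ 2 (Nat.zero_le _) ?_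
      omega
    set F' := rename (Equiv.swap 1 2) F with hF'
    have hF'0 : F' ≠ 0 := fun h => hF0 (rename_injective _ (Equiv.injective _) (by simpa using h))
    have hF'deg : F'.totalDegree ≤ d := totalDegree_rename_le _ _
    set UF := {u ∈ U | ∀ t, eval (redPt u t) F = 0} with hUF
    set VF := {v ∈ V | ∀ t, eval (bluePt v t) F = 0} with hVF
    have hUFn : #UF ≤ n := (card_filter_le _ _).trans hUn
    have hVFn : #VF ≤ n := (card_filter_le _ _).trans hVn
    have hUFi : Set.InjOn (fun u => u.2.2) (UF : Set (K × K × K)) :=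
      hU.mono (coe_subset.2 (filter_subset _ _))
    have hVFi : Set.InjOn (fun u => u.2.2) (VF : Set (K × K × K)) :=
      hV.mono (coe_subset.2 (filter_subset _ _))
    set E₁ := {e ∈ E | e.1 ∉ UF} with hE₁
    set E₂ := {e ∈ E | e.1 ∈ UF ∧ e.2 ∉ VF} with hE₂
    set E₃ := {e ∈ E | e.1 ∈ UF ∧ e.2 ∈ VF} with hE₃
    have hE₃E : E₃ ⊆ E := filter_subset _ _
    have hE₁card : (#E₁ : ℝ) ≤ #E / 4 + 2 * (2000 : ℕ) * (d + 16) * #U := by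
      refine hW d E₁ (filter_subset _ _) fun e he => ?_
      obtain ⟨heE, heU⟩ := mem_filter.1 he
      have hne : ∃ t, eval (redPt e.1 t) F ≠ 0 := by
        by_contra! hall
        exact heU (mem_filter.2 ⟨hEU e heE, hall⟩)
      refine card_le_of_crossings e.1 F _ (hV.mono ?_) hne fun v hv => ?_
      · exact coe_subset.2 ((filter_subset _ _).trans hWV)
      · obtain ⟨hvW, hvE⟩ := mem_filter.1 hv
        rw [(hE _ hvE).redPt_eq]
        exact hFW v hvW _
    have hE₂card : #E₂ ≤ d * #V := by
      rw [← card_map (Equiv.prodComm _ _).toEmbedding]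
      refine card_le_mul_of_fst _ V ?_ d ?_
      · intro e he
        obtain ⟨f, hf, rfl⟩ := mem_map.1 he
        exact hEV _ (mem_filter.1 hf).1
      · intro v hv T hT
        have hT' : ∀ u ∈ T, (u, v) ∈ E₂ := fun u hu => by simpa using hT u hu
        rcases T.eq_empty_or_nonempty with rfl | ⟨u₀, hu₀⟩
        · simp
        have hvF : v ∉ VF := (mem_filter.1 (hT' _ hu₀)).2.2
        have hne : ∃ t, eval (redPt v t) F' ≠ 0 := by
          by_contra! hall
          simp only [hF', eval_redPt_rename_swap] at hall
          exact hvF (mem_filter.2 ⟨hv, hall⟩)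
        refine (card_le_of_crossings v F' T (hU.mono ?_) hne fun u hu => ?_).trans hF'deg
        · exact fun u hu => hEU _ (mem_filter.1 (hT' u hu)).1
        · obtain ⟨huE, huF, -⟩ := mem_filter.1 (hT' u hu)
          rw [eval_redPt_rename_swap, ← (hE _ huE).redPt_eq]
          exact (mem_filter.1 huF).2 _
    obtain ⟨U', hU'U, hU'card, hU'⟩ := exists_exceptional_reds p F hF0 d le_rfl hdp UF VF hUFi hVFi
      E₃ (fun e he => hE e (hE₃E he)) (fun e he => (mem_filter.1 he).2.2) k (hk.mono hE₃E)
      (fun v hv => (mem_filter.1 hv).2)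
    obtain ⟨V', hV'V, hV'card, hV'⟩ := exists_exceptional_reds p F' hF'0 d hF'deg hdp VF UF hVFi
      hUFi (E₃.map (Equiv.prodComm _ _).toEmbedding)
      (fun e he => by
        obtain ⟨f, hf, rfl⟩ := mem_map.1 he
        exact (hE f (hE₃E hf)).symm)
      (fun e he => by
        obtain ⟨f, hf, rfl⟩ := mem_map.1 he
        exact (mem_filter.1 hf).2.1) k (hk.mono hE₃E).swap
      (fun u hu t => by
        rw [hF', eval_bluePt_rename_swap]
        exact (mem_filter.1 hu).2 t)
    set E₄ := {e ∈ E₃ | e.1 ∉ U'} with hE₄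
    set E₅ := {e ∈ E₃ | e.2 ∉ V'} with hE₅
    set E₆ := {e ∈ E₃ | e.1 ∈ U' ∧ e.2 ∈ V'} with hE₆
    have hE₄card : #E₄ ≤ 4 * d * #UF + k * (#UF + #VF) :=
      hU' E₄ (filter_subset _ _) fun e he =>
        ⟨(mem_filter.1 (mem_filter.1 he).1).2.1, (mem_filter.1 he).2⟩
    have hE₅card : #E₅ ≤ 4 * d * #VF + k * (#VF + #UF) := by
      rw [← card_map (Equiv.prodComm _ _).toEmbedding]
      refine hV' _ (map_subset_map.2 (filter_subset _ _)) fun e he => ?_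
      obtain ⟨f, hf, rfl⟩ := mem_map.1 he
      exact ⟨(mem_filter.1 (mem_filter.1 hf).1).2.2, (mem_filter.1 hf).2⟩
    have hU'n : #U' ≤ n / 4 := by omega
    have hV'n : #V' ≤ n / 4 := by omega
    have hE₆card : (#E₆ : ℝ) ≤ 200000 * (n / 4 : ℕ) * (√(n / 4 : ℕ) + k) :=
      ih (n / 4) (by omega) (by omega) U' V' hU'n hV'n
        (hUFi.mono (coe_subset.2 hU'U)) (hVFi.mono (coe_subset.2 hV'V)) E₆
        (fun e he => (mem_filter.1 he).2.1) (fun e he => (mem_filter.1 he).2.2)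
        (fun e he => hE e (hE₃E (mem_filter.1 he).1))
        (hk.mono ((filter_subset _ _).trans hE₃E))
    have hcover : #E ≤ #E₁ + #E₂ + #E₄ + #E₅ + #E₆ := card_le_of_cover E _ _ _ _
    have hcover' : (#E : ℝ) ≤ #E₁ + #E₂ + #E₄ + #E₅ + #E₆ := by exact_mod_cast hcover
    have hUF' : (#UF : ℝ) ≤ n := by exact_mod_cast hUFn
    have hVF' : (#VF : ℝ) ≤ n := by exact_mod_cast hVFn
    have b4 : (#E₄ : ℝ) ≤ 4 * d * #UF + k * (#UF + #VF) := by exact_mod_cast hE₄card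
    have b5 : (#E₅ : ℝ) ≤ 4 * d * #VF + k * (#VF + #UF) := by exact_mod_cast hE₅card
    have hdn' : (1000 * d ^ 2 : ℝ) ≤ 27 * n := by exact_mod_cast hdn
    have hq : ((n / 4 : ℕ) : ℝ) ≤ n / 4 := Nat.cast_div_le
    exact incidence_recursion_bound (n := n) (by exact_mod_cast hlarge) (Nat.cast_nonneg k)
      hdn' hq (Nat.cast_nonneg _)
      (Nat.cast_nonneg _) (Nat.cast_nonneg _) (Nat.cast_nonneg _) (by exact_mod_cast hUn)
      (by exact_mod_cast hVn) hUF' hVF' (by exact_mod_cast hE₁card)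
      (by exact_mod_cast hE₂card) b4 b5 hE₆card hcover'

end IncidenceBound

section Reflections

variable {K : Type*} [Field K]

/-- The point `P`, in isotropic coordinates, lies on the circle or line with coefficients `κ`. -/
def OnCircle (κ : K × K × K × K) (P : K × K) : Prop :=
  κ.1 * (P.1 * P.2) + κ.2.1 * P.1 + κ.2.2.1 * P.2 + κ.2.2.2 = 0

/-- Squared distance in isotropic coordinates. -/
def sqDist (x y : K × K) : K := (x.1 - y.1) * (x.2 - y.2)

theorem circle_eq_zero_of_three {η : K × K × K × K} {P Q R : K × K}
    (h : η.2.1 + η.1 * P.2 = 0) (hP : OnCircle η P) (hQ : OnCircle η Q) (hR : OnCircle η R)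
    (hPQ : P.2 ≠ Q.2) (hPR : P.2 ≠ R.2) (hQR : Q.1 ≠ R.1) : η = 0 := by
  obtain ⟨a, b, c, d⟩ := η
  simp only [OnCircle] at *
  have h1 : a * Q.1 + c = 0 := by
    refine (mul_eq_zero.1 (?_ : (Q.2 - P.2) * _ = 0)).resolve_left (sub_ne_zero.2 hPQ.symm)
    linear_combination hQ - hP + (P.1 - Q.1) * h
  have h2 : a * R.1 + c = 0 := by
    refine (mul_eq_zero.1 (?_ : (R.2 - P.2) * _ = 0)).resolve_left (sub_ne_zero.2 hPR.symm)
    linear_combination hR - hP + (P.1 - R.1) * h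
  have ha : a = 0 := by
    refine (mul_eq_zero.1 (?_ : (Q.1 - R.1) * _ = 0)).resolve_left (sub_ne_zero.2 hQR)
    linear_combination h1 - h2
  subst ha
  have hb : b = 0 := by simpa using h
  have hc : c = 0 := by simpa using h1
  subst hb hc
  have hd : d = 0 := by simpa using hP
  rw [hd]; rfl

/-- Three points determine a circle. -/
theorem onCircle_iff_of_three {κ κ' : K × K × K × K} (hκ : κ ≠ 0) (hκ' : κ' ≠ 0) {P Q R : K × K}
    (hP : OnCircle κ P) (hQ : OnCircle κ Q) (hR : OnCircle κ R)
    (hP' : OnCircle κ' P) (hQ' : OnCircle κ' Q) (hR' : OnCircle κ' R)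
    (hPQ : P.2 ≠ Q.2) (hPR : P.2 ≠ R.2) (hQR : Q.1 ≠ R.1) (S : K × K) :
    OnCircle κ S ↔ OnCircle κ' S := by
  set f := κ.2.1 + κ.1 * P.2 with hf
  set f' := κ'.2.1 + κ'.1 * P.2 with hf'
  have hf0 : f ≠ 0 := fun h => hκ (circle_eq_zero_of_three h hP hQ hR hPQ hPR hQR)
  have hf'0 : f' ≠ 0 := fun h => hκ' (circle_eq_zero_of_three h hP' hQ' hR' hPQ hPR hQR)
  have hη : f' • κ - f • κ' = 0 := by
    refine circle_eq_zero_of_three (P := P) (Q := Q) (R := R) ?_ ?_ ?_ ?_ hPQ hPR hQR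
    · simp only [Prod.snd_sub, Prod.fst_sub, Prod.smul_fst, Prod.smul_snd, smul_eq_mul, hf, hf']
      ring
    all_goals
      simp only [OnCircle, Prod.snd_sub, Prod.fst_sub, Prod.smul_fst, Prod.smul_snd,
        smul_eq_mul] at *
    · linear_combination f' * hP - f * hP'
    · linear_combination f' * hQ - f * hQ'
    · linear_combination f' * hR - f * hR'
  rw [sub_eq_zero] at hη
  have e1 := congrArg (fun t => t.1) hη
  have e2 := congrArg (fun t => t.2.1) hη
  have e3 := congrArg (fun t => t.2.2.1) hη
  have e4 := congrArg (fun t => t.2.2.2) hη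
  simp only [Prod.smul_fst, Prod.smul_snd, smul_eq_mul] at e1 e2 e3 e4
  simp only [OnCircle]
  constructor <;> intro h
  · refine (mul_eq_zero.1 (?_ : f * _ = 0)).resolve_left hf0
    linear_combination f' * h - (S.1 * S.2) * e1 - S.1 * e2 - S.2 * e3 - e4
  · refine (mul_eq_zero.1 (?_ : f' * _ = 0)).resolve_left hf'0
    linear_combination f * h + (S.1 * S.2) * e1 + S.1 * e2 + S.2 * e3 + e4

/-- Half of the condition that some reflection maps `u.1` to `v.1` and `u.2` to `v.2`. -/
def HalfReflects (u v : (K × K) × (K × K)) : Prop :=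
  (v.1.1 - v.2.1) * (v.1.2 - u.1.2) + (u.1.2 - u.2.2) * (v.1.1 - u.1.1) = 0

/-- A reflection maps `u.1` to `v.1` and `u.2` to `v.2`. -/
def Reflects (u v : (K × K) × (K × K)) : Prop :=
  HalfReflects u v ∧ (v.1.2 - v.2.2) * (v.1.1 - u.1.1) + (u.1.1 - u.2.1) * (v.1.2 - u.1.2) = 0

/-- The circle through the endpoints of segments in correspondence with both `v` and `v'`. -/
def linkCircle (v v' : (K × K) × (K × K)) : K × K × K × K :=
  let Y := v.1.1 - v.2.1
  let Y' := v'.1.1 - v'.2.1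
  (Y - Y', Y' * v'.1.2 - Y * v.1.2, Y' * v.1.1 - Y * v'.1.1,
    Y * v.1.2 * v'.1.1 - Y' * v'.1.2 * v.1.1)

theorem onCircle_linkCircle_iff (v v' : (K × K) × (K × K)) (P : K × K) :
    OnCircle (linkCircle v v') P ↔ (v.1.1 - v.2.1) * (v.1.2 - P.2) * (v'.1.1 - P.1) =
      (v'.1.1 - v'.2.1) * (v'.1.2 - P.2) * (v.1.1 - P.1) := by
  rw [← sub_eq_zero (a := _ * _ * _)]
  simp only [OnCircle, linkCircle]
  ring_nf

theorem linkCircle_ne_zero {v v' : (K × K) × (K × K)} (hv : v.1.1 ≠ v.2.1)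
    (h : v.1.2 ≠ v'.1.2) : linkCircle v v' ≠ 0 := by
  intro h0
  have e1 : (v.1.1 - v.2.1) - (v'.1.1 - v'.2.1) = 0 := congrArg (fun t => t.1) h0
  have e2 : (v'.1.1 - v'.2.1) * v'.1.2 - (v.1.1 - v.2.1) * v.1.2 = 0 :=
    congrArg (fun t => t.2.1) h0
  refine h ((mul_right_inj' (sub_ne_zero.2 hv)).1 ?_)
  linear_combination -e2 - v'.1.2 * e1

theorem HalfReflects.onCircle {u v v' : (K × K) × (K × K)} (h : HalfReflects u v)
    (h' : HalfReflects u v') : OnCircle (linkCircle v v') u.1 := by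
  rw [onCircle_linkCircle_iff]
  simp only [HalfReflects] at h h'
  linear_combination (v'.1.1 - u.1.1) * h - (v.1.1 - u.1.1) * h'

/-- In a complete pattern of reflections, few pairs avoid a common circle. -/
theorem card_le_of_complete_reflections (A : Finset (K × K))
    (hA1 : Set.InjOn Prod.fst (A : Set (K × K))) (hA2 : Set.InjOn Prod.snd (A : Set (K × K)))
    (E₀ : Finset ((K × K) × (K × K))) (hE₀ : ∀ e ∈ E₀, e.1 ≠ e.2) (k : ℕ)
    (hk : ∀ κ : K × K × K × K, κ ≠ 0 → ∃ S : Finset (K × K), #S ≤ k ∧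
      ∀ e ∈ E₀, OnCircle κ e.1 → OnCircle κ e.2 → e.1 ∈ S ∨ e.2 ∈ S)
    (U V : Finset ((K × K) × (K × K))) (hU : ∀ u ∈ U, u.1 ∈ A ∧ u.2 ∈ A)
    (hV : ∀ u ∈ V, u.1 ∈ A ∧ u.2 ∈ A) (hV' : ∀ u ∈ V, u.1 ≠ u.2)
    (hUV : ∀ u ∈ U, ∀ v ∈ V, HalfReflects u v)
    (E : Finset (((K × K) × (K × K)) × ((K × K) × (K × K))))
    (hE : ∀ e ∈ E, e.1 ∈ U ∧ e.2 ∈ V ∧ (e.1.1, e.2.1) ∈ E₀) :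
    #E ≤ (k + 2) * (#U + #V) := by
  classical
  have hEUV : #E ≤ #U * #V := by
    rw [← card_product]
    exact card_le_card fun e he => mem_product.2 ⟨(hE e he).1, (hE e he).2.1⟩
  rcases E.eq_empty_or_nonempty with rfl | ⟨⟨u₀, v₀⟩, he₀⟩
  · simp
  obtain ⟨hu₀, hv₀, hE₀'⟩ := hE _ he₀
  have hne₀ : u₀.1 ≠ v₀.1 := hE₀ _ hE₀'
  simp only at hu₀ hv₀
  by_cases hU2 : #U ≤ 2
  · nlinarith [Nat.zero_le (k * (#U + #V)), Nat.mul_le_mul_right #V hU2]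
  by_cases hV2 : #V ≤ 2
  · nlinarith [Nat.zero_le (k * (#U + #V)), Nat.mul_le_mul_left #U hV2]
  have hUinj : Set.InjOn Prod.fst (U : Set ((K × K) × (K × K))) := by
    intro u hu u' hu' h
    by_contra hne
    have hX : u.2.2 ≠ u'.2.2 := fun h2 =>
      hne (Prod.ext h (hA2 (hU u hu).2 (hU u' hu').2 h2))
    have hy : ∀ v ∈ V, v.1 = u.1 := by
      intro v hv
      have h1 := hUV u hu v hv
      have h2 := hUV u' hu' v hv
      refine hA1 (hV v hv).1 (hU u hu).1 (sub_eq_zero.1 ?_)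
      refine (mul_eq_zero.1 (?_ : (u.2.2 - u'.2.2) * _ = 0)).resolve_left (sub_ne_zero.2 hX)
      simp only [HalfReflects, ← h] at h1 h2
      linear_combination h2 - h1
    refine hV2 ((card_le_one.2 fun v hv v' hv' => ?_).trans (by norm_num))
    have h1 := hUV u₀ hu₀ v hv
    have h2 := hUV u₀ hu₀ v' hv'
    have h3 := (hy v hv).trans (hy v' hv').symm
    have h4 : v.1.2 - u₀.1.2 ≠ 0 := by
      refine sub_ne_zero.2 fun h5 => hne₀ ?_
      rw [hA2 (hV v₀ hv₀).1 (hU u₀ hu₀).1 (by rw [hy v₀ hv₀, ← hy v hv, h5])]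
    refine Prod.ext h3 (hA1 (hV v hv).2 (hV v' hv').2 (sub_eq_zero.1 ?_))
    refine (mul_eq_zero.1 (?_ : (v.1.2 - u₀.1.2) * _ = 0)).resolve_left h4
    simp only [HalfReflects, ← h3] at h1 h2
    linear_combination h2 - h1
  have hVinj : Set.InjOn Prod.fst (V : Set ((K × K) × (K × K))) := by
    intro v hv v' hv' h
    by_contra hne
    have hX : v.2.1 ≠ v'.2.1 := fun h2 =>
      hne (Prod.ext h (hA1 (hV v hv).2 (hV v' hv').2 h2))
    have hy : ∀ u ∈ U, u.1 = v.1 := by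
      intro u hu
      have h1 := hUV u hu v hv
      have h2 := hUV u hu v' hv'
      refine hA2 (hU u hu).1 (hV v hv).1 (sub_eq_zero.1 ?_)
      refine (mul_eq_zero.1 (?_ : (v.2.1 - v'.2.1) * _ = 0)).resolve_left (sub_ne_zero.2 hX)
      simp only [HalfReflects, ← h] at h1 h2
      linear_combination h1 - h2
    refine hU2 ((card_le_one.2 fun u hu u' hu' => ?_).trans (by norm_num))
    have h1 := hUV u hu v₀ hv₀
    have h2 := hUV u' hu' v₀ hv₀
    have h3 := (hy u hu).trans (hy u' hu').symm
    have h4 : v₀.1.1 - u.1.1 ≠ 0 := by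
      refine sub_ne_zero.2 fun h5 => hne₀ ?_
      rw [hA1 (hV v₀ hv₀).1 (hU u₀ hu₀).1 (by rw [hy u₀ hu₀, ← hy u hu, h5])]
    refine Prod.ext h3 (hA2 (hU u hu).2 (hU u' hu').2 (sub_eq_zero.1 ?_))
    refine (mul_eq_zero.1 (?_ : (v₀.1.1 - u.1.1) * _ = 0)).resolve_left h4
    simp only [HalfReflects, ← h3] at h1 h2
    linear_combination h2 - h1
  obtain ⟨u₁, hu₁, u₂, hu₂, u₃, hu₃, h12, h13, h23⟩ := two_lt_card.1 (not_le.1 hU2)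
  obtain ⟨v₁, hv₁, v₂, hv₂, hv12⟩ := one_lt_card.1 (lt_of_lt_of_le one_lt_two (not_le.1 hV2).le)
  have snd_ne : ∀ v ∈ V, ∀ v' ∈ V, v ≠ v' → v.1.2 ≠ v'.1.2 := fun v hv v' hv' hne h =>
    hne (hVinj hv hv' (hA2 (hV v hv).1 (hV v' hv').1 h))
  have fst_ne : ∀ v ∈ V, v.1.1 ≠ v.2.1 := fun v hv h => hV' v hv (hA1 (hV v hv).1 (hV v hv).2 h)
  have uu2 : ∀ u ∈ U, ∀ u' ∈ U, u ≠ u' → u.1.2 ≠ u'.1.2 := fun v hv v' hv' hne h =>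
    hne (hUinj hv hv' (hA2 (hU v hv).1 (hU v' hv').1 h))
  have uu1 : ∀ u ∈ U, ∀ u' ∈ U, u ≠ u' → u.1.1 ≠ u'.1.1 := fun v hv v' hv' hne h =>
    hne (hUinj hv hv' (hA1 (hU v hv).1 (hU v' hv').1 h))
  set κ := linkCircle v₁ v₂ with hκ
  have hκ0 : κ ≠ 0 := linkCircle_ne_zero (fst_ne v₁ hv₁) (snd_ne v₁ hv₁ v₂ hv₂ hv12)
  have hUκ : ∀ u ∈ U, OnCircle κ u.1 := fun u hu => (hUV u hu v₁ hv₁).onCircle (hUV u hu v₂ hv₂)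
  have hVκ : ∀ v ∈ V, OnCircle κ v.1 := by
    intro v hv
    by_cases hv1 : v = v₁
    · subst hv1
      rw [hκ, onCircle_linkCircle_iff]; ring
    · have hon : ∀ u ∈ U, OnCircle (linkCircle v₁ v) u.1 := fun u hu =>
        (hUV u hu v₁ hv₁).onCircle (hUV u hu v hv)
      rw [onCircle_iff_of_three hκ0
        (linkCircle_ne_zero (fst_ne v₁ hv₁) (snd_ne v₁ hv₁ v hv (Ne.symm hv1)))
        (hUκ u₁ hu₁) (hUκ u₂ hu₂) (hUκ u₃ hu₃) (hon u₁ hu₁) (hon u₂ hu₂) (hon u₃ hu₃)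
        (uu2 u₁ hu₁ u₂ hu₂ h12) (uu2 u₁ hu₁ u₃ hu₃ h13) (uu1 u₂ hu₂ u₃ hu₃ h23),
        onCircle_linkCircle_iff]
      ring
  obtain ⟨S, hS, hS'⟩ := hk κ hκ0
  have hsub : E ⊆ {u ∈ U | u.1 ∈ S} ×ˢ V ∪ U ×ˢ {v ∈ V | v.1 ∈ S} := by
    intro e he
    obtain ⟨h1, h2, h3⟩ := hE e he
    have := hS' _ h3 (hUκ e.1 h1) (hVκ e.2 h2)
    simp only [mem_union, mem_product, mem_filter]
    tauto
  have c1 : #{u ∈ U | u.1 ∈ S} ≤ k := (card_le_card_of_injOn Prod.fst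
    (fun u hu => (mem_filter.1 hu).2) (hUinj.mono (coe_subset.2 (filter_subset _ _)))).trans hS
  have c2 : #{v ∈ V | v.1 ∈ S} ≤ k := (card_le_card_of_injOn Prod.fst
    (fun u hu => (mem_filter.1 hu).2) (hVinj.mono (coe_subset.2 (filter_subset _ _)))).trans hS
  calc #E ≤ #{u ∈ U | u.1 ∈ S} * #V + #U * #{v ∈ V | v.1 ∈ S} := by
        refine (card_le_card hsub).trans ((card_union_le _ _).trans ?_)
        rw [card_product, card_product]
    _ ≤ k * #V + #U * k := by gcongr
    _ ≤ _ := by nlinarith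

end Reflections

section ReflectionBound

variable {K : Type*} [Field K]

theorem exists_generic_pair [Infinite K] (L : Finset (K × K × K))
    (h : ∀ l ∈ L, l.1 ≠ 0 ∨ l.2.1 ≠ 0) : ∃ a c : K, ∀ l ∈ L, a * l.1 + c * l.2.1 ≠ l.2.2 := by
  classical
  obtain ⟨a, ha⟩ := Infinite.exists_notMem_finset (L.image fun l => l.2.2 / l.1)
  obtain ⟨c, hc⟩ := Infinite.exists_notMem_finset (L.image fun l => (l.2.2 - a * l.1) / l.2.1)
  refine ⟨a, c, fun l hl heq => ?_⟩
  by_cases h2 : l.2.1 = 0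
  · have h1 := (h l hl).resolve_right (not_not.2 h2)
    refine ha (mem_image.2 ⟨l, hl, ?_⟩)
    rw [div_eq_iff h1, ← heq, h2]; ring
  · refine hc (mem_image.2 ⟨l, hl, ?_⟩)
    rw [div_eq_iff h2, ← heq]; ring

/-- The line of the first kind encoding a segment. -/
def redOf (a c : K) (u : (K × K) × (K × K)) : K × K × K :=
  (u.1.2, u.1.2 - u.2.2, (u.1.2 - u.2.2) * u.1.1 - a * u.1.2 - c * (u.1.2 - u.2.2))

/-- The line of the second kind encoding a segment. -/
def blueOf (a c : K) (v : (K × K) × (K × K)) : K × K × K :=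
  ((v.1.1 - v.2.1) * v.1.2 / (v.1.1 - v.2.1 + a), -1 / (v.1.1 - v.2.1 + a),
    (c - v.1.1) / (v.1.1 - v.2.1 + a))

theorem meets_redOf_blueOf_iff (a c : K) (u v : (K × K) × (K × K))
    (h : v.1.1 - v.2.1 + a ≠ 0) : Meets (redOf a c u) (blueOf a c v) ↔ HalfReflects u v := by
  simp only [Meets, redOf, blueOf, HalfReflects]
  field_simp
  constructor <;> intro h1 <;> linear_combination -h1

theorem exists_generic_encoding [Infinite K] (A : Finset (K × K))
    (hA1 : Set.InjOn Prod.fst (A : Set (K × K))) (hA2 : Set.InjOn Prod.snd (A : Set (K × K))) :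
    ∃ a c : K, (∀ v ∈ A ×ˢ A, v.1.1 - v.2.1 + a ≠ 0) ∧
      Set.InjOn (fun u => (redOf a c u).2.2) (A ×ˢ A : Finset ((K × K) × (K × K))) ∧
      Set.InjOn (fun u => (blueOf a c u).2.2) (A ×ˢ A : Finset ((K × K) × (K × K))) := by
  classical
  set P := A ×ˢ A with hP
  set D := {q ∈ P ×ˢ P | q.1 ≠ q.2} with hD
  set L₁ : Finset (K × K × K) := P.image fun v => (1, 0, v.2.1 - v.1.1) with hL₁
  set L₂ : Finset (K × K × K) := D.image fun q =>
    (q.1.1.2 - q.2.1.2, (q.1.1.2 - q.1.2.2) - (q.2.1.2 - q.2.2.2),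
      (q.1.1.2 - q.1.2.2) * q.1.1.1 - (q.2.1.2 - q.2.2.2) * q.2.1.1) with hL₂
  set L₃ : Finset (K × K × K) := D.image fun q =>
    (q.2.1.1 - q.1.1.1, (q.2.1.1 - q.2.2.1) - (q.1.1.1 - q.1.2.1),
      q.1.1.1 * (q.2.1.1 - q.2.2.1) - q.2.1.1 * (q.1.1.1 - q.1.2.1)) with hL₃
  have hDne : ∀ q ∈ D, q.1.1 ∈ A ∧ q.1.2 ∈ A ∧ q.2.1 ∈ A ∧ q.2.2 ∈ A ∧ q.1 ≠ q.2 := by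
    intro q hq
    simp only [hD, hP, mem_filter, mem_product] at hq
    tauto
  obtain ⟨a, c, hac⟩ := exists_generic_pair (L₁ ∪ L₂ ∪ L₃) (by
    intro l hl
    simp only [mem_union] at hl
    rcases hl with (hl | hl) | hl
    · obtain ⟨v, -, rfl⟩ := mem_image.1 hl
      exact Or.inl one_ne_zero
    · obtain ⟨q, hq, rfl⟩ := mem_image.1 hl
      obtain ⟨h1, h2, h3, h4, hne⟩ := hDne q hq
      by_contra! h0
      simp only at h0
      have e1 := hA2 h1 h3 (sub_eq_zero.1 h0.1)
      refine hne (Prod.ext e1 (hA2 h2 h4 ?_))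
      linear_combination h0.1 - h0.2
    · obtain ⟨q, hq, rfl⟩ := mem_image.1 hl
      obtain ⟨h1, h2, h3, h4, hne⟩ := hDne q hq
      by_contra! h0
      simp only at h0
      have e1 := hA1 h3 h1 (sub_eq_zero.1 h0.1)
      refine hne (Prod.ext e1.symm (hA1 h2 h4 ?_))
      linear_combination h0.2 - h0.1)
  have ha : ∀ v ∈ P, v.1.1 - v.2.1 + a ≠ 0 := by
    intro v hv h
    refine hac _ (mem_union_left _ (mem_union_left _ (mem_image_of_mem _ hv))) ?_
    simp only
    linear_combination h
  refine ⟨a, c, ha, ?_, ?_⟩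
  · intro u hu v hv h
    by_contra hne
    have hq : (u, v) ∈ D := mem_filter.2 ⟨mem_product.2 ⟨hu, hv⟩, hne⟩
    refine hac _ (mem_union_left _ (mem_union_right _ (mem_image_of_mem _ hq))) ?_
    simp only [redOf] at h ⊢
    linear_combination -h
  · intro u hu v hv h
    by_contra hne
    have hq : (u, v) ∈ D := mem_filter.2 ⟨mem_product.2 ⟨hu, hv⟩, hne⟩
    refine hac _ (mem_union_right _ (mem_image_of_mem _ hq)) ?_
    simp only [blueOf] at h ⊢
    rw [div_eq_div_iff (ha u hu) (ha v hv)] at h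
    linear_combination h

/-- The number of correspondences by reflections between segments of a family. -/
theorem card_reflections_le [Infinite K] (p : ℕ) [CharP K p] (A : Finset (K × K))
    (hA1 : Set.InjOn Prod.fst (A : Set (K × K))) (hA2 : Set.InjOn Prod.snd (A : Set (K × K)))
    (E₀ : Finset ((K × K) × (K × K))) (hE₀ : ∀ e ∈ E₀, e.1 ≠ e.2) (k : ℕ)
    (hk : ∀ κ : K × K × K × K, κ ≠ 0 → ∃ S : Finset (K × K), #S ≤ k ∧
      ∀ e ∈ E₀, OnCircle κ e.1 → OnCircle κ e.2 → e.1 ∈ S ∨ e.2 ∈ S)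
    (U : Finset ((K × K) × (K × K))) (hUA : U ⊆ A ×ˢ A) (hU : ∀ u ∈ U, u.1 ≠ u.2)
    (hUp : #U ≤ p ^ 2) (E : Finset (((K × K) × (K × K)) × ((K × K) × (K × K))))
    (hE : ∀ e ∈ E, e.1 ∈ U ∧ e.2 ∈ U ∧ (e.1.1, e.2.1) ∈ E₀ ∧ HalfReflects e.1 e.2) :
    (#E : ℝ) ≤ 200000 * #U * (√(#U) + (k + 2)) := by
  classical
  obtain ⟨a, c, ha, hred, hblue⟩ := exists_generic_encoding A hA1 hA2
  have hred' : Set.InjOn (redOf a c) (U : Set _) := fun u hu v hv h =>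
    hred (hUA hu) (hUA hv) (by simp only [h])
  have hblue' : Set.InjOn (blueOf a c) (U : Set _) := fun u hu v hv h =>
    hblue (hUA hu) (hUA hv) (by simp only [h])
  have hmem : ∀ u ∈ U, u.1 ∈ A ∧ u.2 ∈ A := fun u hu => mem_product.1 (hUA hu)
  set f := fun e : ((K × K) × (K × K)) × ((K × K) × (K × K)) => (redOf a c e.1, blueOf a c e.2)
    with hf
  have hfinj : Set.InjOn f (E : Set _) := by
    intro e he e' he' h
    obtain ⟨h1, h2, -⟩ := hE e he
    obtain ⟨h1', h2', -⟩ := hE e' he'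
    exact Prod.ext (hred' h1 h1' (congrArg Prod.fst h)) (hblue' h2 h2' (congrArg Prod.snd h))
  have key := card_incidences_le p (k + 2) #U hUp (U.image (redOf a c)) (U.image (blueOf a c))
    card_image_le card_image_le ?_ ?_ (E.image f) ?_ ?_ ?_ ?_
  · rw [card_image_of_injOn hfinj] at key
    push_cast at key
    exact key
  · intro x hx y hy h
    obtain ⟨u, hu, rfl⟩ := mem_image.1 hx
    obtain ⟨v, hv, rfl⟩ := mem_image.1 hy
    rw [hred (hUA hu) (hUA hv) h]
  · intro x hx y hy h
    obtain ⟨u, hu, rfl⟩ := mem_image.1 hx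
    obtain ⟨v, hv, rfl⟩ := mem_image.1 hy
    rw [hblue (hUA hu) (hUA hv) h]
  · intro x hx
    obtain ⟨e, he, rfl⟩ := mem_image.1 hx
    exact mem_image_of_mem _ (hE e he).1
  · intro x hx
    obtain ⟨e, he, rfl⟩ := mem_image.1 hx
    exact mem_image_of_mem _ (hE e he).2.1
  · intro x hx
    obtain ⟨e, he, rfl⟩ := mem_image.1 hx
    obtain ⟨-, h2, -, h4⟩ := hE e he
    exact (meets_redOf_blueOf_iff a c e.1 e.2 (ha _ (hUA h2))).2 h4
  · intro U₀ V₀ hUV E' hE'E hE'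
    set U₁ := {u ∈ U | redOf a c u ∈ U₀} with hU₁
    set V₁ := {u ∈ U | blueOf a c u ∈ V₀} with hV₁
    set E₁ := {e ∈ E | f e ∈ E'} with hE₁
    have hE₁card : #E' ≤ #E₁ := by
      refine (card_le_card fun x hx => ?_).trans (card_image_le (s := E₁) (f := f))
      obtain ⟨e, he, rfl⟩ := mem_image.1 (hE'E hx)
      exact mem_image_of_mem _ (mem_filter.2 ⟨he, hx⟩)
    have hU₁card : #U₁ ≤ #U₀ := card_le_card_of_injOn _ (fun u hu => (mem_filter.1 hu).2)
      (hred'.mono (coe_subset.2 (filter_subset _ _)))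
    have hV₁card : #V₁ ≤ #V₀ := card_le_card_of_injOn _ (fun u hu => (mem_filter.1 hu).2)
      (hblue'.mono (coe_subset.2 (filter_subset _ _)))
    refine hE₁card.trans ((card_le_of_complete_reflections A hA1 hA2 E₀ hE₀ k hk U₁ V₁ ?_ ?_ ?_ ?_
      E₁ ?_).trans (Nat.mul_le_mul_left _ (Nat.add_le_add hU₁card hV₁card)))
    · exact fun u hu => hmem u (mem_filter.1 hu).1
    · exact fun u hu => hmem u (mem_filter.1 hu).1
    · exact fun u hu => hU u (mem_filter.1 hu).1
    · intro u hu v hv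
      obtain ⟨-, hu⟩ := mem_filter.1 hu
      obtain ⟨hvU, hv⟩ := mem_filter.1 hv
      exact (meets_redOf_blueOf_iff a c u v (ha _ (hUA hvU))).1 (hUV _ hu _ hv)
    · intro e he
      obtain ⟨heE, he'⟩ := mem_filter.1 he
      obtain ⟨h1, h2, h3, -⟩ := hE e heE
      exact ⟨mem_filter.2 ⟨h1, (hE' _ he').1⟩, mem_filter.2 ⟨h2, (hE' _ he').2⟩, h3⟩

theorem card_reflections_le_mul (A : Finset (K × K))
    (hA1 : Set.InjOn Prod.fst (A : Set (K × K))) (hA2 : Set.InjOn Prod.snd (A : Set (K × K)))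
    (U : Finset ((K × K) × (K × K))) (hUA : U ⊆ A ×ˢ A)
    (E : Finset (((K × K) × (K × K)) × ((K × K) × (K × K))))
    (hE : ∀ e ∈ E, e.1 ∈ U ∧ e.2 ∈ U ∧ e.1.1 ≠ e.2.1 ∧ HalfReflects e.1 e.2) :
    #E ≤ #U * #A := by
  classical
  rw [← card_product]
  refine card_le_card_of_injOn (fun e => (e.1, e.2.1)) ?_ ?_
  · intro e he
    obtain ⟨h1, h2, -⟩ := hE e he
    exact mem_product.2 ⟨h1, (mem_product.1 (hUA h2)).1⟩
  · rintro ⟨u, v⟩ he ⟨u', v'⟩ he' h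
    obtain ⟨h1, h2, h3, h4⟩ := hE _ he
    obtain ⟨-, h2', -, h4'⟩ := hE _ he'
    simp only [Prod.mk.injEq] at h h1 h2 h3 h4 h2' h4'
    obtain ⟨rfl, h⟩ := h
    have hu := mem_product.1 (hUA h1)
    have hv := mem_product.1 (hUA h2)
    have hv' := mem_product.1 (hUA h2')
    have hD : v.1.2 - u.1.2 ≠ 0 := sub_ne_zero.2 fun h0 => h3 (hA2 hv.1 hu.1 h0).symm
    refine Prod.ext rfl (Prod.ext h (hA1 hv.2 hv'.2 (sub_eq_zero.1 ?_)))
    refine (mul_eq_zero.1 (?_ : (v.1.2 - u.1.2) * _ = 0)).resolve_left hD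
    simp only [HalfReflects, ← h] at h4 h4'
    linear_combination h4' - h4

theorem Reflects.sqDist_eq {u v : (K × K) × (K × K)} (h : Reflects u v)
    (h1 : u.1.1 ≠ v.1.1) (h2 : u.1.2 ≠ v.1.2) : sqDist u.1 u.2 = sqDist v.1 v.2 := by
  obtain ⟨e1, e2⟩ := h
  simp only [HalfReflects] at e1
  simp only [sqDist]
  refine mul_left_cancel₀ (mul_ne_zero (sub_ne_zero.2 h1.symm) (sub_ne_zero.2 h2.symm)) ?_
  linear_combination (v.1.2 - u.1.2) * (u.1.1 - u.2.1) * e1 -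
    (v.1.1 - v.2.1) * (v.1.2 - u.1.2) * e2

theorem sum_sq_card_fiber_le {α β : Type*} [DecidableEq β] (S : Finset α) (f : α → β)
    (R : Finset β) :
    ∑ r ∈ R, #{a ∈ S | f a = r} ^ 2 ≤ #{q ∈ S ×ˢ S | f q.1 = f q.2} := by
  classical
  calc ∑ r ∈ R, #{a ∈ S | f a = r} ^ 2
      = ∑ r ∈ R, #{q ∈ S ×ˢ S | f q.1 = r ∧ f q.2 = r} := by
        refine sum_congr rfl fun r _ => ?_
        rw [sq, ← card_product, ← filter_product]
    _ = #(R.biUnion fun r => {q ∈ S ×ˢ S | f q.1 = r ∧ f q.2 = r}) := by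
        refine (card_biUnion fun r _ r' _ hne => disjoint_left.2 fun q hq hq' => hne ?_).symm
        exact (mem_filter.1 hq).2.1.symm.trans (mem_filter.1 hq').2.1
    _ ≤ _ := by
        refine card_le_card (biUnion_subset.2 fun r _ q hq => ?_)
        obtain ⟨h1, h2, h3⟩ := mem_filter.1 hq
        exact mem_filter.2 ⟨h1, h2.trans h3.symm⟩

open Classical in
/-- Isosceles triples with apex in `B` and base in `A`. -/
noncomputable def isosceles (B A : Finset (K × K)) : Finset ((K × K) × (K × K) × (K × K)) :=
  {t ∈ B ×ˢ (A ×ˢ A) | sqDist t.1 t.2.1 = sqDist t.1 t.2.2}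

open Classical in
theorem card_isosceles (B A : Finset (K × K)) :
    #(isosceles B A) = ∑ b ∈ B, #{q ∈ A ×ˢ A | sqDist b q.1 = sqDist b q.2} := by
  rw [isosceles, card_filter, sum_product]
  exact sum_congr rfl fun b _ => (card_filter _ _).symm

open Classical in
/-- Pairs of pairs in `E₀` with a common axis. -/
noncomputable def axisPairs (E₀ : Finset ((K × K) × (K × K))) :
    Finset (((K × K) × (K × K)) × ((K × K) × (K × K))) :=
  {q ∈ E₀ ×ˢ E₀ | Reflects (q.1.1, q.2.1) (q.1.2, q.2.2)}

open Classical in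
/-- The segments of squared length `r`. -/
noncomputable def segments (A : Finset (K × K)) (r : K) : Finset ((K × K) × (K × K)) :=
  {u ∈ A ×ˢ A | u.1 ≠ u.2 ∧ sqDist u.1 u.2 = r}

theorem sum_sq_card_segments_le (A : Finset (K × K)) (R : Finset K) :
    ∑ r ∈ R, (#(segments A r) : ℝ) ^ 2 ≤ #A * #(isosceles A A) := by
  classical
  have h1 : ∀ r, #(segments A r) ≤ ∑ x ∈ A, #{z ∈ A | sqDist x z = r} := by
    intro r
    calc _ ≤ #{u ∈ A ×ˢ A | sqDist u.1 u.2 = r} :=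
          card_le_card (monotone_filter_right _ fun _ _ h => h.2)
      _ = _ := by
        rw [card_filter, sum_product]
        exact sum_congr rfl fun x _ => (card_filter _ _).symm
  have h2 : ∑ r ∈ R, #(segments A r) ^ 2 ≤ #A * #(isosceles A A) := by
    calc _ ≤ ∑ r ∈ R, #A * ∑ x ∈ A, #{z ∈ A | sqDist x z = r} ^ 2 :=
          sum_le_sum fun r _ => (Nat.pow_le_pow_left (h1 r) 2).trans sq_sum_le_card_mul_sum_sq
      _ = #A * ∑ x ∈ A, ∑ r ∈ R, #{z ∈ A | sqDist x z = r} ^ 2 := by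
          rw [← mul_sum, sum_comm]
      _ ≤ #A * #(isosceles A A) := by
          rw [card_isosceles]
          exact Nat.mul_le_mul_left _ (sum_le_sum fun x _ => sum_sq_card_fiber_le A (sqDist x) R)
  exact_mod_cast h2

theorem sum_card_segments_le (A : Finset (K × K)) (R : Finset K) :
    ∑ r ∈ R, (#(segments A r) : ℝ) ≤ (#A : ℝ) ^ 2 := by
  classical
  have : ∑ r ∈ R, #(segments A r) ≤ #(A ×ˢ A) := by
    rw [← card_biUnion]
    · exact card_le_card (biUnion_subset.2 fun r _ => filter_subset _ _)
    · intro r _ r' _ hne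
      exact disjoint_left.2 fun u hu hu' =>
        hne ((mem_filter.1 hu).2.2.symm.trans (mem_filter.1 hu').2.2)
  rw [card_product, ← sq] at this
  exact_mod_cast this

theorem sum_card_mul_sqrt_segments_le (A : Finset (K × K)) (R : Finset K) :
    ∑ r ∈ R, (#(segments A r) : ℝ) * √(#(segments A r)) ≤ #A * √(#A * #(isosceles A A)) := by
  calc ∑ r ∈ R, (#(segments A r) : ℝ) * √(#(segments A r))
      = ∑ r ∈ R, √(#(segments A r) : ℝ) * √((#(segments A r) : ℝ) ^ 2) := by
        refine sum_congr rfl fun r _ => ?_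
        rw [Real.sqrt_sq (Nat.cast_nonneg _), mul_comm]
    _ ≤ √(∑ r ∈ R, (#(segments A r) : ℝ)) * √(∑ r ∈ R, (#(segments A r) : ℝ) ^ 2) :=
        Real.sum_sqrt_mul_sqrt_le _ (fun _ => Nat.cast_nonneg _) (fun _ => sq_nonneg _)
    _ ≤ √((#A : ℝ) ^ 2) * √(#A * #(isosceles A A)) :=
        mul_le_mul (Real.sqrt_le_sqrt (sum_card_segments_le A R))
          (Real.sqrt_le_sqrt (sum_sq_card_segments_le A R)) (Real.sqrt_nonneg _)
          (Real.sqrt_nonneg _)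
    _ = _ := by rw [Real.sqrt_sq (Nat.cast_nonneg _)]

theorem sum_reflection_bound {ι : Type*} (R : Finset ι) (e n : ι → ℝ) {k N T q : ℝ}
    (hk : 0 ≤ k) (hN : 0 ≤ N) (hq : 0 ≤ q)
    (h : ∀ r ∈ R, e r ≤ 200000 * (n r * √(n r) + k * n r) + n r ^ 2 * N / q)
    (h1 : ∑ r ∈ R, n r ≤ N ^ 2) (h2 : ∑ r ∈ R, n r ^ 2 ≤ N * T)
    (h3 : ∑ r ∈ R, n r * √(n r) ≤ N * √(N * T)) :
    ∑ r ∈ R, e r ≤ 200000 * (N * √(N * T) + k * N ^ 2) + N ^ 2 * T / q := by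
  have hNq : 0 ≤ N / q := by positivity
  calc _ ≤ ∑ r ∈ R, (200000 * (n r * √(n r) + k * n r) + n r ^ 2 * N / q) := sum_le_sum h
    _ = 200000 * (∑ r ∈ R, n r * √(n r) + k * ∑ r ∈ R, n r) + (∑ r ∈ R, n r ^ 2) * (N / q) := by
      rw [sum_add_distrib, ← mul_sum, sum_add_distrib, ← mul_sum, sum_mul]
      congr 1
      exact sum_congr rfl fun r _ => by ring
    _ ≤ 200000 * (N * √(N * T) + k * N ^ 2) + (N * T) * (N / q) := by
      refine add_le_add (mul_le_mul_of_nonneg_left (add_le_add h3 ?_) (by norm_num)) ?_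
      · exact mul_le_mul_of_nonneg_left h1 hk
      · exact mul_le_mul_of_nonneg_right h2 hNq
    _ = _ := by ring

theorem mem_axisPairs {E₀ : Finset ((K × K) × (K × K))}
    {q : ((K × K) × (K × K)) × ((K × K) × (K × K))} :
    q ∈ axisPairs E₀ ↔ (q.1 ∈ E₀ ∧ q.2 ∈ E₀) ∧ Reflects (q.1.1, q.2.1) (q.1.2, q.2.2) := by
  classical
  rw [axisPairs, mem_filter, mem_product]

open Classical in
theorem card_axisPairs_diag_le (A : Finset (K × K))
    (hA1 : Set.InjOn Prod.fst (A : Set (K × K))) (hA2 : Set.InjOn Prod.snd (A : Set (K × K)))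
    (E₀ : Finset ((K × K) × (K × K))) (hE₀A : E₀ ⊆ A ×ˢ A) (hE₀ : ∀ e ∈ E₀, e.1 ≠ e.2) :
    #{q ∈ axisPairs E₀ | q.1.1 = q.2.1} ≤ #A ^ 2 := by
  have hEA : ∀ e ∈ E₀, e.1 ∈ A ∧ e.2 ∈ A := fun e he => mem_product.1 (hE₀A he)
  rw [sq, ← card_product]
  refine card_le_card_of_injOn Prod.fst ?_ ?_
  · exact fun q hq => hE₀A (mem_axisPairs.1 (mem_filter.1 hq).1).1.1
  · have hdiag : ∀ q ∈ ({q ∈ axisPairs E₀ | q.1.1 = q.2.1} : Finset _), q.1 = q.2 := by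
      intro q hq
      obtain ⟨hq1, hq2⟩ := mem_filter.1 hq
      obtain ⟨⟨h1, h2⟩, h3, -⟩ := mem_axisPairs.1 hq1
      have hne : q.1.2.2 - q.1.1.2 ≠ 0 := sub_ne_zero.2 fun h =>
        hE₀ _ h1 (hA2 (hEA _ h1).1 (hEA _ h1).2 h.symm)
      refine Prod.ext hq2 (hA1 (hEA _ h1).2 (hEA _ h2).2 (sub_eq_zero.1 ?_))
      simp only [HalfReflects, ← hq2, sub_self, zero_mul, add_zero] at h3
      exact (mul_eq_zero.1 h3).resolve_right hne
    intro q hq q' hq' h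
    exact Prod.ext h (by rw [← hdiag q hq, ← hdiag q' hq', h])

open Classical in
theorem card_axisPairs_fiber_le [Infinite K] (p : ℕ) [CharP K p] (hp : 0 < p) (A : Finset (K × K))
    (hA1 : Set.InjOn Prod.fst (A : Set (K × K))) (hA2 : Set.InjOn Prod.snd (A : Set (K × K)))
    (E₀ : Finset ((K × K) × (K × K))) (hE₀A : E₀ ⊆ A ×ˢ A) (hE₀ : ∀ e ∈ E₀, e.1 ≠ e.2) (k : ℕ)
    (hk : ∀ κ : K × K × K × K, κ ≠ 0 → ∃ S : Finset (K × K), #S ≤ k ∧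
      ∀ e ∈ E₀, OnCircle κ e.1 → OnCircle κ e.2 → e.1 ∈ S ∨ e.2 ∈ S) (r : K) :
    (#{q ∈ {q ∈ axisPairs E₀ | q.1.1 ≠ q.2.1} | sqDist q.1.1 q.2.1 = r} : ℝ) ≤
      200000 * (#(segments A r) * √(#(segments A r)) + (k + 2) * #(segments A r)) +
        #(segments A r) ^ 2 * #A / p ^ 2 := by
  have hEA : ∀ e ∈ E₀, e.1 ∈ A ∧ e.2 ∈ A := fun e he => mem_product.1 (hE₀A he)
  set f := fun q : ((K × K) × (K × K)) × ((K × K) × (K × K)) =>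
    ((q.1.1, q.2.1), (q.1.2, q.2.2)) with hf
  have hfinj : Function.Injective f := by
    rintro ⟨⟨x, y⟩, z, w⟩ ⟨⟨x', y'⟩, z', w'⟩ h
    simp only [hf, Prod.mk.injEq] at h ⊢
    tauto
  set Er := ({q ∈ {q ∈ axisPairs E₀ | q.1.1 ≠ q.2.1} | sqDist q.1.1 q.2.1 = r} : Finset _).image f with hEr
  have hcard : #{q ∈ {q ∈ axisPairs E₀ | q.1.1 ≠ q.2.1} | sqDist q.1.1 q.2.1 = r} = #Er := (card_image_of_injective _ hfinj).symm
  have hErp : ∀ e ∈ Er, e.1 ∈ segments A r ∧ e.2 ∈ segments A r ∧ (e.1.1, e.2.1) ∈ E₀ ∧ HalfReflects e.1 e.2 := by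
    intro e he
    obtain ⟨q, hq, rfl⟩ := mem_image.1 he
    obtain ⟨hq1, hqr⟩ := mem_filter.1 hq
    obtain ⟨hq2, hne⟩ := mem_filter.1 hq1
    obtain ⟨⟨h1, h2⟩, h3⟩ := mem_axisPairs.1 hq2
    have hD2 : q.1.1.2 ≠ q.1.2.2 := fun h => hE₀ _ h1 (hA2 (hEA _ h1).1 (hEA _ h1).2 h)
    have hD1 : q.1.1.1 ≠ q.1.2.1 := fun h => hE₀ _ h1 (hA1 (hEA _ h1).1 (hEA _ h1).2 h)
    have hX : q.1.1.2 ≠ q.2.1.2 := fun h => hne (hA2 (hEA _ h1).1 (hEA _ h2).1 h)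
    refine ⟨mem_filter.2 ⟨mem_product.2 ⟨(hEA _ h1).1, (hEA _ h2).1⟩, hne, hqr⟩,
      mem_filter.2 ⟨mem_product.2 ⟨(hEA _ h1).2, (hEA _ h2).2⟩, ?_, ?_⟩, h1, h3.1⟩
    · intro hyw
      have h4 := h3.1
      simp only [hf] at hyw
      simp only [HalfReflects, ← hyw, sub_self, zero_mul, zero_add] at h4
      exact (mul_ne_zero (sub_ne_zero.2 hX) (sub_ne_zero.2 hD1.symm)) h4
    · exact (h3.sqDist_eq hD1 hD2).symm.trans hqr
  have hSgA : segments A r ⊆ A ×ˢ A := filter_subset _ _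
  rw [hcard]
  have hp2 : (0 : ℝ) < p ^ 2 := by positivity
  rcases le_or_gt #(segments A r) (p ^ 2) with hle | hgt
  · have := card_reflections_le p A hA1 hA2 E₀ hE₀ k hk (segments A r) hSgA
      (fun u hu => (mem_filter.1 hu).2.1) hle Er hErp
    have h2 : (0 : ℝ) ≤ #(segments A r) ^ 2 * #A / p ^ 2 := by positivity
    linarith
  · have h1 := card_reflections_le_mul A hA1 hA2 (segments A r) hSgA Er fun e he =>
      ⟨(hErp e he).1, (hErp e he).2.1, hE₀ _ (hErp e he).2.2.1, (hErp e he).2.2.2⟩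
    have h2 : (#Er : ℝ) ≤ #(segments A r) * #A := by exact_mod_cast h1
    have h3 : (p ^ 2 : ℝ) ≤ #(segments A r) := by exact_mod_cast hgt.le
    have h4 : (#(segments A r) * #A : ℝ) ≤ #(segments A r) ^ 2 * #A / p ^ 2 := by
      rw [le_div_iff₀ hp2, sq (#(segments A r) : ℝ)]
      calc (#(segments A r) * #A * p ^ 2 : ℝ) ≤ #(segments A r) * #A * #(segments A r) := by gcongr
        _ = _ := by ring
    have h5 : (0 : ℝ) ≤ 200000 * (#(segments A r) * √(#(segments A r)) + (k + 2) * #(segments A r)) := by positivity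
    linarith

open Classical in
/-- Few pairs of pairs have a common axis. -/
theorem card_axisPairs_le [Infinite K] (p : ℕ) [CharP K p] (hp : 0 < p) (A : Finset (K × K))
    (hA1 : Set.InjOn Prod.fst (A : Set (K × K))) (hA2 : Set.InjOn Prod.snd (A : Set (K × K)))
    (E₀ : Finset ((K × K) × (K × K))) (hE₀A : E₀ ⊆ A ×ˢ A) (hE₀ : ∀ e ∈ E₀, e.1 ≠ e.2) (k : ℕ)
    (hk : ∀ κ : K × K × K × K, κ ≠ 0 → ∃ S : Finset (K × K), #S ≤ k ∧
      ∀ e ∈ E₀, OnCircle κ e.1 → OnCircle κ e.2 → e.1 ∈ S ∨ e.2 ∈ S) :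
    (#(axisPairs E₀) : ℝ) ≤ #A ^ 2 + 200000 * (#A * √(#A * #(isosceles A A)) + (k + 2) * #A ^ 2) +
      #A ^ 2 * #(isosceles A A) / p ^ 2 := by
  have hsplit : (#(axisPairs E₀) : ℝ) = #{q ∈ axisPairs E₀ | q.1.1 = q.2.1} +
      #{q ∈ axisPairs E₀ | q.1.1 ≠ q.2.1} := by
    rw [← Nat.cast_add, card_filter_add_card_filter_not]
  have h0 : (#{q ∈ axisPairs E₀ | q.1.1 = q.2.1} : ℝ) ≤ #A ^ 2 := by
    have := card_axisPairs_diag_le A hA1 hA2 E₀ hE₀A hE₀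
    exact_mod_cast this
  have hfib := card_axisPairs_fiber_le p hp A hA1 hA2 E₀ hE₀A hE₀ k hk
  generalize ({q ∈ axisPairs E₀ | q.1.1 ≠ q.2.1} : Finset _) = Q₁ at hsplit hfib
  have hQ₁card : (#Q₁ : ℝ) = ∑ r ∈ Q₁.image fun q => sqDist q.1.1 q.2.1,
      (#{q ∈ Q₁ | sqDist q.1.1 q.2.1 = r} : ℝ) := by
    rw [card_eq_sum_card_image (fun q => sqDist q.1.1 q.2.1) Q₁, Nat.cast_sum]
  generalize (Q₁.image fun q => sqDist q.1.1 q.2.1) = R at hQ₁card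
  have hk0 : (0 : ℝ) ≤ k + 2 := by positivity
  have hQ₁le := sum_reflection_bound R _ (fun r => (#(segments A r) : ℝ)) hk0 (Nat.cast_nonneg #A)
    (sq_nonneg (p : ℝ)) (fun r _ => hfib r) (sum_card_segments_le A R)
    (sum_sq_card_segments_le A R) (sum_card_mul_sqrt_segments_le A R)
  rw [← hQ₁card] at hQ₁le
  linarith

end ReflectionBound

section CircleDecomposition

variable {K : Type*} [Field K]

theorem onCircle_iff_of_three_le {κ κ' : K × K × K × K} (hκ : κ ≠ 0) (hκ' : κ' ≠ 0)
    {C : Finset (K × K)} (hC1 : Set.InjOn Prod.fst (C : Set (K × K)))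
    (hC2 : Set.InjOn Prod.snd (C : Set (K × K))) (hC : 3 ≤ #C) (h : ∀ P ∈ C, OnCircle κ P)
    (h' : ∀ P ∈ C, OnCircle κ' P) (S : K × K) : OnCircle κ S ↔ OnCircle κ' S := by
  obtain ⟨P, hP, Q, hQ, R, hR, hPQ, hPR, hQR⟩ := two_lt_card.1 (show 2 < #C from hC)
  exact onCircle_iff_of_three hκ hκ' (h P hP) (h Q hQ) (h R hR) (h' P hP) (h' Q hQ) (h' R hR)
    (fun e => hPQ (hC2 hP hQ e)) (fun e => hPR (hC2 hP hR e)) (fun e => hQR (hC1 hQ hR e)) S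

/-- Two circles through three common points are concentric. -/
theorem eq_of_sqDist_of_three_le {b b' : K × K} {r r' : K} {C : Finset (K × K)}
    (hC1 : Set.InjOn Prod.fst (C : Set (K × K))) (hC2 : Set.InjOn Prod.snd (C : Set (K × K)))
    (hC : 3 ≤ #C) (h : ∀ P ∈ C, sqDist b P = r) (h' : ∀ P ∈ C, sqDist b' P = r') : b = b' := by
  obtain ⟨P, hP, Q, hQ, R, hR, hPQ, hPR, hQR⟩ := two_lt_card.1 (show 2 < #C from hC)
  have hPQ : P.2 ≠ Q.2 := fun e => hPQ (hC2 hP hQ e)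
  have hPR : P.2 ≠ R.2 := fun e => hPR (hC2 hP hR e)
  have hQR : Q.1 ≠ R.1 := fun e => hQR (hC1 hQ hR e)
  have hb : ∀ S ∈ C, OnCircle (1, -b.2, -b.1, b.1 * b.2 - r) S := fun S hS => by
    have := h S hS
    simp only [OnCircle, sqDist] at this ⊢
    linear_combination this
  have hf : P.2 - b.2 ≠ 0 := fun h0 => by
    have := circle_eq_zero_of_three (by simp only; linear_combination h0) (hb P hP) (hb Q hQ)
      (hb R hR) hPQ hPR hQR
    exact one_ne_zero (congrArg Prod.fst this)
  have hη : ∀ S ∈ C, OnCircle (b.2 - b'.2, (P.2 - b.2) * b'.2 - (P.2 - b'.2) * b.2,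
      (P.2 - b.2) * b'.1 - (P.2 - b'.2) * b.1, (P.2 - b'.2) * (b.1 * b.2 - r) -
        (P.2 - b.2) * (b'.1 * b'.2 - r')) S := fun S hS => by
    have h1 := h S hS
    have h2 := h' S hS
    simp only [OnCircle, sqDist] at h1 h2 ⊢
    linear_combination (P.2 - b'.2) * h1 - (P.2 - b.2) * h2
  have h0 := circle_eq_zero_of_three (by simp only; ring) (hη P hP) (hη Q hQ) (hη R hR)
    hPQ hPR hQR
  have e1 : b.2 - b'.2 = 0 := congrArg Prod.fst h0
  have e2 : (P.2 - b.2) * b'.1 - (P.2 - b'.2) * b.1 = 0 := congrArg (fun t => t.2.2.1) h0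
  refine Prod.ext (sub_eq_zero.1 ?_) (sub_eq_zero.1 e1)
  refine (mul_eq_zero.1 (?_ : (P.2 - b.2) * _ = 0)).resolve_left hf
  linear_combination -e2 - b.1 * e1

open Classical in
/-- Disjoint circular pieces can be removed from a set so as to leave no rich circle. -/
theorem exists_circle_decomposition (k : ℕ) (hk : 3 ≤ k) (A : Finset (K × K))
    (hA1 : Set.InjOn Prod.fst (A : Set (K × K))) (hA2 : Set.InjOn Prod.snd (A : Set (K × K))) :
    ∃ 𝒞 : Finset (Finset (K × K)), (∀ C ∈ 𝒞, C ⊆ A) ∧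
      (∀ C ∈ 𝒞, ∀ C' ∈ 𝒞, C ≠ C' → Disjoint C C') ∧ #𝒞 * k ≤ #A ∧
      (∀ κ : K × K × K × K, κ ≠ 0 → #{P ∈ A | OnCircle κ P ∧ ∀ C ∈ 𝒞, P ∉ C} ≤ k) ∧
      (∀ C ∈ 𝒞, ∃ κ : K × K × K × K, κ ≠ 0 ∧ ∀ P ∈ C, OnCircle κ P) ∧
      (∀ κ : K × K × K × K, κ ≠ 0 → ∀ C ∈ 𝒞, ∀ C' ∈ 𝒞, 3 ≤ #{P ∈ C | OnCircle κ P} →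
        3 ≤ #{P ∈ C' | OnCircle κ P} → C = C') := by
  induction A using Finset.strongInduction with
  | H A ih =>
  by_cases hrich : ∃ κ : K × K × K × K, κ ≠ 0 ∧ k ≤ #{P ∈ A | OnCircle κ P}
  · obtain ⟨κ₀, hκ₀, hcard⟩ := hrich
    set C₀ := {P ∈ A | OnCircle κ₀ P} with hC₀
    have hC₀A : C₀ ⊆ A := filter_subset _ _
    have hne : C₀.Nonempty := card_pos.1 (by omega)
    obtain ⟨𝒞, h1, h2, h3, h4, h5, h6⟩ := ih (A \ C₀) (sdiff_ssubset hC₀A hne)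
      (hA1.mono (coe_subset.2 sdiff_subset)) (hA2.mono (coe_subset.2 sdiff_subset))
    have hdis : ∀ C ∈ 𝒞, Disjoint C₀ C := fun C hC =>
      disjoint_of_subset_right (h1 C hC) disjoint_sdiff
    have hnot : C₀ ∉ 𝒞 := fun h => hne.ne_empty (disjoint_self.1 (hdis _ h))
    have huniq : ∀ κ : K × K × K × K, κ ≠ 0 → ∀ C ∈ 𝒞, 3 ≤ #{P ∈ C₀ | OnCircle κ P} →
        3 ≤ #{P ∈ C | OnCircle κ P} → False := by
      intro κ hκ C hC hc₀ hc
      obtain ⟨P, hP⟩ := card_pos.1 (show 0 < #{P ∈ C | OnCircle κ P} by omega)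
      obtain ⟨hPC, hPκ⟩ := mem_filter.1 hP
      have hsub : ((({P ∈ C₀ | OnCircle κ P} : Finset _)) : Set (K × K)) ⊆ A :=
        coe_subset.2 ((filter_subset _ _).trans hC₀A)
      have := (onCircle_iff_of_three_le hκ hκ₀ (hA1.mono hsub) (hA2.mono hsub) hc₀
        (fun S hS => (mem_filter.1 hS).2)
        (fun S hS => (mem_filter.1 (mem_filter.1 hS).1).2) P).1 hPκ
      exact disjoint_left.1 (hdis C hC)
        (mem_filter.2 ⟨(mem_sdiff.1 (h1 C hC hPC)).1, this⟩) hPC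
    refine ⟨insert C₀ 𝒞, ?_, ?_, ?_, ?_, ?_, ?_⟩
    · intro C hC
      rcases mem_insert.1 hC with rfl | hC
      · exact hC₀A
      · exact (h1 C hC).trans sdiff_subset
    · intro C hC C' hC' hCC
      rcases mem_insert.1 hC with rfl | hC <;> rcases mem_insert.1 hC' with rfl | hC'
      · exact absurd rfl hCC
      · exact hdis C' hC'
      · exact (hdis C hC).symm
      · exact h2 C hC C' hC' hCC
    · rw [card_insert_of_notMem hnot]
      have := card_sdiff_add_card_eq_card hC₀A
      linarith
    · intro κ hκ
      refine (card_le_card fun P hP => ?_).trans (h4 κ hκ)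
      obtain ⟨hPA, hPκ, hPC⟩ := mem_filter.1 hP
      exact mem_filter.2 ⟨mem_sdiff.2 ⟨hPA, hPC _ (mem_insert_self _ _)⟩, hPκ,
        fun C hC => hPC C (mem_insert_of_mem hC)⟩
    · intro C hC
      rcases mem_insert.1 hC with rfl | hC
      · exact ⟨κ₀, hκ₀, fun P hP => (mem_filter.1 hP).2⟩
      · exact h5 C hC
    · intro κ hκ C hC C' hC' hc hc'
      rcases mem_insert.1 hC with rfl | hC <;> rcases mem_insert.1 hC' with rfl | hC'
      · rfl
      · exact (huniq κ hκ C' hC' hc hc').elim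
      · exact (huniq κ hκ C hC hc' hc).elim
      · exact h6 κ hκ C hC C' hC' hc hc'
  · push Not at hrich
    refine ⟨∅, by simp, by simp, by simp, ?_, by simp, by simp⟩
    intro κ hκ
    simpa using (hrich κ hκ).le

open Classical in
theorem card_isosceles_of_circle_le (B C : Finset (K × K))
    (hC1 : Set.InjOn Prod.fst (C : Set (K × K))) (hC2 : Set.InjOn Prod.snd (C : Set (K × K)))
    (hC : ∃ κ : K × K × K × K, κ ≠ 0 ∧ ∀ P ∈ C, OnCircle κ P) :
    #(isosceles B C) ≤ 2 * #C * #B + #C ^ 2 := by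
  obtain ⟨κ, hκ, hκC⟩ := hC
  set Z := {b ∈ B | ∃ r, 3 ≤ #{P ∈ C | sqDist b P = r}} with hZ
  have hκb : ∀ (b : K × K) (r : K), ((1, -b.2, -b.1, b.1 * b.2 - r) : K × K × K × K) ≠ 0 :=
    fun b r h => one_ne_zero (congrArg Prod.fst h)
  have hon : ∀ (b P : K × K) (r : K),
      OnCircle (1, -b.2, -b.1, b.1 * b.2 - r) P ↔ sqDist b P = r := by
    intro b P r
    simp only [OnCircle, sqDist]
    constructor <;> intro h <;> linear_combination h
  have hsub : ∀ b r, (({P ∈ C | sqDist b P = r} : Finset _) : Set (K × K)) ⊆ C :=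
    fun b r => coe_subset.2 (filter_subset _ _)
  have hall : ∀ b r, 3 ≤ #{P ∈ C | sqDist b P = r} → ∀ P ∈ C, sqDist b P = r := by
    intro b r h P hP
    refine (hon b P r).1 ((onCircle_iff_of_three_le (hκb b r) hκ (hC1.mono (hsub b r))
      (hC2.mono (hsub b r)) h (fun S hS => (hon b S r).2 (mem_filter.1 hS).2)
      (fun S hS => hκC S (mem_filter.1 hS).1) P).2 (hκC P hP))
  have hZ1 : #Z ≤ 1 := by
    refine card_le_one.2 fun b hb b' hb' => ?_
    obtain ⟨-, r, hr⟩ := mem_filter.1 hb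
    obtain ⟨-, r', hr'⟩ := mem_filter.1 hb'
    exact eq_of_sqDist_of_three_le hC1 hC2 (hr.trans (card_filter_le _ _)) (hall b r hr)
      (hall b' r' hr')
  have hterm : ∀ b ∈ B, #{q ∈ C ×ˢ C | sqDist b q.1 = sqDist b q.2} ≤
      2 * #C + if b ∈ Z then #C ^ 2 else 0 := by
    intro b hb
    split_ifs with h
    · refine (card_filter_le _ _).trans ?_
      rw [card_product, ← sq]
      exact Nat.le_add_left _ _
    · have hno : ∀ r, #{P ∈ C | sqDist b P = r} ≤ 2 := fun r => by
        by_contra hlt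
        exact h (mem_filter.2 ⟨hb, r, by omega⟩)
      rw [card_filter, sum_product, add_zero]
      calc ∑ x ∈ C, ∑ y ∈ C, (if sqDist b x = sqDist b y then 1 else 0)
          ≤ ∑ x ∈ C, 2 := sum_le_sum fun x _ => by
            rw [← card_filter]
            simpa only [eq_comm] using hno (sqDist b x)
        _ = 2 * #C := by rw [sum_const, smul_eq_mul, mul_comm]
  rw [card_isosceles]
  calc _ ≤ ∑ b ∈ B, (2 * #C + if b ∈ Z then #C ^ 2 else 0) := sum_le_sum hterm
    _ = 2 * #C * #B + #Z * #C ^ 2 := by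
      rw [sum_add_distrib, sum_const, smul_eq_mul, ← sum_filter, sum_const, smul_eq_mul,
        filter_mem_eq_inter, inter_eq_right.2 (filter_subset _ _ : Z ⊆ B)]
      ring
    _ ≤ _ := by nlinarith [Nat.zero_le (#C ^ 2)]

open Classical in
/-- Most pairs of points of `A` satisfy a nondegeneracy condition with respect to circles. -/
theorem exists_nondegenerate_pairs (k m : ℕ) (hk : 3 ≤ k) (A : Finset (K × K))
    (hA1 : Set.InjOn Prod.fst (A : Set (K × K))) (hA2 : Set.InjOn Prod.snd (A : Set (K × K)))
    (hm : #A ≤ m * k) :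
    ∃ E₀ ⊆ A ×ˢ A, (∀ e ∈ E₀, e.1 ≠ e.2) ∧
      (∀ κ : K × K × K × K, κ ≠ 0 → ∃ S : Finset (K × K), #S ≤ k + 2 * m ∧
        ∀ e ∈ E₀, OnCircle κ e.1 → OnCircle κ e.2 → e.1 ∈ S ∨ e.2 ∈ S) ∧
      ∀ B : Finset (K × K),
        #(isosceles B A) ≤ #{t ∈ isosceles B A | t.2 ∈ E₀} + (3 * #A * #B + #A ^ 2) := by
  obtain ⟨𝒞, h1, h2, h3, h4, h5, h6⟩ := exists_circle_decomposition k hk A hA1 hA2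
  have hcard𝒞 : #𝒞 ≤ m := Nat.le_of_mul_le_mul_right (h3.trans hm) (by omega)
  refine ⟨{e ∈ A ×ˢ A | e.1 ≠ e.2 ∧ ∀ C ∈ 𝒞, ¬(e.1 ∈ C ∧ e.2 ∈ C)}, filter_subset _ _,
    fun e he => (mem_filter.1 he).2.1, ?_, ?_⟩
  · intro κ hκ
    set F := {P ∈ A | OnCircle κ P ∧ ∀ C ∈ 𝒞, P ∉ C} with hF
    set 𝒟 := {C ∈ 𝒞 | #{P ∈ C | OnCircle κ P} ≤ 2} with h𝒟
    refine ⟨F ∪ 𝒟.biUnion fun C => {P ∈ C | OnCircle κ P}, ?_, ?_⟩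
    · refine (card_union_le _ _).trans (Nat.add_le_add (h4 κ hκ) ?_)
      refine (card_biUnion_le_card_mul _ _ 2 fun C hC => (mem_filter.1 hC).2).trans ?_
      rw [mul_comm]
      exact Nat.mul_le_mul_left _ ((card_filter_le _ _).trans hcard𝒞)
    · intro e he he1 he2
      by_contra! hcon
      obtain ⟨heA, -, heC⟩ := mem_filter.1 he
      have hbig : ∀ P ∈ A, OnCircle κ P → P ∉ F ∪ 𝒟.biUnion (fun C => {P ∈ C | OnCircle κ P}) →
          ∃ C ∈ 𝒞, P ∈ C ∧ 3 ≤ #{P ∈ C | OnCircle κ P} := by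
        intro P hPA hPκ hP
        rw [mem_union, not_or] at hP
        have : ∃ C ∈ 𝒞, P ∈ C := by
          by_contra! h
          exact hP.1 (mem_filter.2 ⟨hPA, hPκ, h⟩)
        obtain ⟨C, hC, hPC⟩ := this
        refine ⟨C, hC, hPC, ?_⟩
        by_contra hlt
        exact hP.2 (mem_biUnion.2 ⟨C, mem_filter.2 ⟨hC, by omega⟩, mem_filter.2 ⟨hPC, hPκ⟩⟩)
      obtain ⟨C, hC, hC1, hC3⟩ := hbig _ (mem_product.1 heA).1 he1 hcon.1
      obtain ⟨C', hC', hC1', hC3'⟩ := hbig _ (mem_product.1 heA).2 he2 hcon.2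
      obtain rfl := h6 κ hκ C hC C' hC' hC3 hC3'
      exact heC C hC ⟨hC1, hC1'⟩
  · intro B
    set E₀ := {e ∈ A ×ˢ A | e.1 ≠ e.2 ∧ ∀ C ∈ 𝒞, ¬(e.1 ∈ C ∧ e.2 ∈ C)} with hE₀
    have hcover : isosceles B A ⊆ {t ∈ isosceles B A | t.2 ∈ E₀} ∪
        ((B ×ˢ A).image (fun q => (q.1, q.2, q.2)) ∪ 𝒞.biUnion fun C => isosceles B C) := by
      intro t ht
      obtain ⟨htA, hteq⟩ := mem_filter.1 ht
      obtain ⟨htB, htA⟩ := mem_product.1 htA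
      by_cases hE : t.2 ∈ E₀
      · exact mem_union_left _ (mem_filter.2 ⟨ht, hE⟩)
      refine mem_union_right _ ?_
      by_cases hne : t.2.1 = t.2.2
      · refine mem_union_left _ (mem_image.2 ⟨(t.1, t.2.1),
          mem_product.2 ⟨htB, (mem_product.1 htA).1⟩, ?_⟩)
        exact Prod.ext rfl (Prod.ext rfl hne)
      · have : ∃ C ∈ 𝒞, t.2.1 ∈ C ∧ t.2.2 ∈ C := by
          by_contra! h
          exact hE (mem_filter.2 ⟨htA, hne, fun C hC hh => h C hC hh.1 hh.2⟩)
        obtain ⟨C, hC, hh⟩ := this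
        exact mem_union_right _ (mem_biUnion.2 ⟨C, hC,
          mem_filter.2 ⟨mem_product.2 ⟨htB, mem_product.2 hh⟩, hteq⟩⟩)
    have hsum : ∑ C ∈ 𝒞, #C ≤ #A := by
      rw [← card_biUnion h2]
      exact card_le_card (biUnion_subset.2 h1)
    refine (card_le_card hcover).trans ((card_union_le _ _).trans (Nat.add_le_add_left ?_ _))
    refine (card_union_le _ _).trans ?_
    have hdiag : #((B ×ˢ A).image (fun q => (q.1, q.2, q.2))) ≤ #B * #A :=
      card_image_le.trans (card_product _ _).le
    have hcirc : #(𝒞.biUnion fun C => isosceles B C) ≤ 2 * #A * #B + #A ^ 2 := by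
      calc _ ≤ ∑ C ∈ 𝒞, #(isosceles B C) := card_biUnion_le
        _ ≤ ∑ C ∈ 𝒞, (2 * #C * #B + #C * #A) := sum_le_sum fun C hC => by
            refine (card_isosceles_of_circle_le B C (hA1.mono (coe_subset.2 (h1 C hC)))
              (hA2.mono (coe_subset.2 (h1 C hC))) (h5 C hC)).trans ?_
            rw [sq]
            exact Nat.add_le_add_left (Nat.mul_le_mul_left _ (card_le_card (h1 C hC))) _
        _ = (∑ C ∈ 𝒞, #C) * (2 * #B + #A) := by
            rw [sum_mul]
            exact sum_congr rfl fun C _ => by ring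
        _ ≤ #A * (2 * #B + #A) := Nat.mul_le_mul_right _ hsum
        _ = _ := by ring
    linarith

end CircleDecomposition

section WeightedIncidence

variable {F : Type*} [Field F] [Fintype F] [DecidableEq F]

/-- The number of points of `B` on the line with coefficients `v`. -/
def lineCount (B : Finset (F × F)) (v : F × F × F) : ℕ :=
  #{b ∈ B | b.1 * v.1 + b.2 * v.2.1 + v.2.2 = 0}

theorem card_lines_through (b : F × F) :
    #{v : F × F × F | b.1 * v.1 + b.2 * v.2.1 + v.2.2 = 0} = Fintype.card F ^ 2 := by
  rw [sq, ← Fintype.card_prod, ← card_univ]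
  refine card_bij' (fun v _ => (v.1, v.2.1)) (fun w _ => (w.1, w.2, -(b.1 * w.1 + b.2 * w.2)))
    (fun _ _ => mem_univ _) (fun w _ => ?_) (fun v hv => ?_) (fun _ _ => rfl)
  · simp
  · have := (mem_filter.1 hv).2
    refine Prod.ext rfl (Prod.ext rfl ?_)
    simp only
    linear_combination -this

theorem card_lines_through_two_le {b b' : F × F} (h : b ≠ b') :
    #{v : F × F × F | b.1 * v.1 + b.2 * v.2.1 + v.2.2 = 0 ∧
      b'.1 * v.1 + b'.2 * v.2.1 + v.2.2 = 0} ≤ Fintype.card F := by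
  rw [← card_univ]
  by_cases h1 : b.1 = b'.1
  · have h2 : b.2 - b'.2 ≠ 0 := sub_ne_zero.2 fun h2 => h (Prod.ext h1 h2)
    refine card_le_card_of_injOn (fun v => v.1) (fun _ _ => mem_univ _) ?_
    intro v hv w hw hvw
    obtain ⟨-, e1, e2⟩ := mem_filter.1 hv
    obtain ⟨-, e3, e4⟩ := mem_filter.1 hw
    simp only at hvw
    have e5 : v.2.1 = w.2.1 := by
      refine mul_left_cancel₀ h2 ?_
      linear_combination e1 - e2 - e3 + e4 - (b.1 - b'.1) * hvw
    refine Prod.ext hvw (Prod.ext e5 ?_)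
    linear_combination e1 - e3 - b.1 * hvw - b.2 * e5
  · have h1 : b.1 - b'.1 ≠ 0 := sub_ne_zero.2 h1
    refine card_le_card_of_injOn (fun v => v.2.1) (fun _ _ => mem_univ _) ?_
    intro v hv w hw hvw
    obtain ⟨-, e1, e2⟩ := mem_filter.1 hv
    obtain ⟨-, e3, e4⟩ := mem_filter.1 hw
    simp only at hvw
    have e5 : v.1 = w.1 := by
      refine mul_left_cancel₀ h1 ?_
      linear_combination e1 - e2 - e3 + e4 - (b.2 - b'.2) * hvw
    refine Prod.ext e5 (Prod.ext hvw ?_)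
    linear_combination e1 - e3 - b.2 * hvw - b.1 * e5

theorem sum_lineCount (B : Finset (F × F)) :
    ∑ v, lineCount B v = #B * Fintype.card F ^ 2 := by
  simp only [lineCount, card_filter]
  rw [sum_comm, card_eq_sum_ones, sum_mul]
  refine sum_congr rfl fun b _ => ?_
  rw [← card_filter, card_lines_through, one_mul]

theorem sum_lineCount_sq_le (B : Finset (F × F)) :
    ∑ v, lineCount B v ^ 2 ≤ #B * Fintype.card F ^ 2 + #B ^ 2 * Fintype.card F := by
  have h1 : ∀ v, lineCount B v ^ 2 = ∑ b ∈ B, ∑ b' ∈ B,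
      if b.1 * v.1 + b.2 * v.2.1 + v.2.2 = 0 ∧ b'.1 * v.1 + b'.2 * v.2.1 + v.2.2 = 0
      then 1 else 0 := by
    intro v
    rw [lineCount, sq, card_filter, sum_mul_sum]
    refine sum_congr rfl fun b _ => sum_congr rfl fun b' _ => ?_
    split_ifs <;> simp_all
  simp only [h1]
  rw [sum_comm]
  calc _ = ∑ b ∈ B, ∑ b' ∈ B, #{v : F × F × F | b.1 * v.1 + b.2 * v.2.1 + v.2.2 = 0 ∧
        b'.1 * v.1 + b'.2 * v.2.1 + v.2.2 = 0} := by
        refine sum_congr rfl fun b _ => ?_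
        rw [sum_comm]
        exact sum_congr rfl fun b' _ => (card_filter _ _).symm
    _ ≤ ∑ b ∈ B, ∑ b' ∈ B, ((if b = b' then Fintype.card F ^ 2 else 0) + Fintype.card F) := by
        refine sum_le_sum fun b _ => sum_le_sum fun b' _ => ?_
        split_ifs with h
        · subst h
          simp only [and_self, card_lines_through, le_add_iff_nonneg_right, zero_le]
        · simpa using card_lines_through_two_le h
    _ = _ := by
        simp only [sum_add_distrib, sum_ite_eq, sum_const, smul_eq_mul]
        rw [← sum_filter, filter_true_of_mem (fun _ h => h), sum_const, smul_eq_mul]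
        ring

theorem sum_lineCount_sub_sq_le (B : Finset (F × F)) :
    ∑ v, ((lineCount B v : ℝ) - #B / Fintype.card F) ^ 2 ≤ #B * Fintype.card F ^ 2 := by
  have hq : (Fintype.card F : ℝ) ≠ 0 := Nat.cast_ne_zero.2 Fintype.card_ne_zero
  have h1 : ∑ v, (lineCount B v : ℝ) = #B * Fintype.card F ^ 2 := by
    exact_mod_cast sum_lineCount B
  have h2 : ∑ v, (lineCount B v : ℝ) ^ 2 ≤ #B * Fintype.card F ^ 2 + #B ^ 2 * Fintype.card F := by
    exact_mod_cast sum_lineCount_sq_le B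
  have h3 : ∑ v, ((lineCount B v : ℝ) - #B / Fintype.card F) ^ 2 =
      ∑ v, (lineCount B v : ℝ) ^ 2 - 2 * (#B / Fintype.card F) * ∑ v, (lineCount B v : ℝ) +
        Fintype.card F ^ 3 * (#B / Fintype.card F) ^ 2 := by
    rw [mul_sum, ← sum_sub_distrib]
    have : (Fintype.card F : ℝ) ^ 3 * (#B / Fintype.card F) ^ 2 =
        ∑ _v : F × F × F, ((#B : ℝ) / Fintype.card F) ^ 2 := by
      rw [sum_const, card_univ, Fintype.card_prod, Fintype.card_prod, nsmul_eq_mul]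
      push_cast
      ring
    rw [this, ← sum_add_distrib]
    exact sum_congr rfl fun v _ => by ring
  rw [h3, h1]
  have h4 : 2 * ((#B : ℝ) / Fintype.card F) * (#B * Fintype.card F ^ 2) =
      2 * (#B ^ 2 * Fintype.card F) := by field_simp
  have h5 : (Fintype.card F : ℝ) ^ 3 * (#B / Fintype.card F) ^ 2 = #B ^ 2 * Fintype.card F := by
    field_simp
  rw [h4, h5]
  linarith

/-- The line with coefficients `v`, rescaled. -/
def scaleLine (c : F) (v : F × F × F) : F × F × F := (c * v.1, c * v.2.1, c * v.2.2)

theorem lineCount_scaleLine {G : Type*} [Field G] [DecidableEq G] (B : Finset (G × G)) (c : Gˣ)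
    (v : G × G × G) : lineCount B (scaleLine (c : G) v) = lineCount B v := by
  refine congrArg card (filter_congr fun b _ => ?_)
  simp only [scaleLine]
  rw [← mul_eq_zero_iff_left c.ne_zero (b := b.1 * v.1 + b.2 * v.2.1 + v.2.2)]
  constructor <;> intro h <;> linear_combination h

/-- Incidences between points and a weighted family of lines. -/
theorem sum_lineCount_le {ι : Type*} [DecidableEq ι] (B : Finset (F × F)) (E : Finset ι)
    (V : ι → F × F × F) (hV : ∀ e ∈ E, V e ≠ 0) (Q : Finset (ι × ι))
    (hQ : ∀ e ∈ E, ∀ e' ∈ E, ∀ c : Fˣ, V e = scaleLine (c : F) (V e') → (e, e') ∈ Q) :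
    ∑ e ∈ E, (lineCount B (V e) : ℝ) ≤
      #B * #E / Fintype.card F + √(2 * Fintype.card F * #B * #Q) := by
  set q := Fintype.card F with hq
  have hq2 : 2 ≤ q := Fintype.one_lt_card
  set S : Finset (Fˣ × ι) := univ ×ˢ E with hS
  set f : Fˣ × ι → F × F × F := fun s => scaleLine s.1 (V s.2) with hf
  set w : F × F × F → ℝ := fun v => #{s ∈ S | f s = v} with hw
  set g : F × F × F → ℝ := fun v => (lineCount B v : ℝ) - #B / q with hg
  have hU : (Fintype.card Fˣ : ℝ) = q - 1 := by
    rw [Fintype.card_units, Nat.cast_sub (by omega), Nat.cast_one]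
  have hq2' : (2 : ℝ) ≤ q := by exact_mod_cast hq2
  have hsum : ∑ v, w v * g v = (q - 1) * ∑ e ∈ E, g (V e) := by
    calc ∑ v, w v * g v = ∑ v, ∑ s ∈ S with f s = v, g (f s) := by
          refine sum_congr rfl fun v _ => ?_
          rw [sum_congr rfl (g := fun _ => g v) fun s hs => by rw [(mem_filter.1 hs).2],
            sum_const, nsmul_eq_mul]
      _ = ∑ s ∈ S, g (f s) := sum_fiberwise _ _ _
      _ = ∑ _c : Fˣ, ∑ e ∈ E, g (V e) := by
          rw [hS, sum_product]
          refine sum_congr rfl fun c _ => sum_congr rfl fun e _ => ?_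
          simp only [hg, hf, lineCount_scaleLine]
      _ = _ := by rw [sum_const, card_univ, nsmul_eq_mul, hU]
  have hwsq : ∑ v, w v ^ 2 ≤ (q - 1) * #Q := by
    have h1 : ∑ v, #{s ∈ S | f s = v} ^ 2 ≤ #((univ : Finset Fˣ) ×ˢ Q) := by
      refine (sum_sq_card_fiber_le S f univ).trans ?_
      refine card_le_card_of_injOn (fun t => (t.1.1, (t.1.2, t.2.2))) ?_ ?_
      · rintro ⟨⟨c, e⟩, c', e'⟩ ht
        obtain ⟨ht, heq⟩ := mem_filter.1 ht
        obtain ⟨h1, h2⟩ := mem_product.1 ht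
        refine mem_product.2 ⟨mem_univ _, hQ e (mem_product.1 h1).2 e' (mem_product.1 h2).2
          (c⁻¹ * c') ?_⟩
        simp only [hf, scaleLine, Prod.mk.injEq] at heq
        obtain ⟨e1, e2, e3⟩ := heq
        simp only [scaleLine, Units.val_mul, mul_assoc, ← e1, ← e2, ← e3, Units.inv_mul_cancel_left]
      · rintro ⟨⟨c, e⟩, c', e'⟩ ht ⟨⟨d, i⟩, d', i'⟩ ht' h
        obtain ⟨ht, heq⟩ := mem_filter.1 ht
        obtain ⟨-, heq'⟩ := mem_filter.1 ht'
        have he' := (mem_product.1 (mem_product.1 ht).2).2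
        simp only [Prod.mk.injEq] at h
        obtain ⟨rfl, rfl, rfl⟩ := h
        have h0 := heq.symm.trans heq'
        simp only [hf, scaleLine, Prod.mk.injEq] at h0
        obtain ⟨e1, e2, e3⟩ := h0
        have : c' = d' := by
          by_contra hne
          have hne : (c' : F) - d' ≠ 0 := sub_ne_zero.2 fun h => hne (Units.ext h)
          refine hV e' he' (Prod.ext ?_ (Prod.ext ?_ ?_))
          · exact (mul_eq_zero.1 (show ((c' : F) - d') * _ = 0 by linear_combination e1)).resolve_left hne
          · exact (mul_eq_zero.1 (show ((c' : F) - d') * _ = 0 by linear_combination e2)).resolve_left hne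
          · exact (mul_eq_zero.1 (show ((c' : F) - d') * _ = 0 by linear_combination e3)).resolve_left hne
        rw [this]
    rw [card_product, card_univ] at h1
    rw [← hU]
    have h2 : ∑ v, w v ^ 2 = ((∑ v, #{s ∈ S | f s = v} ^ 2 : ℕ) : ℝ) := by
      push_cast
      rfl
    rw [h2]
    exact_mod_cast h1
  have hcs := sum_mul_sq_le_sq_mul_sq univ w g
  have hgsq := sum_lineCount_sub_sq_le B
  have hG : ∑ e ∈ E, g (V e) ≤ √(2 * q * #B * #Q) := by
    refine Real.le_sqrt_of_sq_le ?_
    have hpos : (0 : ℝ) < (q - 1) ^ 2 := by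
      have : (0 : ℝ) < q - 1 := by linarith
      positivity
    refine le_of_mul_le_mul_left ?_ hpos
    calc ((q : ℝ) - 1) ^ 2 * (∑ e ∈ E, g (V e)) ^ 2 = (∑ v, w v * g v) ^ 2 := by rw [hsum]; ring
      _ ≤ (∑ v, w v ^ 2) * ∑ v, g v ^ 2 := hcs
      _ ≤ ((q - 1) * #Q) * (#B * q ^ 2) := by
          refine mul_le_mul hwsq hgsq (sum_nonneg fun _ _ => sq_nonneg _) ?_
          exact mul_nonneg (by linarith) (Nat.cast_nonneg _)
      _ ≤ (q - 1) ^ 2 * (2 * q * #B * #Q) := by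
          have h1 : (0 : ℝ) ≤ (q - 1) * q * #B * #Q := by
            have : (0 : ℝ) ≤ q - 1 := by linarith
            positivity
          nlinarith
  have : ∑ e ∈ E, g (V e) = ∑ e ∈ E, (lineCount B (V e) : ℝ) - #B * #E / q := by
    simp only [hg]
    rw [sum_sub_distrib, sum_const, nsmul_eq_mul]
    ring
  linarith

end WeightedIncidence

section Isotropic

variable {F K : Type*} [Field F] [Field K] [Algebra F K]

/-- Isotropic coordinates of a point of the plane, with respect to a square root `i` of `-1`. -/
def isotropic (i : K) (x : F × F) : K × K :=
  (algebraMap F K x.1 + i * algebraMap F K x.2, algebraMap F K x.1 - i * algebraMap F K x.2)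

theorem sqDist_isotropic {i : K} (hi : i ^ 2 = -1) (x y : F × F) :
    sqDist (isotropic i x) (isotropic i y) =
      algebraMap F K ((x.1 - y.1) ^ 2 + (x.2 - y.2) ^ 2) := by
  simp only [sqDist, isotropic, map_add, map_sub, map_pow]
  linear_combination -(algebraMap F K x.2 - algebraMap F K y.2) ^ 2 * hi

theorem isotropic_fst_injective {i : K} (hi : i ^ 2 = -1)
    (hF : ∀ a b : F, a ^ 2 + b ^ 2 = 0 → a = 0 ∧ b = 0) :
    Function.Injective fun x : F × F => (isotropic i x).1 := by
  intro x y h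
  simp only [isotropic] at h
  have h0 : algebraMap F K ((x.1 - y.1) ^ 2 + (x.2 - y.2) ^ 2) = 0 := by
    rw [← sqDist_isotropic hi]
    simp only [sqDist, isotropic, h, sub_self, zero_mul]
  obtain ⟨h1, h2⟩ := hF _ _ ((map_eq_zero _).1 h0)
  exact Prod.ext (sub_eq_zero.1 h1) (sub_eq_zero.1 h2)

theorem isotropic_snd_injective {i : K} (hi : i ^ 2 = -1)
    (hF : ∀ a b : F, a ^ 2 + b ^ 2 = 0 → a = 0 ∧ b = 0) :
    Function.Injective fun x : F × F => (isotropic i x).2 := by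
  intro x y h
  simp only [isotropic] at h
  have h0 : algebraMap F K ((x.1 - y.1) ^ 2 + (x.2 - y.2) ^ 2) = 0 := by
    rw [← sqDist_isotropic hi]
    simp only [sqDist, isotropic, h, sub_self, mul_zero]
  obtain ⟨h1, h2⟩ := hF _ _ ((map_eq_zero _).1 h0)
  exact Prod.ext (sub_eq_zero.1 h1) (sub_eq_zero.1 h2)

/-- The coefficients of the perpendicular bisector of a segment. -/
def bisector (e : (F × F) × (F × F)) : F × F × F :=
  (2 * (e.2.1 - e.1.1), 2 * (e.2.2 - e.1.2),
    e.1.1 ^ 2 + e.1.2 ^ 2 - (e.2.1 ^ 2 + e.2.2 ^ 2))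

theorem bisector_ne_zero (h2 : (2 : F) ≠ 0) {e : (F × F) × (F × F)} (he : e.1 ≠ e.2) :
    bisector e ≠ 0 := by
  intro h
  have e1 : 2 * (e.2.1 - e.1.1) = 0 := congrArg Prod.fst h
  have e2 : 2 * (e.2.2 - e.1.2) = 0 := congrArg (fun t => t.2.1) h
  exact he (Prod.ext (sub_eq_zero.1 ((mul_eq_zero.1 e1).resolve_left h2)).symm
    (sub_eq_zero.1 ((mul_eq_zero.1 e2).resolve_left h2)).symm)

theorem sqDist_isotropic_eq_iff {i : K} (hi : i ^ 2 = -1) (b : F × F) (e : (F × F) × (F × F)) :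
    sqDist (isotropic i b) (isotropic i e.1) = sqDist (isotropic i b) (isotropic i e.2) ↔
      b.1 * (bisector e).1 + b.2 * (bisector e).2.1 + (bisector e).2.2 = 0 := by
  rw [sqDist_isotropic hi, sqDist_isotropic hi, (algebraMap F K).injective.eq_iff]
  simp only [bisector]
  constructor <;> intro h <;> linear_combination h

theorem reflects_of_bisector {i : K} (hi : i ^ 2 = -1) (h2 : (2 : F) ≠ 0)
    {e e' : (F × F) × (F × F)} {c : F} (h : bisector e = scaleLine c (bisector e')) :
    Reflects (isotropic i e.1, isotropic i e'.1) (isotropic i e.2, isotropic i e'.2) := by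
  obtain ⟨⟨x₁, x₂⟩, y₁, y₂⟩ := e
  obtain ⟨⟨z₁, z₂⟩, w₁, w₂⟩ := e'
  simp only [bisector, scaleLine, Prod.mk.injEq] at h
  obtain ⟨h1, h2', h3⟩ := h
  have e1 : y₁ = x₁ + c * (w₁ - z₁) := mul_left_cancel₀ h2 (by linear_combination h1)
  have e2 : y₂ = x₂ + c * (w₂ - z₂) := mul_left_cancel₀ h2 (by linear_combination h2')
  subst e1 e2
  have h4 := congrArg (algebraMap F K) h3
  simp only [map_add, map_sub, map_mul, map_pow] at h4
  simp only [Reflects, HalfReflects, isotropic, map_add, map_sub, map_mul]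
  generalize algebraMap F K x₁ = x₁, algebraMap F K x₂ = x₂, algebraMap F K z₁ = z₁,
    algebraMap F K z₂ = z₂, algebraMap F K w₁ = w₁, algebraMap F K w₂ = w₂,
    algebraMap F K c = c at h4 ⊢
  constructor <;> linear_combination
    -h4 - c * (w₂ - z₂) * (x₂ + c * (w₂ - z₂) - w₂ + (x₂ - z₂)) * hi

variable [Fintype F] [DecidableEq F]

open Classical in
theorem card_isosceles_filter_le {i : K} (hi : i ^ 2 = -1) (h2 : (2 : F) ≠ 0)
    (hF : ∀ a b : F, a ^ 2 + b ^ 2 = 0 → a = 0 ∧ b = 0) (A B : Finset (F × F))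
    (E₀ : Finset ((K × K) × (K × K))) (hE₀ : ∀ e ∈ E₀, e.1 ≠ e.2) :
    (#{t ∈ isosceles (B.image (isotropic i)) (A.image (isotropic i)) | t.2 ∈ E₀} : ℝ) ≤
      #B * #A ^ 2 / Fintype.card F + √(2 * Fintype.card F * #B * #(axisPairs E₀)) := by
  have hinj : Function.Injective (isotropic i : F × F → K × K) := fun x y h =>
    isotropic_fst_injective hi hF (congrArg Prod.fst h)
  set j : (F × F) × (F × F) → (K × K) × (K × K) := Prod.map (isotropic i) (isotropic i) with hj
  have hjinj : Function.Injective j := hinj.prodMap hinj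
  set E := {e ∈ A ×ˢ A | j e ∈ E₀} with hE
  set Q := {q ∈ E ×ˢ E | (j q.1, j q.2) ∈ axisPairs E₀} with hQ
  have hQcard : #Q ≤ #(axisPairs E₀) :=
    card_le_card_of_injOn (Prod.map j j) (fun q hq => (mem_filter.1 hq).2)
      (hjinj.prodMap hjinj).injOn
  have hEcard : (#E : ℝ) ≤ #A ^ 2 := by
    have := card_filter_le (A ×ˢ A) (fun e => j e ∈ E₀)
    rw [card_product, ← sq] at this
    exact_mod_cast this
  have key := sum_lineCount_le B E bisector
    (fun e he => bisector_ne_zero h2 fun h =>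
      hE₀ _ (mem_filter.1 he).2 (congrArg (isotropic i) h)) Q
    (fun e he e' he' c h => mem_filter.2 ⟨mem_product.2 ⟨he, he'⟩,
      mem_axisPairs.2 ⟨⟨(mem_filter.1 he).2, (mem_filter.1 he').2⟩,
        reflects_of_bisector hi h2 h⟩⟩)
  have hcount : #{t ∈ isosceles (B.image (isotropic i)) (A.image (isotropic i)) | t.2 ∈ E₀} ≤
      ∑ e ∈ E, lineCount B (bisector e) := by
    calc _ ≤ #((E.sigma fun e => {b ∈ B |
          b.1 * (bisector e).1 + b.2 * (bisector e).2.1 + (bisector e).2.2 = 0}).image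
          fun s => (isotropic i s.2, j s.1)) := by
          refine card_le_card fun t ht => ?_
          obtain ⟨ht, htE⟩ := mem_filter.1 ht
          obtain ⟨ht, heq⟩ := mem_filter.1 ht
          obtain ⟨htB, htA⟩ := mem_product.1 ht
          obtain ⟨t1, t2, t3⟩ := t
          obtain ⟨b, hb, rfl⟩ := mem_image.1 htB
          obtain ⟨x, hx, rfl⟩ := mem_image.1 (mem_product.1 htA).1
          obtain ⟨y, hy, rfl⟩ := mem_image.1 (mem_product.1 htA).2
          refine mem_image.2 ⟨⟨(x, y), b⟩, mem_sigma.2 ⟨mem_filter.2 ⟨mem_product.2 ⟨hx, hy⟩, htE⟩,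
            mem_filter.2 ⟨hb, (sqDist_isotropic_eq_iff hi b (x, y)).1 heq⟩⟩, rfl⟩
      _ ≤ _ := card_image_le
      _ = _ := by
          rw [card_sigma]
          exact sum_congr rfl fun e _ => by rw [lineCount]
  calc (_ : ℝ) ≤ ∑ e ∈ E, (lineCount B (bisector e) : ℝ) := by exact_mod_cast hcount
    _ ≤ _ := key
    _ ≤ _ := by gcongr

open Classical in
/-- The two inequalities relating isosceles triples and pairs of segments with a common axis. -/
theorem exists_axis_count [Infinite K] (p : ℕ) [CharP K p] (hp : Fintype.card F = p) {i : K}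
    (hi : i ^ 2 = -1) (h2 : (2 : F) ≠ 0)
    (hF : ∀ a b : F, a ^ 2 + b ^ 2 = 0 → a = 0 ∧ b = 0) (A : Finset (F × F)) (k m : ℕ)
    (hk : 3 ≤ k) (hm : #A ≤ m * k) :
    ∃ Q : ℝ, 0 ≤ Q ∧
      (∀ T : ℝ, T = #(isosceles (A.image (isotropic i)) (A.image (isotropic i))) →
        Q ≤ #A ^ 2 + 200000 * (#A * √(#A * T) + (k + 2 * m + 2) * #A ^ 2) + #A ^ 2 * T / p ^ 2) ∧
      ∀ B : Finset (F × F), (#(isosceles (B.image (isotropic i)) (A.image (isotropic i))) : ℝ) ≤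
        #B * #A ^ 2 / p + √(2 * p * #B * Q) + (3 * #A * #B + #A ^ 2) := by
  have hinj : Function.Injective (isotropic i : F × F → K × K) := fun x y h =>
    isotropic_fst_injective hi hF (congrArg Prod.fst h)
  have hA1 : Set.InjOn Prod.fst (A.image (isotropic i) : Set (K × K)) := by
    rw [coe_image]
    exact Set.InjOn.image_of_comp (isotropic_fst_injective hi hF).injOn
  have hA2 : Set.InjOn Prod.snd (A.image (isotropic i) : Set (K × K)) := by
    rw [coe_image]
    exact Set.InjOn.image_of_comp (isotropic_snd_injective hi hF).injOn
  have hcard : ∀ B : Finset (F × F), #(B.image (isotropic i : F × F → K × K)) = #B := fun B =>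
    card_image_of_injective _ hinj
  obtain ⟨E₀, hE₀A, hE₀, hS, hB⟩ := exists_nondegenerate_pairs k m hk (A.image (isotropic i))
    hA1 hA2 (by rwa [hcard])
  have hp0 : 0 < p := hp ▸ Fintype.card_pos
  refine ⟨#(axisPairs E₀), Nat.cast_nonneg _, ?_, fun B => ?_⟩
  · rintro T rfl
    have := card_axisPairs_le p hp0 _ hA1 hA2 E₀ hE₀A hE₀ (k + 2 * m) hS
    rw [hcard] at this
    push_cast at this
    exact this
  · have h1 := hB (B.image (isotropic i))
    rw [hcard, hcard] at h1
    have h2 := card_isosceles_filter_le hi h2 hF A B E₀ hE₀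
    rw [hp] at h2
    have h3 : (#(isosceles (B.image (isotropic i)) (A.image (isotropic i))) : ℝ) ≤
      #{t ∈ isosceles (B.image (isotropic i)) (A.image (isotropic i)) | t.2 ∈ E₀} +
        (3 * #A * #B + #A ^ 2) := by exact_mod_cast h1
    linarith

end Isotropic

section Bootstrap

theorem sqrt_mul_le_of_le {P N T s : ℝ} (hP : 0 ≤ P) (hs : 0 ≤ s) (hN : N ≤ 2 * P ^ 5)
    (hT : T = s ^ 2 * P ^ 11) : √(N * T) ≤ 2 * P ^ 8 * s := by
  refine Real.sqrt_le_iff.2 ⟨by positivity, ?_⟩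
  rw [hT]
  calc N * (s ^ 2 * P ^ 11) ≤ (2 * P ^ 5) * (s ^ 2 * P ^ 11) := by gcongr
    _ ≤ (2 * P ^ 8 * s) ^ 2 := by
      have : 0 ≤ P ^ 16 * s ^ 2 := by positivity
      nlinarith

theorem axis_count_upper {P N T Q s k : ℝ} (hP : 1 ≤ P) (hN0 : 0 ≤ N)
    (hN : N ≤ 2 * P ^ 5) (hs : 0 ≤ s) (hT : T = s ^ 2 * P ^ 11) (hk : k ≤ 12 * P ^ 3)
    (hQ : Q ≤ N ^ 2 + 200000 * (N * √(N * T) + k * N ^ 2) + N ^ 2 * T / (P ^ 4) ^ 2) :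
    Q ≤ P ^ 13 * (9600004 + 800000 * s + 4 * s ^ 2) := by
  have hP0 : 0 < P := by linarith
  have hN2 : N ^ 2 ≤ 4 * P ^ 10 := by
    calc N ^ 2 ≤ (2 * P ^ 5) ^ 2 := by gcongr
      _ = _ := by ring
  have hP10 : P ^ 10 ≤ P ^ 13 := pow_le_pow_right₀ hP (by norm_num)
  have h1 : N * √(N * T) ≤ 4 * P ^ 13 * s := by
    calc N * √(N * T) ≤ (2 * P ^ 5) * (2 * P ^ 8 * s) :=
          mul_le_mul hN (sqrt_mul_le_of_le hP0.le hs hN hT) (Real.sqrt_nonneg _) (by positivity)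
      _ = _ := by ring
  have h2 : k * N ^ 2 ≤ 48 * P ^ 13 := by
    calc k * N ^ 2 ≤ (12 * P ^ 3) * (4 * P ^ 10) := by gcongr
      _ = _ := by ring
  have h3 : N ^ 2 * T / (P ^ 4) ^ 2 ≤ 4 * P ^ 13 * s ^ 2 := by
    rw [div_le_iff₀ (by positivity), hT]
    calc N ^ 2 * (s ^ 2 * P ^ 11) ≤ (4 * P ^ 10) * (s ^ 2 * P ^ 11) := by gcongr
      _ = _ := by ring
  linarith

theorem isosceles_count_upper {P N M T Q q r : ℝ} (hP : 1 ≤ P) (hN0 : 0 ≤ N)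
    (hN : N ≤ 2 * P ^ 5) (hM0 : 0 ≤ M) (hM : M ≤ 2 * P ^ 5) (hr : 0 ≤ r)
    (hQ : Q ≤ P ^ 13 * q) (hq : q ≤ r ^ 2)
    (hT : T ≤ M * N ^ 2 / P ^ 4 + √(2 * P ^ 4 * M * Q) + (3 * N * M + N ^ 2)) :
    T ≤ (24 + 2 * r) * P ^ 11 := by
  have hP0 : 0 < P := by linarith
  have hP10 : P ^ 10 ≤ P ^ 11 := pow_le_pow_right₀ hP (by norm_num)
  have hN2 : N ^ 2 ≤ 4 * P ^ 10 := by
    calc N ^ 2 ≤ (2 * P ^ 5) ^ 2 := by gcongr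
      _ = _ := by ring
  have h1 : M * N ^ 2 / P ^ 4 ≤ 8 * P ^ 11 := by
    rw [div_le_iff₀ (by positivity)]
    calc M * N ^ 2 ≤ (2 * P ^ 5) * (4 * P ^ 10) := by gcongr
      _ = _ := by ring
  have h2 : √(2 * P ^ 4 * M * Q) ≤ 2 * P ^ 11 * r := by
    refine Real.sqrt_le_iff.2 ⟨by positivity, ?_⟩
    calc 2 * P ^ 4 * M * Q ≤ 2 * P ^ 4 * M * (P ^ 13 * r ^ 2) := by
          refine mul_le_mul_of_nonneg_left (hQ.trans ?_) (by positivity)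
          gcongr
      _ ≤ 2 * P ^ 4 * (2 * P ^ 5) * (P ^ 13 * r ^ 2) := by gcongr
      _ = _ := by ring
  have h3 : N * M ≤ 4 * P ^ 10 := by
    calc N * M ≤ (2 * P ^ 5) * (2 * P ^ 5) := by gcongr
      _ = _ := by ring
  linarith

theorem axis_count_le {P N T Q k : ℝ} (hP : 1 ≤ P) (hN0 : 0 ≤ N)
    (hN : N ≤ 2 * P ^ 5) (hT0 : 0 ≤ T) (hk : k ≤ 12 * P ^ 3)
    (hQ : Q ≤ N ^ 2 + 200000 * (N * √(N * T) + k * N ^ 2) + N ^ 2 * T / (P ^ 4) ^ 2)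
    (hT : T ≤ N * N ^ 2 / P ^ 4 + √(2 * P ^ 4 * N * Q) + (3 * N * N + N ^ 2)) :
    Q ≤ P ^ 13 * 170000000 := by
  have hP0 : 0 < P := by linarith
  have hP11 : 0 < P ^ 11 := by positivity
  set s := √(T / P ^ 11) with hs
  have hs0 : 0 ≤ s := Real.sqrt_nonneg _
  have hTs : T = s ^ 2 * P ^ 11 := by
    rw [hs, Real.sq_sqrt (by positivity), div_mul_cancel₀ _ hP11.ne']
  have hQs := axis_count_upper hP hN0 hN hs0 hTs hk hQ
  set q := 9600004 + 800000 * s + 4 * s ^ 2 with hq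
  have hq0 : 0 ≤ q := by positivity
  have h1 := isosceles_count_upper hP hN0 hN hN0 hN (Real.sqrt_nonneg q) hQs
    (Real.sq_sqrt hq0).ge hT
  rw [hTs] at h1
  have h2 : s ^ 2 - 24 ≤ 2 * √q := by linarith [le_of_mul_le_mul_right h1 hP11]
  have hs200 : s ≤ 200 := by
    by_contra! hlt
    have hsq : 40000 ≤ s ^ 2 := by nlinarith
    have h3 : (s ^ 2 - 24) ^ 2 ≤ 4 * q := by
      calc (s ^ 2 - 24) ^ 2 ≤ (2 * √q) ^ 2 := by gcongr; linarith
        _ = 4 * q := by rw [mul_pow, Real.sq_sqrt hq0]; norm_num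
    nlinarith
  refine hQs.trans (mul_le_mul_of_nonneg_left ?_ (by positivity))
  rw [hq]
  nlinarith

section

variable {F K : Type*} [Field F] [Field K] [Algebra F K] [Fintype F] [DecidableEq F]

open Classical in
/-- Few isosceles triples in sets of about `p ^ (5 / 4)` points. -/
theorem card_isosceles_le [Infinite K] (p : ℕ) [CharP K p] (hp : Fintype.card F = p) {i : K}
    (hi : i ^ 2 = -1) (h2 : (2 : F) ≠ 0)
    (hF : ∀ a b : F, a ^ 2 + b ^ 2 = 0 → a = 0 ∧ b = 0) {P : ℝ} (hP : 1 ≤ P)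
    (hPp : P ^ 4 = p) (A B : Finset (F × F)) (hA : #A ≤ 2 * P ^ 5) (hB : #B ≤ 2 * P ^ 5) :
    (#(isosceles (B.image (isotropic i)) (A.image (isotropic i))) : ℝ) ≤ 27000 * P ^ 11 := by
  have hP0 : 0 < P := by linarith
  have hP3 : 1 ≤ P ^ 3 := one_le_pow₀ hP
  set k := ⌈P ^ 3⌉₊ + 2 with hk
  set m := ⌈2 * P ^ 2⌉₊ with hm
  have hceil : (⌈P ^ 3⌉₊ : ℝ) < P ^ 3 + 1 := Nat.ceil_lt_add_one (by positivity)
  have hceil1 : 1 ≤ ⌈P ^ 3⌉₊ := Nat.one_le_ceil_iff.2 (by positivity)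
  have hk3 : 3 ≤ k := by omega
  have hkP : (P ^ 3 : ℝ) ≤ k := by
    rw [hk]
    push_cast
    linarith [Nat.le_ceil (P ^ 3)]
  have hmP : (2 * P ^ 2 : ℝ) ≤ m := Nat.le_ceil _
  have hmP' : (m : ℝ) ≤ 2 * P ^ 2 + 1 := (Nat.ceil_lt_add_one (by positivity)).le
  have hP23 : P ^ 2 ≤ P ^ 3 := pow_le_pow_right₀ hP (by norm_num)
  have hk12 : (k : ℝ) + 2 * m + 2 ≤ 12 * P ^ 3 := by
    rw [hk]
    push_cast
    linarith
  have hmk : #A ≤ m * k := by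
    have : (#A : ℝ) ≤ m * k := by
      calc (#A : ℝ) ≤ 2 * P ^ 5 := hA
        _ = (2 * P ^ 2) * P ^ 3 := by ring
        _ ≤ m * k := by gcongr
    exact_mod_cast this
  obtain ⟨Q, -, hQ, hT⟩ := exists_axis_count p hp hi h2 hF A k m hk3 hmk
  rw [← hPp] at hQ hT
  have hQle := axis_count_le hP (Nat.cast_nonneg #A) hA (Nat.cast_nonneg _) hk12 (hQ _ rfl) (hT A)
  have := isosceles_count_upper (r := 13040) hP (Nat.cast_nonneg #A) hA (Nat.cast_nonneg #B) hB
    (by norm_num) hQle (by norm_num) (hT B)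
  exact this.trans (by gcongr; norm_num)

end

end Bootstrap

section DotProducts

theorem sq_card_le_card_image_mul {α β : Type*} [DecidableEq β] (S : Finset α) (f : α → β) :
    (#S : ℝ) ^ 2 ≤ #(S.image f) * #{q ∈ S ×ˢ S | f q.1 = f q.2} := by
  norm_cast
  calc #S ^ 2 = (∑ r ∈ S.image f, #{a ∈ S | f a = r}) ^ 2 := by
        rw [← card_eq_sum_card_image]
    _ ≤ #(S.image f) * ∑ r ∈ S.image f, #{a ∈ S | f a = r} ^ 2 := sq_sum_le_card_mul_sum_sq
    _ ≤ _ := Nat.mul_le_mul_left _ (sum_sq_card_fiber_le S f _)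

/-- Some point of a large set determines many distances to another large set. -/
theorem exists_card_distances_ge (p : ℕ) [Fact p.Prime] (hp4 : p % 4 = 3) {P : ℝ} (hP : 1 ≤ P)
    (hPp : P ^ 4 = p) (A B : Finset (ZMod p × ZMod p)) (hA : #A ≤ 2 * P ^ 5)
    (hA' : P ^ 5 ≤ #A) (hB : #B ≤ 2 * P ^ 5) (hB' : P ^ 5 / 2 ≤ #B) :
    ∃ b ∈ B, (p : ℝ) ≤
      54000 * #(A.image fun a => (b.1 - a.1) ^ 2 + (b.2 - a.2) ^ 2) := by
  classical
  have hP0 : 0 < P := by linarith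
  obtain ⟨i, hi⟩ := IsAlgClosed.exists_pow_nat_eq (-1 : AlgebraicClosure (ZMod p)) two_pos
  have hF : ∀ a b : ZMod p, a ^ 2 + b ^ 2 = 0 → a = 0 ∧ b = 0 := by
    intro a b h
    have hb : b = 0 := by
      by_contra hb
      exact ZMod.mod_four_ne_three_of_sq_eq_neg_sq' hb (eq_neg_of_add_eq_zero_left h) hp4
    refine ⟨?_, hb⟩
    rw [hb] at h
    simpa using h
  have h2 : (2 : ZMod p) ≠ 0 := by
    intro h
    have h' : ((2 : ℕ) : ZMod p) = 0 := by exact_mod_cast h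
    have := Nat.le_of_dvd two_pos ((ZMod.natCast_eq_zero_iff 2 p).1 h')
    omega
  have hinj : Function.Injective (isotropic i : ZMod p × ZMod p → _) := fun x y h =>
    isotropic_fst_injective hi hF (congrArg Prod.fst h)
  have : CharP (AlgebraicClosure (ZMod p)) p := charP_of_injective_algebraMap
    (algebraMap (ZMod p) (AlgebraicClosure (ZMod p))).injective p
  have hT := card_isosceles_le p (ZMod.card p) hi h2 hF hP hPp A B hA hB
  have hBpos : (0 : ℝ) < #B := lt_of_lt_of_le (by positivity) hB'
  have hBne : B.Nonempty := card_pos.1 (by exact_mod_cast hBpos)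
  set f : ZMod p × ZMod p → ZMod p × ZMod p → ZMod p :=
    fun b a => (b.1 - a.1) ^ 2 + (b.2 - a.2) ^ 2 with hf
  have hsum : ∑ b ∈ B, (#{q ∈ A ×ˢ A | f b q.1 = f b q.2} : ℝ) ≤ ∑ _b ∈ B, 54000 * P ^ 6 := by
    have h1 : ∑ b ∈ B, #{q ∈ A ×ˢ A | f b q.1 = f b q.2} =
        #(isosceles (B.image (isotropic i)) (A.image (isotropic i))) := by
      rw [card_isosceles, sum_image hinj.injOn]
      refine sum_congr rfl fun b _ => ?_
      refine card_bij (fun q _ => (isotropic i q.1, isotropic i q.2)) ?_ ?_ ?_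
      · intro q hq
        obtain ⟨hq, heq⟩ := mem_filter.1 hq
        refine mem_filter.2 ⟨mem_product.2 ⟨mem_image_of_mem _ (mem_product.1 hq).1,
          mem_image_of_mem _ (mem_product.1 hq).2⟩, ?_⟩
        rw [sqDist_isotropic hi, sqDist_isotropic hi]
        exact congrArg _ heq
      · intro q _ q' _ h
        exact Prod.ext (hinj (congrArg Prod.fst h)) (hinj (congrArg Prod.snd h))
      · rintro ⟨x, y⟩ hq
        obtain ⟨hq, heq⟩ := mem_filter.1 hq
        obtain ⟨a, ha, rfl⟩ := mem_image.1 (mem_product.1 hq).1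
        obtain ⟨a', ha', rfl⟩ := mem_image.1 (mem_product.1 hq).2
        rw [sqDist_isotropic hi, sqDist_isotropic hi] at heq
        have heq := (algebraMap (ZMod p) (AlgebraicClosure (ZMod p))).injective heq
        exact ⟨(a, a'), mem_filter.2 ⟨mem_product.2 ⟨ha, ha'⟩, heq⟩, rfl⟩
    rw [← Nat.cast_sum, h1, sum_const, nsmul_eq_mul]
    refine hT.trans ?_
    calc 27000 * P ^ 11 = P ^ 5 / 2 * (54000 * P ^ 6) := by ring
      _ ≤ #B * (54000 * P ^ 6) := by gcongr
  obtain ⟨b, hb, hbP⟩ := exists_le_of_sum_le hBne hsum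
  refine ⟨b, hb, ?_⟩
  have hcs := sq_card_le_card_image_mul A (f b)
  have h6 : (0 : ℝ) < P ^ 6 := by positivity
  refine le_of_mul_le_mul_right ?_ h6
  calc (p : ℝ) * P ^ 6 = (P ^ 5) ^ 2 := by rw [← hPp]; ring
    _ ≤ (#A : ℝ) ^ 2 := by gcongr
    _ ≤ #(A.image (f b)) * (54000 * P ^ 6) :=
        hcs.trans (mul_le_mul_of_nonneg_left hbP (Nat.cast_nonneg _))
    _ = _ := by ring

/-- Half of the inversion in the unit circle, composed with the central symmetry. -/
def antiInversion {F : Type*} [Field F] (b : F × F) : F × F :=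
  (-b.1 / (2 * (b.1 ^ 2 + b.2 ^ 2)), -b.2 / (2 * (b.1 ^ 2 + b.2 ^ 2)))

theorem antiInversion_antiInversion {F : Type*} [Field F] (h2 : (2 : F) ≠ 0) {b : F × F}
    (hb : b.1 ^ 2 + b.2 ^ 2 ≠ 0) : antiInversion (antiInversion b) = b := by
  have hn : 2 * ((-b.1 / (2 * (b.1 ^ 2 + b.2 ^ 2))) ^ 2 + (-b.2 / (2 * (b.1 ^ 2 + b.2 ^ 2))) ^ 2) =
      1 / (2 * (b.1 ^ 2 + b.2 ^ 2)) := by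
    field_simp
  refine Prod.ext ?_ ?_
  · simp only [antiInversion]
    rw [hn]
    field_simp
  · simp only [antiInversion]
    rw [hn]
    field_simp

theorem mul_sqDist_antiInversion {F : Type*} [Field F] (h2 : (2 : F) ≠ 0) {b : F × F}
    (hb : b.1 ^ 2 + b.2 ^ 2 ≠ 0) (a : F × F) :
    (b.1 ^ 2 + b.2 ^ 2) * (((antiInversion b).1 - a.1) ^ 2 + ((antiInversion b).2 - a.2) ^ 2) =
      a.1 * b.1 + a.2 * b.2 + (a.1 ^ 2 + a.2 ^ 2) * (b.1 ^ 2 + b.2 ^ 2) + 1 / 4 := by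
  have h4 : (4 : F) ≠ 0 := by
    have : (4 : F) = 2 * 2 := by norm_num
    rw [this]
    exact mul_ne_zero h2 h2
  simp only [antiInversion]
  field_simp
  ring

end DotProducts

/-- there are absolute constants `C, c > 0` such that for any prime
`p ≡ 3 (mod 4)` and `E ⊆ P₃ ⊆ 𝔽_p³`, if `|E| ≥ C p^{5/4}` then `|∏(E)| ≥ c p`. -/
theorem stmt3 :
    ∃ C c : ℝ, 0 < C ∧ 0 < c ∧
      ∀ (p : ℕ), p.Prime → p % 4 = 3 →
        ∀ E : Finset (Fin 3 → ZMod p),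
          (∀ x ∈ E, x 2 = x 0 ^ 2 + x 1 ^ 2) →
          C * (p : ℝ) ^ ((5 : ℝ) / 4) ≤ (E.card : ℝ) →
          c * (p : ℝ) ≤ ((prodSet E).card : ℝ) := by
  refine ⟨2, 1 / 54000, by norm_num, by norm_num, fun p hp hp4 E hE hcard => ?_⟩
  classical
  have : Fact p.Prime := ⟨hp⟩
  have hp3 : (3 : ℝ) ≤ p := by
    have : 3 ≤ p := by omega
    exact_mod_cast this
  set P : ℝ := (p : ℝ) ^ ((1 : ℝ) / 4) with hPdef
  have hP1 : 1 ≤ P := Real.one_le_rpow (by linarith) (by norm_num)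
  have hP0 : 0 < P := by linarith
  have hP4 : P ^ 4 = p := by
    rw [hPdef, ← Real.rpow_natCast, ← Real.rpow_mul (Nat.cast_nonneg p)]
    norm_num
  have hP5 : (p : ℝ) ^ ((5 : ℝ) / 4) = P ^ 5 := by
    rw [hPdef, ← Real.rpow_natCast, ← Real.rpow_mul (Nat.cast_nonneg p)]
    norm_num
  have hP53 : 3 ≤ P ^ 5 := by
    calc (3 : ℝ) ≤ P ^ 4 := by rwa [hP4]
      _ ≤ P ^ 5 := pow_le_pow_right₀ hP1 (by norm_num)
  rw [hP5] at hcard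
  have hceil : (⌈P ^ 5⌉₊ : ℝ) < P ^ 5 + 1 := Nat.ceil_lt_add_one (by positivity)
  have hle : ⌈P ^ 5⌉₊ ≤ #E := by
    have : (⌈P ^ 5⌉₊ : ℝ) ≤ #E := by linarith
    exact_mod_cast this
  obtain ⟨E', hE'E, hE'card⟩ := exists_subset_card_eq hle
  set π : (Fin 3 → ZMod p) → ZMod p × ZMod p := fun x => (x 0, x 1) with hπ
  have hπinj : Set.InjOn π (E' : Set (Fin 3 → ZMod p)) := by
    intro x hx y hy h
    have h0 : x 0 = y 0 := congrArg Prod.fst h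
    have h1 : x 1 = y 1 := congrArg Prod.snd h
    funext j
    fin_cases j
    · exact h0
    · exact h1
    · simp only [Fin.reduceFinMk]
      rw [hE x (hE'E hx), hE y (hE'E hy), h0, h1]
  set A := E'.image π with hA
  have hAcard : #A = ⌈P ^ 5⌉₊ := by rw [hA, card_image_of_injOn hπinj, hE'card]
  have hF : ∀ b : ZMod p × ZMod p, b ≠ 0 → b.1 ^ 2 + b.2 ^ 2 ≠ 0 := by
    intro b hb h
    have hb2 : b.2 = 0 := by
      by_contra hb2
      exact ZMod.mod_four_ne_three_of_sq_eq_neg_sq' hb2 (eq_neg_of_add_eq_zero_left h) hp4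
    refine hb (Prod.ext ?_ hb2)
    rw [hb2] at h
    simpa using h
  have h2 : (2 : ZMod p) ≠ 0 := by
    intro h
    have h' : ((2 : ℕ) : ZMod p) = 0 := by exact_mod_cast h
    have := Nat.le_of_dvd two_pos ((ZMod.natCast_eq_zero_iff 2 p).1 h')
    omega
  set B := (A.erase 0).image antiInversion with hB
  have hBcard : #B = #(A.erase 0) := by
    refine card_image_of_injOn fun b hb b' hb' h => ?_
    rw [← antiInversion_antiInversion h2 (hF b (mem_erase.1 hb).1), h,
      antiInversion_antiInversion h2 (hF b' (mem_erase.1 hb').1)]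
  have hAl : (P ^ 5 : ℝ) ≤ #A := by
    rw [hAcard]
    exact Nat.le_ceil _
  have hAu : (#A : ℝ) ≤ 2 * P ^ 5 := by
    rw [hAcard]
    linarith
  have hBu : (#B : ℝ) ≤ #A := by
    rw [hBcard]
    exact_mod_cast card_le_card (erase_subset _ _)
  have hBl : (#A : ℝ) ≤ #B + 1 := by
    rw [hBcard]
    exact_mod_cast Nat.sub_le_iff_le_add.1 (pred_card_le_card_erase (s := A) (a := 0))
  obtain ⟨b', hb', hD⟩ := exists_card_distances_ge p hp4 hP1 hP4 A B hAu hAl (hBu.trans hAu)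
    (by linarith)
  obtain ⟨b, hb, rfl⟩ := mem_image.1 hb'
  obtain ⟨hb0, hbA⟩ := mem_erase.1 hb
  have hN := hF b hb0
  have hle : #(A.image fun a => ((antiInversion b).1 - a.1) ^ 2 + ((antiInversion b).2 - a.2) ^ 2) ≤
      #(prodSet E) := by
    refine card_le_card_of_injOn (fun t => (b.1 ^ 2 + b.2 ^ 2) * t - 1 / 4) ?_ ?_
    · intro t ht
      obtain ⟨a, ha, rfl⟩ := mem_image.1 ht
      obtain ⟨x, hx, rfl⟩ := mem_image.1 ha
      obtain ⟨y, hy, rfl⟩ := mem_image.1 hbA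
      refine mem_image.2 ⟨(x, y), mem_product.2 ⟨hE'E hx, hE'E hy⟩, ?_⟩
      simp only
      rw [mul_sqDist_antiInversion h2 hN]
      simp only [dotP, Fin.sum_univ_three, hE x (hE'E hx), hE y (hE'E hy), hπ]
      ring
    · intro t _ t' _ h
      exact mul_left_cancel₀ hN (sub_left_injective h)
  have hle' : (#(A.image fun a => ((antiInversion b).1 - a.1) ^ 2 +
    ((antiInversion b).2 - a.2) ^ 2) : ℝ) ≤ #(prodSet E) := by exact_mod_cast hle
  linarith
end

section
/- There exists an absolute constant C > 0 such that the following holds for all n ≥ 2 and all odd prime powers q. Let X ⊆ 𝔽_q^n and y ∈ X. Then #{(x, z) ∈ X × X : ||x − y|| = ||z − y|| ≠ 0} ≤ C ( |X|²/q + q^n Σ_{r ∈ 𝔽_q \ {0}} | Σ_{m ∈ S_r} X̂(m) χ(y·m) |² + q^n | Σ_{m : ||m|| = 0, m ≠ 0} X̂(m) χ(y·m) |² ). -/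
open Finset

section DotProduct

variable {R : Type*} [CommRing R] {n : ℕ}

lemma nrm_add (a b : Fin n → R) : nrm (a + b) = nrm a + 2 * dotP a b + nrm b := by
  simp only [nrm, dotP, Pi.add_apply, Finset.mul_sum, ← Finset.sum_add_distrib]
  exact Finset.sum_congr rfl fun i _ => by ring

lemma nrm_smul (c : R) (a : Fin n → R) : nrm (c • a) = c ^ 2 * nrm a := by
  simp only [nrm, Pi.smul_apply, smul_eq_mul, Finset.mul_sum]
  exact Finset.sum_congr rfl fun i _ => by ring

lemma dotP_smul_right (c : R) (a b : Fin n → R) : dotP a (c • b) = c * dotP a b := by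
  simp only [dotP, Pi.smul_apply, smul_eq_mul, Finset.mul_sum]
  exact Finset.sum_congr rfl fun i _ => by ring

lemma dotP_add_right (a b c : Fin n → R) : dotP a (b + c) = dotP a b + dotP a c := by
  simp only [dotP, Pi.add_apply, mul_add, Finset.sum_add_distrib]

lemma dotP_sub_left (a b c : Fin n → R) : dotP (a - b) c = dotP a c - dotP b c := by
  simp only [dotP, Pi.sub_apply, sub_mul, Finset.sum_sub_distrib]

lemma dotP_comm (a b : Fin n → R) : dotP a b = dotP b a := by
  simp only [dotP, mul_comm]

lemma dotP_self (a : Fin n → R) : dotP a a = nrm a := rfl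

end DotProduct

section CharacterSums

variable {F : Type*} [Field F] [Fintype F] {χ : AddChar F ℂ} {n : ℕ}

/-- Completing the square. -/
lemma sum_addChar_mul_nrm_sub_dotP (χ : AddChar F ℂ) (h2 : (2 : F) ≠ 0) {s : F} (hs : s ≠ 0)
    (x : Fin n → F) :
    ∑ m : Fin n → F, χ (s * nrm m - dotP x m) =
      χ (-(4 * s)⁻¹ * nrm x) * ∑ m : Fin n → F, χ (s * nrm m) := by
  rw [← Equiv.sum_comp (Equiv.addRight ((2 * s)⁻¹ • x)), Finset.mul_sum]
  refine Finset.sum_congr rfl fun m _ => ?_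
  rw [← AddChar.map_add_eq_mul]
  congr 1
  simp only [Equiv.coe_addRight, nrm_add, nrm_smul, dotP_smul_right, dotP_add_right, dotP_self,
    dotP_comm m x]
  have h4 : (4 : F) ≠ 0 := by
    rw [show (4 : F) = 2 * 2 by norm_num]; exact mul_ne_zero h2 h2
  field_simp
  ring

variable [DecidableEq F]

lemma sum_addChar_mul_dotP (hχ : χ ≠ 1) {c : F} (hc : c ≠ 0) (h : Fin n → F) :
    ∑ m : Fin n → F, χ (c * dotP m h) = if h = 0 then (Fintype.card F : ℂ) ^ n else 0 := by
  have hprod : ∀ m : Fin n → F, χ (c * dotP m h) = ∏ i, χ (m i * (c * h i)) := fun m => by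
    simp_rw [mul_left_comm _ c]
    rw [dotP, Finset.mul_sum]
    exact map_prod χ.toMonoidHom (fun i => Multiplicative.ofAdd (c * (m i * h i))) Finset.univ
  simp_rw [hprod]
  rw [← Fintype.prod_sum (fun i (a : F) => χ (a * (c * h i)))]
  simp_rw [AddChar.sum_mulShift _ (AddChar.IsPrimitive.of_ne_one hχ)]
  split_ifs with h0
  · simp [h0]
  · obtain ⟨i, hi⟩ := Function.ne_iff.mp h0
    exact Finset.prod_eq_zero (Finset.mem_univ i) (by simpa [hc] using hi)

/-- Plancherel's identity for the push-forward along `g` of the weight `w` on `X`. -/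
lemma sum_norm_sq_sum_addChar_mul {ι : Type*} (hχ : χ ≠ 1) (X : Finset ι) (g : ι → F)
    (w : ι → ℂ) :
    ∑ u, ‖∑ x ∈ X, w x * χ (u * g x)‖ ^ 2 =
      Fintype.card F * ∑ t, ‖∑ x ∈ X with g x = t, w x‖ ^ 2 := by
  have hprim := AddChar.IsPrimitive.of_ne_one hχ
  rw [← Complex.ofReal_inj]
  push_cast
  simp_rw [← Complex.mul_conj', map_sum, map_mul, Finset.sum_mul_sum, ← AddChar.map_neg_eq_conj]
  have hterm : ∀ u x x', w x * χ (u * g x) * ((starRingEnd ℂ) (w x') * χ (-(u * g x'))) =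
      w x * (starRingEnd ℂ) (w x') * χ (u * (g x - g x')) := fun u x x' => by
    rw [mul_sub, sub_eq_add_neg, AddChar.map_add_eq_mul]; ring
  have hind : ∀ t, (∑ x ∈ X with g x = t, ∑ x' ∈ X with g x' = t,
        w x * (starRingEnd ℂ) (w x')) =
      ∑ x ∈ X, ∑ x' ∈ X, w x * (starRingEnd ℂ) (w x') *
        if g x = t ∧ g x' = t then 1 else 0 := fun t => by
    rw [Finset.sum_filter]
    refine Finset.sum_congr rfl fun x _ => ?_
    split_ifs with h
    · rw [Finset.sum_filter]
      simp [h]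
    · simp [h]
  simp_rw [hterm, hind]
  rw [Finset.sum_comm, Finset.sum_comm (s := Finset.univ) (t := X), Finset.mul_sum]
  refine Finset.sum_congr rfl fun x _ => ?_
  rw [Finset.sum_comm, Finset.sum_comm (s := Finset.univ) (t := X), Finset.mul_sum]
  refine Finset.sum_congr rfl fun x' _ => ?_
  rw [← Finset.mul_sum, ← Finset.mul_sum, AddChar.sum_mulShift _ hprim]
  by_cases h : g x = g x'
  · simp [h, mul_comm]
  · simp [ite_and, sub_eq_zero, h, Ne.symm h]

lemma norm_sq_sum_addChar_mul_nrm (hχ : χ ≠ 1) (h2 : (2 : F) ≠ 0) {s : F} (hs : s ≠ 0) :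
    ‖∑ m : Fin n → F, χ (s * nrm m)‖ ^ 2 = (Fintype.card F : ℝ) ^ n := by
  rw [← Complex.ofReal_inj]
  push_cast
  rw [← Complex.mul_conj', map_sum, Finset.sum_mul_sum, Finset.sum_comm]
  have hshift : ∀ m' : Fin n → F,
      ∑ m : Fin n → F, χ (s * nrm m) * (starRingEnd ℂ) (χ (s * nrm m')) =
      ∑ h : Fin n → F, χ (s * nrm h) * χ (2 * s * dotP m' h) := fun m' => by
    rw [← Equiv.sum_comp (Equiv.addRight m')]
    refine Finset.sum_congr rfl fun h _ => ?_
    rw [← AddChar.map_neg_eq_conj, ← AddChar.map_add_eq_mul, ← AddChar.map_add_eq_mul]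
    congr 1
    rw [Equiv.coe_addRight, nrm_add, dotP_comm m' h]
    ring
  simp_rw [hshift]
  rw [Finset.sum_comm]
  simp_rw [← Finset.mul_sum, sum_addChar_mul_dotP hχ (mul_ne_zero h2 hs)]
  simp [nrm]

lemma norm_sq_sum_fourierCoef_mul_addChar (hχ : χ ≠ 1) (h2 : (2 : F) ≠ 0) {s : F} (hs : s ≠ 0)
    (X : Finset (Fin n → F)) (y : Fin n → F) :
    (Fintype.card F : ℝ) ^ n *
        ‖∑ m, fourierCoef χ X m * χ (dotP y m) * χ (s * nrm m)‖ ^ 2 =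
      ‖∑ x ∈ X, χ (-(4 * s)⁻¹ * nrm (x - y))‖ ^ 2 := by
  have hq : (Fintype.card F : ℝ) ≠ 0 := by simp
  have hsum : ∑ m, fourierCoef χ X m * χ (dotP y m) * χ (s * nrm m) =
      ((Fintype.card F : ℂ) ^ n)⁻¹ * (∑ m : Fin n → F, χ (s * nrm m)) *
        ∑ x ∈ X, χ (-(4 * s)⁻¹ * nrm (x - y)) := by
    have hterm : ∀ m, fourierCoef χ X m * χ (dotP y m) * χ (s * nrm m) =
        ((Fintype.card F : ℂ) ^ n)⁻¹ * ∑ x ∈ X, χ (s * nrm m - dotP (x - y) m) := fun m => by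
      rw [fourierCoef, mul_assoc, mul_assoc, Finset.sum_mul]
      congr 1
      refine Finset.sum_congr rfl fun x _ => ?_
      rw [← AddChar.map_add_eq_mul, ← AddChar.map_add_eq_mul, dotP_sub_left]
      congr 1
      ring
    simp_rw [hterm]
    rw [← Finset.mul_sum, Finset.sum_comm, mul_assoc]
    congr 1
    rw [Finset.mul_sum]
    refine Finset.sum_congr rfl fun x _ => ?_
    rw [sum_addChar_mul_nrm_sub_dotP χ h2 hs, mul_comm]
  rw [hsum, norm_mul, norm_mul, mul_pow, mul_pow, norm_sq_sum_addChar_mul_nrm hχ h2 hs]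
  simp only [norm_inv, norm_pow, Complex.norm_natCast]
  field_simp

/-- The second moment of the number of points of `X` at given distance from `y` is controlled by
the spherical sums of the Fourier transform. -/
lemma sum_sq_card_filter_nrm_sub_le (hχ : χ ≠ 1) (h2 : (2 : F) ≠ 0) (X : Finset (Fin n → F))
    (y : Fin n → F) :
    ∑ t, (#{x ∈ X | nrm (x - y) = t} : ℝ) ^ 2 ≤
      (#X : ℝ) ^ 2 / Fintype.card F + (Fintype.card F : ℝ) ^ n *
        ∑ r, ‖∑ m ∈ sph F n r, fourierCoef χ X m * χ (dotP y m)‖ ^ 2 := by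
  have hq : (0 : ℝ) < Fintype.card F := by exact_mod_cast Fintype.card_pos
  have h4 : (4 : F) ≠ 0 := by
    rw [show (4 : F) = 2 * 2 by norm_num]; exact mul_ne_zero h2 h2
  have hX := sum_norm_sq_sum_addChar_mul hχ X (fun x => nrm (x - y)) (fun _ => 1)
  have hS := sum_norm_sq_sum_addChar_mul hχ Finset.univ (nrm (n := n))
    (fun m => fourierCoef χ X m * χ (dotP y m))
  simp only [one_mul, Finset.sum_const, nsmul_eq_mul, mul_one, Complex.norm_natCast] at hX
  have hdual : ∑ u ∈ Finset.univ.erase (0 : F), ‖∑ x ∈ X, χ (u * nrm (x - y))‖ ^ 2 =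
      ∑ s ∈ Finset.univ.erase (0 : F), (Fintype.card F : ℝ) ^ n *
        ‖∑ m, fourierCoef χ X m * χ (dotP y m) * χ (s * nrm m)‖ ^ 2 := by
    symm
    refine Finset.sum_nbij' (fun s => -(4 * s)⁻¹) (fun u => -(4 * u)⁻¹) ?_ ?_ ?_ ?_ ?_
    · intro s hs
      simpa [h4] using hs
    · intro s hs
      simpa [h4] using hs
    · intro s hs
      have : s ≠ 0 := by simpa using hs
      field_simp
    · intro s hs
      have : s ≠ 0 := by simpa using hs
      field_simp
    · intro s hs
      exact norm_sq_sum_fourierCoef_mul_addChar hχ h2 (by simpa using hs) X y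
  have hle : ∑ s ∈ Finset.univ.erase (0 : F),
        ‖∑ m, fourierCoef χ X m * χ (dotP y m) * χ (s * nrm m)‖ ^ 2 ≤
      ∑ s, ‖∑ m, fourierCoef χ X m * χ (dotP y m) * χ (s * nrm m)‖ ^ 2 :=
    Finset.sum_le_sum_of_subset_of_nonneg (Finset.erase_subset _ _) fun _ _ _ => by positivity
  rw [← Finset.add_sum_erase _ _ (Finset.mem_univ (0 : F)), hdual, ← Finset.mul_sum] at hX
  simp only [zero_mul, AddChar.map_zero_eq_one, Finset.sum_const, nsmul_eq_mul, mul_one,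
    Complex.norm_natCast] at hX
  rw [hS] at hle
  have hle' := mul_le_mul_of_nonneg_left hle (pow_nonneg hq.le n)
  refine le_of_mul_le_mul_left ?_ hq
  rw [← hX, mul_add, mul_div_cancel₀ _ hq.ne']
  simp only [sph]
  linarith

lemma card_filter_product_eq_ne_zero_le {ι : Type*} (X : Finset ι) (g : ι → F) :
    #{p ∈ X ×ˢ X | g p.1 = g p.2 ∧ g p.1 ≠ 0} ≤ ∑ t, #{x ∈ X | g x = t} ^ 2 := by
  rw [Finset.card_eq_sum_card_fiberwise (f := fun p => g p.1) (t := Finset.univ) (by simp)]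
  refine Finset.sum_le_sum fun t _ => ?_
  rw [sq, ← Finset.card_product]
  refine Finset.card_le_card fun p hp => ?_
  simp only [Finset.mem_filter, Finset.mem_product] at hp ⊢
  obtain ⟨⟨⟨h1, h2⟩, he, -⟩, ht⟩ := hp
  exact ⟨⟨h1, ht⟩, h2, he ▸ ht⟩

lemma norm_sq_sum_sph_zero_le (χ : AddChar F ℂ) (hn : n ≠ 0) (X : Finset (Fin n → F))
    (y : Fin n → F) :
    (Fintype.card F : ℝ) ^ n * ‖∑ m ∈ sph F n 0, fourierCoef χ X m * χ (dotP y m)‖ ^ 2 ≤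
      2 * ((#X : ℝ) ^ 2 / Fintype.card F) + 2 * ((Fintype.card F : ℝ) ^ n *
        ‖∑ m ∈ (sph F n 0).erase 0, fourierCoef χ X m * χ (dotP y m)‖ ^ 2) := by
  have hq : (1 : ℝ) ≤ Fintype.card F := by exact_mod_cast Fintype.card_pos
  have hmem : (0 : Fin n → F) ∈ sph F n 0 := by
    simp only [sph, Finset.mem_filter, Finset.mem_univ, true_and]
    simp [nrm]
  have hzero : ‖fourierCoef χ X 0 * χ (dotP y 0)‖ = #X / (Fintype.card F : ℝ) ^ n := by
    simp [fourierCoef, dotP, div_eq_inv_mul]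
  rw [← Finset.add_sum_erase _ _ hmem]
  set E := ∑ m ∈ (sph F n 0).erase 0, fourierCoef χ X m * χ (dotP y m)
  have htri := norm_add_le (fourierCoef χ X 0 * χ (dotP y 0)) E
  have hsq : ‖fourierCoef χ X 0 * χ (dotP y 0) + E‖ ^ 2 ≤
      2 * (#X / (Fintype.card F : ℝ) ^ n) ^ 2 + 2 * ‖E‖ ^ 2 := by
    rw [← hzero]
    nlinarith [norm_nonneg (fourierCoef χ X 0 * χ (dotP y 0) + E),
      sq_nonneg (‖fourierCoef χ X 0 * χ (dotP y 0)‖ - ‖E‖)]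
  have hpow : (Fintype.card F : ℝ) ^ n * (#X / (Fintype.card F : ℝ) ^ n) ^ 2 ≤
      (#X : ℝ) ^ 2 / Fintype.card F := by
    have : (Fintype.card F : ℝ) ^ n * (#X / (Fintype.card F : ℝ) ^ n) ^ 2 =
        (#X : ℝ) ^ 2 / (Fintype.card F : ℝ) ^ n := by field_simp
    rw [this]
    gcongr
    exact le_self_pow₀ hq hn
  have := mul_le_mul_of_nonneg_left hsq (pow_nonneg (zero_le_one.trans hq) n)
  linarith

end CharacterSums

/-- Lemma 2.3: for `X ⊆ 𝔽_q^n` and `y ∈ X`, the number of pairs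
`(x, z) ∈ X²` with `‖x - y‖ = ‖z - y‖ ≠ 0` is bounded by
`C (|X|²/q + qⁿ Σ_{r ≠ 0} |Σ_{m ∈ S_r} X̂(m) χ(y·m)|² + qⁿ |Σ_{‖m‖=0, m ≠ 0} X̂(m) χ(y·m)|²)`. -/
theorem stmt7 :
    ∃ C : ℝ, 0 < C ∧
      ∀ (n : ℕ), 2 ≤ n →
      ∀ (F : Type) [Field F] [Fintype F] [DecidableEq F],
        Odd (Fintype.card F) →
        ∀ (χ : AddChar F ℂ), χ ≠ 1 →
        ∀ (X : Finset (Fin n → F)) (y : Fin n → F), y ∈ X →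
        ((((X ×ˢ X).filter fun p =>
            nrm (p.1 - y) = nrm (p.2 - y) ∧ nrm (p.1 - y) ≠ 0).card : ℝ)) ≤
          C * ((X.card : ℝ) ^ 2 / (Fintype.card F : ℝ)
            + (Fintype.card F : ℝ) ^ (n : ℕ) *
                ∑ r ∈ (Finset.univ : Finset F) \ {0},
                  ‖∑ m ∈ sph F n r, fourierCoef χ X m * χ (dotP y m)‖ ^ 2
            + (Fintype.card F : ℝ) ^ (n : ℕ) *
                ‖∑ m ∈ (sph F n 0).erase 0, fourierCoef χ X m * χ (dotP y m)‖ ^ 2) := by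
  refine ⟨3, by norm_num, ?_⟩
  intro n hn F _ _ _ hodd χ hχ X y _
  have h2 : (2 : F) ≠ 0 := Ring.two_ne_zero fun hchar =>
    (Nat.not_even_iff_odd.mpr hodd) (Nat.even_iff.mpr (FiniteField.even_card_iff_char_two.mp hchar))
  have hcard := card_filter_product_eq_ne_zero_le X fun x => nrm (x - y)
  have hmoment := sum_sq_card_filter_nrm_sub_le hχ h2 X y
  have hsphere := norm_sq_sum_sph_zero_le χ (by omega : n ≠ 0) X y
  rw [← Finset.add_sum_erase _ (fun r => ‖∑ m ∈ sph F n r, fourierCoef χ X m * χ (dotP y m)‖ ^ 2)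
    (Finset.mem_univ (0 : F)), mul_add] at hmoment
  rw [Finset.sdiff_singleton_eq_erase]
  have hcard' := (Nat.cast_le (α := ℝ)).mpr hcard
  push_cast at hcard'
  have hpos : 0 ≤ (Fintype.card F : ℝ) ^ n * ∑ r ∈ Finset.univ.erase (0 : F),
      ‖∑ m ∈ sph F n r, fourierCoef χ X m * χ (dotP y m)‖ ^ 2 := by positivity
  have hpos' : 0 ≤ (Fintype.card F : ℝ) ^ n *
      ‖∑ m ∈ (sph F n 0).erase 0, fourierCoef χ X m * χ (dotP y m)‖ ^ 2 := by positivity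
  linarith
end
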